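/- Fix an integer n ≥ 2, an integer m ≥ 1, a linear map T: ℝ^n → ℝ^m and δ > 0. Then the spectrum Im*(μ_T) equals the set of all values μ_T(P) where P ranges over proper rigid n-systems of mesh δ on intervals [q₀,∞); it also equals the set of all μ_T(P) where P ranges over proper n-systems, and the set of all μ_T(P) where P ranges over proper generalized n-systems. -/

import Mathlib

open Set Filter

noncomputable section

/-- An `n`-system on the interval `I` (conditions (S1)–(S3)). -/
def IsNSystem (n : ℕ) (I : Set ℝ) (P : ℝ → Fin n → ℝ) : Prop :=
  ∀ q ∈ I,
    ((∀ i, 0 ≤ P q i) ∧ Monotone (P q) ∧ (∑ i, P q i) = q) ∧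
    ∃ ε > 0, ∃ k ℓ : Fin n,
      (∀ t ∈ I ∩ Icc (q - ε) q, P t = P q + Pi.single ℓ (t - q)) ∧
      (∀ t ∈ I ∩ Icc q (q + ε), P t = P q + Pi.single k (t - q)) ∧
      (q ∈ interior I → ℓ < k → ∀ i, ℓ ≤ i → i ≤ k → P q i = P q ℓ)

/-- `f` is, on `H`, convex and piecewise linear with slopes `0` then `1`. -/
def SlopeZeroOneOn (H : Set ℝ) (f : ℝ → ℝ) : Prop :=
  ∃ c v : ℝ, ∀ t ∈ H, f t = v + max (t - c) 0

/-- A generalized `n`-system on `I`: a continuous piecewise linear map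
satisfying (G1), (G2) and (G3). -/
def IsGenNSystem (n : ℕ) (I : Set ℝ) (P : ℝ → Fin n → ℝ) : Prop :=
  ContinuousOn P I ∧
  (∀ q ∈ I, ∃ ε > 0, ∃ a b c d : Fin n → ℝ,
    (∀ t ∈ I ∩ Icc (q - ε) q, ∀ i, P t i = a i * t + b i) ∧
    (∀ t ∈ I ∩ Icc q (q + ε), ∀ i, P t i = c i * t + d i)) ∧
  (∀ q ∈ I, (∀ i, 0 ≤ P q i) ∧ Monotone (P q) ∧ (∑ i, P q i) = q) ∧
  (∀ i : Fin n, MonotoneOn (fun q => P q i) I ∧ LipschitzOnWith 1 (fun q => P q i) I) ∧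
  (∀ j : ℕ, ∀ hj : j + 1 < n, ∀ H : Set ℝ, H ⊆ I → H.OrdConnected →
    (∀ q ∈ H, P q ⟨j, Nat.lt_of_succ_lt hj⟩ < P q ⟨j + 1, hj⟩) →
    SlopeZeroOneOn H fun q => ∑ i : Fin n, if (i : ℕ) ≤ j then P q i else 0)

/-- `P` is proper: its first coordinate (equivalently, by (S1)/(G1), each of its
coordinates) tends to infinity with `q`. -/
def IsProper (n : ℕ) (P : ℝ → Fin n → ℝ) : Prop :=
  ∀ i : Fin n, Tendsto (fun q => P q i) atTop atTop

/-- A rigid `n`-system of mesh `δ` on `[q₀,∞)`. -/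
def IsRigid (n : ℕ) (δ q₀ : ℝ) (P : ℝ → Fin n → ℝ) : Prop :=
  (∃ m : ℤ, q₀ = δ * m) ∧
  (∀ q, q₀ ≤ q → (∃ m : ℤ, q = δ * m) → ∀ i, ∃ m : ℤ, P q i = δ * m) ∧
  Function.Injective (P q₀) ∧
  ∀ q, q₀ < q → (∀ m : ℤ, q ≠ δ * m) → Function.Injective (P q)

open scoped RealInnerProductSpace

/-- The `i`-th successive minimum of the convex body
`C_u(q) = {x : ‖x‖ ≤ 1, |x·u| ≤ e^{-q}}` with respect to `ℤ^n`: the smallest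
`λ ≥ 1` such that `λ C_u(q)` contains `i` linearly independent integer points. -/
def lamMin (n : ℕ) (u : EuclideanSpace ℝ (Fin n)) (q : ℝ) (i : ℕ) : ℝ :=
  sInf {lam : ℝ | 1 ≤ lam ∧ ∃ v : Fin i → EuclideanSpace ℝ (Fin n),
    LinearIndependent ℝ v ∧ ∀ j, (∀ k, ∃ m : ℤ, v j k = (m : ℝ)) ∧
      ‖v j‖ ≤ lam ∧ |⟪v j, u⟫| ≤ lam * Real.exp (-q)}

/-- The map `L_u(q) = (log λ₁(q), …, log λₙ(q))`. -/
def Lu (n : ℕ) (u : EuclideanSpace ℝ (Fin n)) (q : ℝ) : Fin n → ℝ :=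
  fun i => Real.log (lamMin n u q ((i : ℕ) + 1))

/-- `μ_T(P) = (liminf q⁻¹ T₁(P(q)), …, liminf q⁻¹ Tₘ(P(q)))`. -/
def muVec {n m : ℕ} (T : (Fin n → ℝ) → Fin m → ℝ) (P : ℝ → Fin n → ℝ) : Fin m → ℝ :=
  fun i => liminf (fun q : ℝ => T (P q) i / q) atTop

/-- The spectrum `Im*(μ_T)`: the set of values `μ_T(L_u)` over points `u` with
`ℚ`-linearly independent coordinates. -/
def spectrumOf (n m : ℕ) (T : (Fin n → ℝ) →ₗ[ℝ] (Fin m → ℝ)) : Set (Fin m → ℝ) :=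
  {y | ∃ u : EuclideanSpace ℝ (Fin n),
    LinearIndependent ℚ (fun i : Fin n => u i) ∧ y = muVec (fun x => T x) (Lu n u)}


/-! ## Part I: glue -/

theorem liminf_eq_of_sub_tendsto {f g : ℝ → ℝ}
    (h : Tendsto (fun q => f q - g q) atTop (nhds 0)) :
    liminf f atTop = liminf g atTop := by
  have key : ∀ {f g : ℝ → ℝ}, Tendsto (fun q => f q - g q) atTop (nhds 0) → ∀ ε > 0,
      ∀ a, (∀ᶠ q in atTop, a ≤ f q) → (∀ᶠ q in atTop, a - ε ≤ g q) := by
    intro f g h ε hε a ha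
    have h2 : ∀ᶠ q in atTop, f q - g q < ε := h.eventually_lt_const hε
    filter_upwards [ha, h2] with q h3 h4
    linarith
  have h' : Tendsto (fun q => g q - f q) atTop (nhds 0) := by
    have := h.neg
    simpa using this
  rw [liminf_eq, liminf_eq]
  set A := {a | ∀ᶠ q in atTop, a ≤ f q} with hA
  set B := {a | ∀ᶠ q in atTop, a ≤ g q} with hB
  have hAB : ∀ ε > 0, ∀ a ∈ A, a - ε ∈ B := fun ε hε a ha => key h ε hε a ha
  have hBA : ∀ ε > 0, ∀ a ∈ B, a - ε ∈ A := fun ε hε a ha => key h' ε hε a ha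
  have gen : ∀ A B : Set ℝ, (∀ ε > 0, ∀ a ∈ A, a - ε ∈ B) → A.Nonempty → BddAbove B →
      sSup A ≤ sSup B := by
    intro A B hAB hne hbd
    apply le_of_forall_pos_le_add
    intro ε hε
    apply csSup_le hne
    intro a ha
    have := le_csSup hbd (hAB ε hε a ha)
    linarith
  have bd : ∀ A B : Set ℝ, (∀ ε > 0, ∀ a ∈ A, a - ε ∈ B) → BddAbove B → BddAbove A := by
    rintro A B hAB ⟨M, hM⟩
    refine ⟨M + 1, fun a ha => ?_⟩
    have := hM (hAB 1 one_pos a ha)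
    linarith
  by_cases hne : A.Nonempty
  · have hneB : B.Nonempty := by
      obtain ⟨a, ha⟩ := hne
      exact ⟨_, hAB 1 one_pos a ha⟩
    by_cases hb : BddAbove A
    · have hb' := bd _ _ hBA hb
      exact le_antisymm (gen _ _ hAB hne hb') (gen _ _ hBA hneB hb)
    · have hb' : ¬ BddAbove B := fun h => hb (bd _ _ hAB h)
      rw [Real.sSup_of_not_bddAbove hb, Real.sSup_of_not_bddAbove hb']
  · have hneB : ¬ B.Nonempty := by
      rintro ⟨a, ha⟩
      exact hne ⟨_, hBA 1 one_pos a ha⟩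
    rw [Set.not_nonempty_iff_eq_empty] at hne hneB
    rw [hne, hneB]

theorem muVec_congr {n m : ℕ} (T : (Fin n → ℝ) →ₗ[ℝ] (Fin m → ℝ)) {P Q : ℝ → Fin n → ℝ}
    (h : ∀ i, Tendsto (fun q => (P q i - Q q i) / q) atTop (nhds 0)) :
    muVec (fun x => T x) P = muVec (fun x => T x) Q := by
  funext i
  apply liminf_eq_of_sub_tendsto
  have e : (fun q => T (P q) i / q - T (Q q) i / q) =
      fun q => ∑ j, ((P q j - Q q j) / q) * T (Pi.single j 1) i := by
    funext q
    rw [← sub_div, ← Pi.sub_apply, ← map_sub, LinearMap.pi_apply_eq_sum_univ T (P q - Q q),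
      Finset.sum_apply, Finset.sum_div]
    refine Finset.sum_congr rfl fun j _ => ?_
    have : (fun k => if j = k then (1 : ℝ) else 0) = (Pi.single j 1 : Fin n → ℝ) := by
      funext k
      simp [Pi.single_apply, eq_comm]
    rw [this]
    simp only [Pi.smul_apply, Pi.sub_apply, smul_eq_mul]
    ring
  rw [e]
  have := tendsto_finsetSum (Finset.univ : Finset (Fin n)) (fun j _ => (h j).mul_const (T (Pi.single j 1) i))
  simpa using this

/-- sorted rearrangement is controlled by a sorted upper bound -/
theorem sort_le_of_le {n : ℕ} {w F : Fin n → ℝ} {σ : Equiv.Perm (Fin n)}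
    (hσ : Monotone (w ∘ σ)) (hF : Monotone F) {E : ℝ} (h : ∀ j, w j ≤ F j + E) (j : Fin n) :
    w (σ j) ≤ F j + E := by
  by_contra hc
  push Not at hc
  -- the labels `i ≤ j` cannot all lie in positions `< j`
  have hsub : ∀ i : Fin n, i ≤ j → σ.symm i < j := by
    intro i hi
    by_contra hn
    push Not at hn
    have h1 := hσ hn
    simp only [Function.comp, Equiv.apply_symm_apply] at h1
    have h2 := h i
    have h3 := hF hi
    linarith
  have hcard := Finset.card_le_card_of_injOn (s := Finset.Iic j) (t := Finset.Iio j) σ.symm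
    (by intro i hi; simpa using hsub i (by simpa using hi)) (σ.symm.injective.injOn)
  simp at hcard

theorem abs_le_of_sum_eq {n : ℕ} {P F : Fin n → ℝ} {E : ℝ} (hE : 0 ≤ E) (h : ∀ j, P j ≤ F j + E)
    (hs : ∑ j, F j ≤ ∑ j, P j + E) (j : Fin n) : |P j - F j| ≤ (n + 1) * E := by
  have hn : (0 : ℝ) ≤ n := Nat.cast_nonneg n
  rw [abs_le]
  constructor
  · have h1 : ∑ i ∈ Finset.univ.erase j, P i ≤ ∑ i ∈ Finset.univ.erase j, (F i + E) :=
      Finset.sum_le_sum fun i _ => h i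
    rw [Finset.sum_add_distrib] at h1
    have h2 := Finset.add_sum_erase Finset.univ P (Finset.mem_univ j)
    have h3 := Finset.add_sum_erase Finset.univ F (Finset.mem_univ j)
    have h4 : ∑ i ∈ Finset.univ.erase j, E ≤ n * E := by
      rw [Finset.sum_const, nsmul_eq_mul]
      apply mul_le_mul_of_nonneg_right _ hE
      have := Finset.card_erase_le (s := (Finset.univ : Finset (Fin n))) (a := j)
      simp only [Finset.card_univ, Fintype.card_fin] at this
      exact_mod_cast this
    linarith
  · have := h j
    nlinarith

/-! ## Part II: discrete paths and the associated rigid systems -/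

/-- A discrete path: at step `s` the label `k s` rises, all others stay. -/
structure LPath (n : ℕ) where
  lev : ℕ → Fin n → ℕ
  k : ℕ → Fin n
  stay : ∀ s j, j ≠ k s → lev (s + 1) j = lev s j
  rise : ∀ s, lev s (k s) < lev (s + 1) (k s)
  sw : ∀ s, k (s + 1) ≠ k s → lev (s + 1) (k (s + 1)) < lev (s + 1) (k s)
  inj : ∀ s, Function.Injective (lev s)
  prop : ∀ j, Tendsto (fun s => lev s j) atTop atTop

namespace LPath

variable {n : ℕ} (p : LPath n) (δ : ℝ)

def a (s : ℕ) (j : Fin n) : ℝ := δ * (p.lev s j : ℝ) ^ 2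

def τ (s : ℕ) : ℝ := ∑ j, p.a δ s j

theorem a_nonneg (hδ : 0 < δ) (s j) : 0 ≤ p.a δ s j := by
  unfold a; positivity

theorem a_stay (s j) (h : j ≠ p.k s) : p.a δ (s + 1) j = p.a δ s j := by
  unfold a; rw [p.stay s j h]

theorem a_rise (hδ : 0 < δ) (s) : p.a δ s (p.k s) < p.a δ (s + 1) (p.k s) := by
  unfold a
  have := p.rise s
  have h2 : (p.lev s (p.k s) : ℝ) < p.lev (s + 1) (p.k s) := by exact_mod_cast this
  gcongr

theorem a_mono (hδ : 0 < δ) (j) : Monotone (fun s => p.a δ s j) := by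
  apply monotone_nat_of_le_succ
  intro s
  by_cases h : j = p.k s
  · subst h; exact (p.a_rise δ hδ s).le
  · exact (p.a_stay δ s j h).ge

theorem a_succ (s) : p.a δ (s + 1) = p.a δ s + Pi.single (p.k s) (p.τ δ (s + 1) - p.τ δ s) := by
  have h1 : p.τ δ (s + 1) - p.τ δ s = p.a δ (s + 1) (p.k s) - p.a δ s (p.k s) := by
    unfold τ
    rw [← Finset.sum_sub_distrib]
    rw [Finset.sum_eq_single (p.k s)]
    · intro b _ hb
      rw [p.a_stay δ s b hb, sub_self]
    · simp
  funext j
  by_cases h : j = p.k s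
  · subst h; simp [h1]
  · simp [h, p.a_stay δ s j h]

theorem τ_lt_succ (hδ : 0 < δ) (s) : p.τ δ s < p.τ δ (s + 1) := by
  have h1 := congrFun (p.a_succ δ s) (p.k s)
  have h2 := p.a_rise δ hδ s
  simp at h1
  linarith

theorem τ_strictMono (hδ : 0 < δ) : StrictMono (p.τ δ) := strictMono_nat_of_lt_succ (p.τ_lt_succ δ hδ)

theorem a_tendsto (hδ : 0 < δ) (j) : Tendsto (fun s => p.a δ s j) atTop atTop := by
  unfold a
  apply Tendsto.const_mul_atTop hδ
  have h : Tendsto (fun s => (p.lev s j : ℝ)) atTop atTop :=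
    tendsto_natCast_atTop_atTop.comp (p.prop j)
  exact (tendsto_pow_atTop (two_ne_zero)).comp h

theorem a_le_τ (hδ : 0 < δ) (s j) : p.a δ s j ≤ p.τ δ s :=
  Finset.single_le_sum (f := fun j => p.a δ s j) (fun i _ => p.a_nonneg δ hδ s i) (Finset.mem_univ j)

theorem τ_tendsto (hδ : 0 < δ) : Tendsto (p.τ δ) atTop atTop :=
  tendsto_atTop_mono (fun s => p.a_le_τ δ hδ s (p.k 0)) (p.a_tendsto δ hδ (p.k 0))

theorem exists_seg (hδ : 0 < δ) (q) (hq : p.τ δ 0 ≤ q) :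
    ∃ s, p.τ δ s ≤ q ∧ q < p.τ δ (s + 1) := by
  classical
  obtain ⟨N, hN⟩ := ((p.τ_tendsto δ hδ).eventually_gt_atTop q).exists
  have hex : ∃ s, q < p.τ δ (s + 1) := ⟨N, hN.trans (p.τ_lt_succ δ hδ N)⟩
  refine ⟨Nat.find hex, ?_, Nat.find_spec hex⟩
  rcases h : Nat.find hex with _ | s
  · exact hq
  · have := Nat.find_min hex (m := s) (by omega)
    linarith

theorem exists_seg_left (hδ : 0 < δ) (q) (hq : p.τ δ 0 < q) :
    ∃ s, p.τ δ s < q ∧ q ≤ p.τ δ (s + 1) := by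
  obtain ⟨s, h1, h2⟩ := p.exists_seg δ hδ q hq.le
  rcases h1.lt_or_eq with h | h
  · exact ⟨s, h, h2.le⟩
  · rcases s with _ | s
    · linarith
    · exact ⟨s, by rw [← h]; exact p.τ_lt_succ δ hδ s, h.ge⟩

open Classical in
def seg (q : ℝ) : ℕ := if h : ∃ s, p.τ δ s ≤ q ∧ q < p.τ δ (s + 1) then h.choose else 0

/-- position of the labels at time `q` -/
def w (q : ℝ) : Fin n → ℝ :=
  p.a δ (p.seg δ q) + Pi.single (p.k (p.seg δ q)) (q - p.τ δ (p.seg δ q))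

theorem w_eq (hδ : 0 < δ) {s : ℕ} {q : ℝ} (h1 : p.τ δ s ≤ q) (h2 : q ≤ p.τ δ (s + 1)) :
    p.w δ q = p.a δ s + Pi.single (p.k s) (q - p.τ δ s) := by
  have hm := (p.τ_strictMono δ hδ)
  have hseg : ∀ s, p.τ δ s ≤ q → q < p.τ δ (s + 1) → p.seg δ q = s := by
    intro s h1 h2
    have hex : ∃ s, p.τ δ s ≤ q ∧ q < p.τ δ (s + 1) := ⟨s, h1, h2⟩
    unfold seg
    rw [dif_pos hex]
    have h3 := hex.choose_spec
    have h4 := hm.lt_iff_lt.1 (h1.trans_lt h3.2)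
    have h5 := hm.lt_iff_lt.1 (h3.1.trans_lt h2)
    omega
  rcases h2.lt_or_eq with h | h
  · unfold w; rw [hseg s h1 h]
  · unfold w
    rw [hseg (s + 1) h.ge (by rw [h]; exact p.τ_lt_succ δ hδ (s + 1)), h]
    rw [sub_self, Pi.single_zero, add_zero]
    exact p.a_succ δ s

theorem w_τ (hδ : 0 < δ) (s : ℕ) : p.w δ (p.τ δ s) = p.a δ s := by
  rw [p.w_eq δ hδ le_rfl (p.τ_lt_succ δ hδ s).le]; simp

theorem a_le_w (hδ : 0 < δ) {s : ℕ} {q : ℝ} (h1 : p.τ δ s ≤ q) (h2 : q ≤ p.τ δ (s + 1)) (j) :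
    p.a δ s j ≤ p.w δ q j := by
  rw [p.w_eq δ hδ h1 h2, Pi.add_apply]
  by_cases h : j = p.k s
  · subst h; simp; linarith
  · simp [h]

theorem w_le_a (hδ : 0 < δ) {s : ℕ} {q : ℝ} (h1 : p.τ δ s ≤ q) (h2 : q ≤ p.τ δ (s + 1)) (j) :
    p.w δ q j ≤ p.a δ (s + 1) j := by
  rw [p.w_eq δ hδ h1 h2, Pi.add_apply, a_succ, Pi.add_apply]
  by_cases h : j = p.k s
  · subst h; simp; linarith
  · simp [h]

theorem sum_w (hδ : 0 < δ) {q : ℝ} (hq : p.τ δ 0 ≤ q) : ∑ j, p.w δ q j = q := by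
  obtain ⟨s, h1, h2⟩ := p.exists_seg δ hδ q hq
  rw [p.w_eq δ hδ h1 h2.le]
  simp only [Pi.add_apply, Finset.sum_add_distrib, Finset.sum_pi_single', Finset.mem_univ, if_true]
  change p.τ δ s + _ = q
  simp

/-- the associated system -/
def P (q : ℝ) : Fin n → ℝ := p.w δ q ∘ Tuple.sort (p.w δ q)

theorem P_mono (q) : Monotone (p.P δ q) := Tuple.monotone_sort _

theorem sum_P (hδ : 0 < δ) {q : ℝ} (hq : p.τ δ 0 ≤ q) : ∑ j, p.P δ q j = q := by
  exact (Equiv.sum_comp (Tuple.sort (p.w δ q)) (p.w δ q)).trans (p.sum_w δ hδ hq)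

theorem P_eq {q} {σ : Equiv.Perm (Fin n)} (h : Monotone (p.w δ q ∘ σ)) :
    p.P δ q = p.w δ q ∘ σ := (Tuple.comp_sort_eq_comp_iff_monotone.2 h).symm

theorem w_tendsto (hδ : 0 < δ) (M : ℝ) : ∃ q1, ∀ q ≥ q1, ∀ j, M ≤ p.w δ q j := by
  have h : ∀ᶠ s in atTop, ∀ j, M ≤ p.a δ s j := by
    rw [eventually_all]
    exact fun j => (p.a_tendsto δ hδ j).eventually_ge_atTop M
  obtain ⟨s, hs⟩ := h.exists
  refine ⟨p.τ δ s, fun q hq j => ?_⟩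
  have h0 : p.τ δ 0 ≤ p.τ δ s := (p.τ_strictMono δ hδ).monotone (Nat.zero_le s)
  obtain ⟨s', h1, h2⟩ := p.exists_seg δ hδ q (h0.trans hq)
  have h3 : s ≤ s' := by
    have := (p.τ_strictMono δ hδ).lt_iff_lt.1 (hq.trans_lt h2)
    omega
  exact (hs j).trans ((p.a_mono δ hδ j h3).trans (p.a_le_w δ hδ h1 h2.le j))

theorem P_proper (hδ : 0 < δ) : IsProper n (p.P δ) := by
  intro i
  rw [tendsto_atTop]
  intro M
  obtain ⟨q1, h⟩ := p.w_tendsto δ hδ M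
  filter_upwards [eventually_ge_atTop q1] with q hq
  exact h q hq _

end LPath

theorem exists_sort_dir {n : ℕ} (v c : Fin n → ℝ) (hc : ∀ i, |c i| ≤ 1) :
    ∃ ε > (0 : ℝ), ∃ σ : Equiv.Perm (Fin n), ∀ t : ℝ, 0 ≤ t → t ≤ ε → Monotone ((v + t • c) ∘ σ) := by
  classical
  have hε : ∃ ε > (0 : ℝ), ∀ i j, v i < v j → 2 * ε ≤ v j - v i := by
    have : ∀ᶠ ε in nhdsWithin (0 : ℝ) (Ioi 0), ∀ i j, v i < v j → 2 * ε ≤ v j - v i := by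
      rw [eventually_all]; intro i
      rw [eventually_all]; intro j
      by_cases h : v i < v j
      · have h2 : (0 : ℝ) < (v j - v i) / 2 := by linarith
        filter_upwards [Ioo_mem_nhdsGT h2] with ε hε _
        have := hε.2
        linarith
      · exact Eventually.of_forall fun _ h' => absurd h' h
    obtain ⟨ε, h1, h2⟩ := (this.and self_mem_nhdsWithin).exists
    exact ⟨ε, h2, h1⟩
  obtain ⟨ε, hε0, hε⟩ := hε
  let f : Fin n → ℝ ×ₗ ℝ := fun i => toLex (v i, c i)
  refine ⟨ε, hε0, Tuple.sort f, fun t ht ht2 i j hij => ?_⟩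
  have h := Tuple.monotone_sort f hij
  simp only [Function.comp] at h
  set i' := Tuple.sort f i
  set j' := Tuple.sort f j
  have h' : v i' < v j' ∨ v i' = v j' ∧ c i' ≤ c j' := Prod.Lex.le_iff.1 h
  simp only [Function.comp, Pi.add_apply, Pi.smul_apply, smul_eq_mul]
  change v i' + t * c i' ≤ v j' + t * c j'
  rcases h' with h' | ⟨h1, h2⟩
  · have h3 := hε _ _ h'
    have h4 := abs_le.1 (hc i')
    have h5 := abs_le.1 (hc j')
    nlinarith
  · rw [h1]; gcongr

namespace LPath

variable {n : ℕ} (p : LPath n) (δ : ℝ)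

/-- one-sided local description of `P` -/
theorem P_local (q : ℝ) (r : Fin n) (d : ℝ) (hd : |d| ≤ 1) {η : ℝ} (hη : 0 < η)
    (h : ∀ t, 0 ≤ t → t ≤ η → p.w δ (q + t * d) = p.w δ q + Pi.single r (t * d)) :
    ∃ ε > 0, ∃ k : Fin n, p.P δ q k = p.w δ q r ∧
      ∀ t, 0 ≤ t → t ≤ ε → p.P δ (q + t * d) = p.P δ q + Pi.single k (t * d) := by
  obtain ⟨ε, hε, σ, hσ⟩ := exists_sort_dir (p.w δ q) (Pi.single r d) (by
    intro i
    by_cases hi : i = r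
    · subst hi; simpa using hd
    · simp [hi])
  have hσ0 : p.P δ q = p.w δ q ∘ σ := by
    apply p.P_eq
    simpa using hσ 0 le_rfl hε.le
  refine ⟨min ε η, lt_min hε hη, σ.symm r, ?_, ?_⟩
  · rw [hσ0]; simp
  · intro t ht ht2
    have e1 : p.w δ (q + t * d) = p.w δ q + t • Pi.single r d := by
      rw [h t ht (ht2.trans (min_le_right _ _)), ← Pi.single_smul, smul_eq_mul]
    have h2 := hσ t ht (ht2.trans (min_le_left _ _))
    rw [← e1] at h2
    rw [p.P_eq δ h2, hσ0, e1, ← Pi.single_smul, smul_eq_mul]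
    funext i
    simp only [Function.comp, Pi.add_apply, Pi.single_apply, Equiv.eq_symm_apply]

theorem isNSystem (hδ : 0 < δ) : IsNSystem n (Ici (p.τ δ 0)) (p.P δ) := by
  intro q hq
  have hq : p.τ δ 0 ≤ q := hq
  obtain ⟨s, hs1, hs2⟩ := p.exists_seg δ hδ q hq
  refine ⟨⟨fun i => ?_, p.P_mono δ q, p.sum_P δ hδ hq⟩, ?_⟩
  · exact (p.a_nonneg δ hδ s _).trans (p.a_le_w δ hδ hs1 hs2.le _)
  -- right
  obtain ⟨ε, hε, k, hk, hP⟩ := p.P_local δ q (p.k s) 1 (by simp) (sub_pos.2 hs2) (by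
    intro t ht1 ht2
    rw [p.w_eq δ hδ (s := s) (by linarith) (by linarith), p.w_eq δ hδ hs1 hs2.le, add_assoc,
      ← Pi.single_add]
    congr 2; ring)
  rcases hq.eq_or_lt with h0 | h0
  · refine ⟨ε, hε, k, k, ?_, ?_, ?_⟩
    · rintro t ⟨h1, h2⟩
      have : t = q := le_antisymm h2.2 (by rw [← h0]; exact h1)
      subst this; simp
    · rintro t ⟨h1, h2⟩
      have := hP (t - q) (by linarith [h2.1]) (by linarith [h2.2])
      simpa using this
    · intro _ h; exact absurd h (lt_irrefl _)
  · obtain ⟨s', hs1', hs2'⟩ := p.exists_seg_left δ hδ q h0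
    obtain ⟨ε', hε', l, hl, hP'⟩ := p.P_local δ q (p.k s') (-1) (by simp) (sub_pos.2 hs1') (by
      intro t ht1 ht2
      rw [p.w_eq δ hδ (s := s') (by linarith) (by linarith), p.w_eq δ hδ hs1'.le hs2', add_assoc,
        ← Pi.single_add]
      congr 2; ring)
    refine ⟨min ε ε', lt_min hε hε', k, l, ?_, ?_, ?_⟩
    · rintro t ⟨h1, h2⟩
      have := hP' (q - t) (by linarith [h2.2]) (by linarith [h2.1, min_le_right ε ε'])
      simpa using this
    · rintro t ⟨h1, h2⟩
      have := hP (t - q) (by linarith [h2.1]) (by linarith [h2.2, min_le_left ε ε'])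
      simpa using this
    · intro _ hlk i hli hik
      have key : p.w δ q (p.k s) ≤ p.w δ q (p.k s') := by
        have hm := p.τ_strictMono δ hδ
        have h4 := hm.lt_iff_lt.1 (hs1'.trans hs2)
        have h5 := hm.le_iff_le.1 (hs1.trans hs2')
        rcases (show s = s' ∨ s = s' + 1 by omega) with h | h
        · rw [h]
        · have : q = p.τ δ s := le_antisymm (by rw [h]; exact hs2') hs1
          rw [this, p.w_τ δ hδ, h]
          by_cases hk' : p.k (s' + 1) = p.k s'
          · rw [hk']
          · have h6 := p.sw s' hk'
            unfold a
            have h2 : (p.lev (s' + 1) (p.k (s' + 1)) : ℝ) ≤ p.lev (s' + 1) (p.k s') := by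
              exact_mod_cast h6.le
            gcongr
      have h1 := p.P_mono δ q hli
      have h2 := p.P_mono δ q hik
      linarith

theorem isRigid (hδ : 0 < δ) : IsRigid n δ (p.τ δ 0) (p.P δ) := by
  have hτ : ∀ s, ∃ m : ℤ, p.τ δ s = δ * m := by
    intro s
    refine ⟨∑ j, (p.lev s j : ℤ) ^ 2, ?_⟩
    unfold τ a
    push_cast
    rw [Finset.mul_sum]
  have ha : ∀ s j, ∃ m : ℤ, p.a δ s j = δ * m := by
    intro s j
    exact ⟨(p.lev s j : ℤ) ^ 2, by unfold a; push_cast; rfl⟩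
  have hinj : ∀ s, Function.Injective (p.a δ s) := by
    intro s i j hij
    unfold a at hij
    have h1 := mul_left_cancel₀ hδ.ne' hij
    have h2 : (p.lev s i : ℝ) = p.lev s j := (pow_left_inj₀ (by positivity) (by positivity) two_ne_zero).1 h1
    exact p.inj s (by exact_mod_cast h2)
  refine ⟨hτ 0, ?_, ?_, ?_⟩
  · rintro q hq ⟨m, rfl⟩ i
    obtain ⟨s, h1, h2⟩ := p.exists_seg δ hδ _ hq
    have : ∀ j, ∃ m' : ℤ, p.w δ (δ * m) j = δ * m' := by
      intro j
      rw [p.w_eq δ hδ h1 h2.le, Pi.add_apply]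
      obtain ⟨x, hx⟩ := ha s j
      obtain ⟨y, hy⟩ := hτ s
      by_cases hj : j = p.k s
      · refine ⟨x + m - y, ?_⟩
        subst hj
        simp [hx, hy]; ring
      · exact ⟨x, by simp [hj, hx]⟩
    exact this _
  · unfold P
    rw [p.w_τ δ hδ 0]
    exact (hinj 0).comp (Equiv.injective _)
  · intro q hq hm
    obtain ⟨s, h1, h2⟩ := p.exists_seg δ hδ _ hq.le
    unfold P
    refine Function.Injective.comp ?_ (Equiv.injective _)
    have hne : ∀ j, j ≠ p.k s → p.w δ q j ≠ p.w δ q (p.k s) := by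
      intro j hj heq
      rw [p.w_eq δ hδ h1 h2.le, Pi.add_apply, Pi.add_apply] at heq
      simp [hj] at heq
      obtain ⟨x, hx⟩ := ha s j
      obtain ⟨z, hz⟩ := ha s (p.k s)
      obtain ⟨y, hy⟩ := hτ s
      apply hm (x - z + y)
      push_cast
      linarith
    intro i j hij
    by_cases hi : i = p.k s
    · by_cases hj : j = p.k s
      · rw [hi, hj]
      · subst hi; exact absurd hij.symm (hne j hj)
    · by_cases hj : j = p.k s
      · subst hj; exact absurd hij (hne i hi)
      · rw [p.w_eq δ hδ h1 h2.le, Pi.add_apply, Pi.add_apply] at hij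
        simp [hi, hj] at hij
        exact hinj s hij

theorem τ_nonneg (hδ : 0 < δ) (s) : 0 ≤ p.τ δ s :=
  Finset.sum_nonneg fun j _ => p.a_nonneg δ hδ s j

end LPath

/-! ## Successive minima: elementary facts -/

/-- `x` is an integer point of `lam • C_u(q)` -/
def InBody {n : ℕ} (u : EuclideanSpace ℝ (Fin n)) (q lam : ℝ) (x : EuclideanSpace ℝ (Fin n)) : Prop :=
  (∀ k, ∃ m : ℤ, x k = (m : ℝ)) ∧ ‖x‖ ≤ lam ∧ |⟪x, u⟫| ≤ lam * Real.exp (-q)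

theorem InBody.mono {n : ℕ} {u : EuclideanSpace ℝ (Fin n)} {q lam lam' : ℝ}
    {x : EuclideanSpace ℝ (Fin n)} (h : InBody u q lam x) (hl : lam ≤ lam') : InBody u q lam' x :=
  ⟨h.1, h.2.1.trans hl, h.2.2.trans (by gcongr)⟩

theorem lamMin_le {n : ℕ} {u : EuclideanSpace ℝ (Fin n)} {q lam : ℝ} {i : ℕ} (hl : 1 ≤ lam)
    (v : Fin i → EuclideanSpace ℝ (Fin n)) (hv : LinearIndependent ℝ v)
    (hb : ∀ j, InBody u q lam (v j)) : lamMin n u q i ≤ lam :=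
  csInf_le ⟨1, fun _ h => h.1⟩ ⟨hl, v, hv, hb⟩

theorem exists_body {n : ℕ} (u : EuclideanSpace ℝ (Fin n)) (q : ℝ) (x : EuclideanSpace ℝ (Fin n))
    (hx : ∀ k, ∃ m : ℤ, x k = (m : ℝ)) : InBody u q (max ‖x‖ (Real.exp q * |⟪x, u⟫|)) x := by
  refine ⟨hx, le_max_left _ _, ?_⟩
  rw [Real.exp_neg, ← div_eq_mul_inv, le_div_iff₀ (Real.exp_pos q), mul_comm]
  exact le_max_right _ _

theorem lamSet_nonempty {n : ℕ} (u : EuclideanSpace ℝ (Fin n)) (q : ℝ) {i : ℕ} (hi : i ≤ n) :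
    {lam : ℝ | 1 ≤ lam ∧ ∃ v : Fin i → EuclideanSpace ℝ (Fin n),
    LinearIndependent ℝ v ∧ ∀ j, (∀ k, ∃ m : ℤ, v j k = (m : ℝ)) ∧
      ‖v j‖ ≤ lam ∧ |⟪v j, u⟫| ≤ lam * Real.exp (-q)}.Nonempty := by
  let v : Fin n → EuclideanSpace ℝ (Fin n) := fun j => EuclideanSpace.single j 1
  have hv : LinearIndependent ℝ v := by
    have := (EuclideanSpace.basisFun (Fin n) ℝ).orthonormal.linearIndependent
    have e : v = ⇑(EuclideanSpace.basisFun (Fin n) ℝ) := by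
      funext j; simp [v]
    rw [e]; exact this
  have hintg : ∀ j k, ∃ m : ℤ, v j k = (m : ℝ) := by
    intro j k
    by_cases h : k = j
    · exact ⟨1, by simp [v, h]⟩
    · exact ⟨0, by simp [v, h]⟩
  refine ⟨1 + ∑ j, max ‖v j‖ (Real.exp q * |⟪v j, u⟫|), ?_, fun j => v (Fin.castLE hi j),
    hv.comp _ (Fin.castLE_injective hi), fun j => ?_⟩
  · have : 0 ≤ ∑ j, max ‖v j‖ (Real.exp q * |⟪v j, u⟫|) :=
      Finset.sum_nonneg fun j _ => le_max_of_le_left (norm_nonneg _)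
    linarith
  · apply (exists_body u q _ (hintg (Fin.castLE hi j))).mono
    have := Finset.single_le_sum (f := fun j => max ‖v j‖ (Real.exp q * |⟪v j, u⟫|))
      (fun j _ => le_max_of_le_left (norm_nonneg _)) (Finset.mem_univ (Fin.castLE hi j))
    linarith

theorem one_le_lamMin {n : ℕ} (u : EuclideanSpace ℝ (Fin n)) (q : ℝ) {i : ℕ} (hi : i ≤ n) :
    1 ≤ lamMin n u q i :=
  le_csInf (lamSet_nonempty u q hi) fun _ h => h.1

theorem exists_lamMin_family {n : ℕ} (u : EuclideanSpace ℝ (Fin n)) (q : ℝ) {i : ℕ} (hi : i ≤ n) :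
    ∃ v : Fin i → EuclideanSpace ℝ (Fin n), LinearIndependent ℝ v ∧
      ∀ j, InBody u q (2 * lamMin n u q i) (v j) := by
  have h1 := one_le_lamMin u q hi
  obtain ⟨lam, ⟨h2, v, hv, hb⟩, h3⟩ := exists_lt_of_csInf_lt (lamSet_nonempty u q hi)
    (show lamMin n u q i < 2 * lamMin n u q i by linarith)
  exact ⟨v, hv, fun j => InBody.mono (hb j) h3.le⟩

theorem exists_greedy {n : ℕ} (u : EuclideanSpace ℝ (Fin n)) (q : ℝ) (i : ℕ) (hi : i ≤ n) :
    ∃ v : Fin i → EuclideanSpace ℝ (Fin n), LinearIndependent ℝ v ∧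
      ∀ j : Fin i, InBody u q (2 * lamMin n u q (j + 1)) (v j) := by
  induction i with
  | zero => exact ⟨Fin.elim0, linearIndependent_empty_type, fun j => j.elim0⟩
  | succ i ih =>
    obtain ⟨v, hv, hb⟩ := ih (by omega)
    obtain ⟨z, hz, hzb⟩ := exists_lamMin_family u q hi
    have : ∃ l, z l ∉ Submodule.span ℝ (range v) := by
      by_contra hc
      push Not at hc
      have h1 : Submodule.span ℝ (range z) ≤ Submodule.span ℝ (range v) :=
        Submodule.span_le.2 (by rintro _ ⟨l, rfl⟩; exact hc l)
      have h2 := Submodule.finrank_mono h1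
      rw [finrank_span_eq_card hz, finrank_span_eq_card hv] at h2
      simp at h2
    obtain ⟨l, hl⟩ := this
    refine ⟨Fin.snoc v (z l), linearIndependent_finSnoc.2 ⟨hv, hl⟩, fun j => ?_⟩
    refine Fin.lastCases ?_ (fun j => ?_) j
    · simpa using hzb l
    · simpa using hb j

/-- lower bound for the product of the successive minima -/
theorem prod_lamMin_ge {n : ℕ} (u : EuclideanSpace ℝ (Fin n)) (hu : u ≠ 0) :
    ∃ C : ℝ, ∀ q : ℝ, q ≤ ∑ i, Lu n u q i + C := by
  classical
  obtain ⟨m, hm⟩ : ∃ m, u m ≠ 0 := by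
    by_contra h
    push Not at h
    exact hu (by ext i; simpa using h i)
  refine ⟨Real.log ((n.factorial * 2 ^ n : ℝ) / |u m|), fun q => ?_⟩
  obtain ⟨z, hz, hb⟩ := exists_greedy u q n le_rfl
  choose Z hZ using fun i k => (hb i).1 k
  -- integer matrix
  let M : Matrix (Fin n) (Fin n) ℤ := Matrix.of Z
  let MR : Matrix (Fin n) (Fin n) ℝ := M.map (Int.cast)
  have hMR : ∀ i k, MR i k = z i k := fun i k => (hZ i k).symm
  have hdet : MR.det = (M.det : ℝ) := by
    have := (Int.castRingHom ℝ).map_det M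
    simp at this
    rw [this]
  have hdet0 : MR.det ≠ 0 := by
    have h1 : LinearIndependent ℝ MR.row := by
      have h2 := hz.map' ((WithLp.linearEquiv 2 ℝ (Fin n → ℝ)).toLinearMap) (LinearEquiv.ker _)
      have e : MR.row = ⇑((WithLp.linearEquiv 2 ℝ (Fin n → ℝ)).toLinearMap) ∘ z := by
        funext i k
        exact hMR i k
      rw [e]; exact h2
    have h3 := Matrix.linearIndependent_rows_iff_isUnit.1 h1
    exact ((Matrix.isUnit_iff_isUnit_det _).1 h3).ne_zero
  have hdet1 : 1 ≤ |MR.det| := by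
    rw [hdet] at hdet0 ⊢
    have : M.det ≠ 0 := by exact_mod_cast hdet0
    have := Int.one_le_abs this
    exact_mod_cast this
  let A : Matrix (Fin n) (Fin n) ℝ := (1 : Matrix (Fin n) (Fin n) ℝ).updateCol m (fun k => u k)
  have hA : A.det = u m := by
    have := Matrix.cramer_apply (1 : Matrix (Fin n) (Fin n) ℝ) (fun k => u k) m
    rw [Matrix.cramer_one] at this
    simpa using this.symm
  have hMA : MR * A = MR.updateCol m (fun i => ⟪z i, u⟫) := by
    ext i k
    rw [Matrix.mul_apply]
    by_cases hk : k = m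
    · subst hk
      simp only [A, Matrix.updateCol_self, hMR]
      rw [PiLp.inner_apply]
      refine Finset.sum_congr rfl fun j _ => ?_
      simp [mul_comm]
    · simp [A, hk, Matrix.one_apply]
  have hl1 : ∀ i : Fin n, 1 ≤ lamMin n u q (i + 1) := fun i => one_le_lamMin u q (by omega)
  have hup : |(MR * A).det| ≤ n.factorial * ((∏ i : Fin n, 2 * lamMin n u q (i + 1)) * Real.exp (-q)) := by
    rw [hMA, Matrix.det_apply]
    refine (Finset.abs_sum_le_sum_abs _ _).trans ?_
    have : ∀ σ ∈ (Finset.univ : Finset (Equiv.Perm (Fin n))),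
        |Equiv.Perm.sign σ • ∏ i, (MR.updateCol m (fun i => ⟪z i, u⟫)) (σ i) i| ≤
        (∏ i : Fin n, 2 * lamMin n u q (i + 1)) * Real.exp (-q) := by
      intro σ _
      have e1 : |Equiv.Perm.sign σ • ∏ i, (MR.updateCol m (fun i => ⟪z i, u⟫)) (σ i) i| =
          ∏ i, |(MR.updateCol m (fun i => ⟪z i, u⟫)) (σ i) i| := by
        rw [← Finset.abs_prod]
        rcases Int.units_eq_one_or (Equiv.Perm.sign σ) with h | h <;> simp [h]
      rw [e1]
      have e2 : (∏ i : Fin n, 2 * lamMin n u q (i + 1)) * Real.exp (-q) =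
          ∏ i : Fin n, ((2 * lamMin n u q (σ i + 1)) * (if i = m then Real.exp (-q) else 1)) := by
        rw [Finset.prod_mul_distrib (f := fun i => 2 * lamMin n u q (σ i + 1)),
          Equiv.prod_comp σ (fun i => 2 * lamMin n u q (i + 1))]
        simp
      rw [e2]
      apply Finset.prod_le_prod (fun i _ => abs_nonneg _)
      intro i _
      by_cases hi : i = m
      · subst hi; simpa using (hb (σ i)).2.2
      · simp only [ne_eq, hi, not_false_eq_true, Matrix.updateCol_ne, hMR, if_false, mul_one]
        exact (PiLp.norm_apply_le (z (σ i)) i).trans (hb (σ i)).2.1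
    refine (Finset.sum_le_sum this).trans ?_
    rw [Finset.sum_const, nsmul_eq_mul, Finset.card_univ, Fintype.card_perm, Fintype.card_fin]
  rw [Matrix.det_mul, hA, abs_mul] at hup
  have hum : 0 < |u m| := abs_pos.2 hm
  have h5 : |u m| ≤ n.factorial * ((∏ i : Fin n, 2 * lamMin n u q (i + 1)) * Real.exp (-q)) := by
    nlinarith
  have hsum : ∑ i, Lu n u q i = Real.log (∏ i : Fin n, lamMin n u q (i + 1)) := by
    rw [Real.log_prod]
    · rfl
    · intro i _; linarith [hl1 i]
  have hpos : 0 < ∏ i : Fin n, lamMin n u q (i + 1) :=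
    Finset.prod_pos fun i _ => by linarith [hl1 i]
  rw [hsum, ← Real.log_mul hpos.ne' (by positivity)]
  rw [Real.le_log_iff_exp_le (by positivity)]
  rw [Finset.prod_mul_distrib, Finset.prod_const, Finset.card_univ, Fintype.card_fin, Real.exp_neg] at h5
  have he := Real.exp_pos q
  rw [← mul_div_assoc, le_div_iff₀ hum]
  calc Real.exp q * |u m| ≤ Real.exp q * (n.factorial * ((2 ^ n * ∏ i : Fin n, lamMin n u q (i + 1)) * (Real.exp q)⁻¹)) := by gcongr
    _ = _ := by field_simp

theorem Lu_mono {n : ℕ} (u : EuclideanSpace ℝ (Fin n)) (q : ℝ) : Monotone (Lu n u q) := by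
  intro i j hij
  have hi : (i : ℕ) + 1 ≤ n := i.2
  have hj : (j : ℕ) + 1 ≤ n := j.2
  have h1 := one_le_lamMin u q hi
  apply Real.log_le_log (by linarith)
  apply csInf_le_csInf ⟨1, fun _ h => h.1⟩ (lamSet_nonempty u q hj)
  rintro lam ⟨h1, v, hv, hb⟩
  have hle : (i : ℕ) + 1 ≤ j + 1 := by have : (i : ℕ) ≤ j := hij; omega
  exact ⟨h1, fun l => v (Fin.castLE hle l), hv.comp _ (Fin.castLE_injective _), fun l => hb _⟩

theorem Lu_nonneg {n : ℕ} (u : EuclideanSpace ℝ (Fin n)) (q : ℝ) (i) : 0 ≤ Lu n u q i :=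
  Real.log_nonneg (one_le_lamMin u q i.2)

/-- if the coordinates are dependent over `ℚ`, `L_{u,1}` is bounded. -/
theorem Lu_zero_bdd {n : ℕ} (hn : 0 < n) (u : EuclideanSpace ℝ (Fin n))
    (h : ¬ LinearIndependent ℚ (fun i : Fin n => u i)) : ∃ B, ∀ q, Lu n u q ⟨0, hn⟩ ≤ B := by
  rw [← LinearIndependent.iff_fractionRing ℤ ℚ, Fintype.not_linearIndependent_iff] at h
  obtain ⟨g, hg, i, hi⟩ := h
  let z : EuclideanSpace ℝ (Fin n) := WithLp.toLp 2 fun i => (g i : ℝ)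
  have hz0 : z ≠ 0 := by
    intro hz
    have := congrArg (fun x : EuclideanSpace ℝ (Fin n) => x i) hz
    simp [z] at this
    exact hi this
  have hzu : ⟪z, u⟫ = 0 := by
    rw [PiLp.inner_apply, ← hg]
    refine Finset.sum_congr rfl fun j _ => ?_
    simp [z, mul_comm]
  refine ⟨Real.log (max 1 ‖z‖), fun q => ?_⟩
  have h1 := one_le_lamMin u q (i := 1) (by omega)
  apply Real.log_le_log (by simp only [zero_add]; linarith)
  simp only [zero_add]
  apply lamMin_le (le_max_left _ _) (fun _ => z)
  · exact linearIndependent_unique_iff.2 hz0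
  · intro j
    refine ⟨fun k => ⟨g k, rfl⟩, le_max_right _ _, ?_⟩
    rw [hzu, abs_zero]; positivity

/-! ## Part III: from a path to a point `u` -/

namespace LPath

variable {n : ℕ} (p : LPath n) (δ : ℝ)

def gap (s : ℕ) : ℝ := δ * (2 * (p.lev (s + 1) (p.k s) : ℝ) - 1)

def eps (s : ℕ) : ℝ := 2 * Real.exp (-p.gap δ s)

theorem lev_mono (j) : Monotone (fun s => p.lev s j) := by
  apply monotone_nat_of_le_succ
  intro s
  by_cases h : j = p.k s
  · subst h; exact (p.rise s).le
  · exact (p.stay s j h).ge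

theorem summable_eps (hδ : 0 < δ) : Summable (p.eps δ) := by
  have hinj : Function.Injective (fun s => (p.k s, p.lev (s + 1) (p.k s))) := by
    have key : ∀ s t, s < t → (p.k s, p.lev (s + 1) (p.k s)) ≠ (p.k t, p.lev (t + 1) (p.k t)) := by
      intro s t hst h
      rw [Prod.mk.injEq] at h
      obtain ⟨h1, h2⟩ := h
      have h3 := p.lev_mono (p.k t) (show s + 1 ≤ t from hst)
      have h4 := p.rise t
      rw [h1] at h2
      simp only at h3
      omega
    intro s t h
    rcases lt_trichotomy s t with h' | h' | h'
    · exact absurd h (key s t h')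
    · exact h'
    · exact absurd h.symm (key t s h')
  have h1 : Summable (fun l : ℕ => 2 * Real.exp δ * (Real.exp (-(2 * δ))) ^ l) := by
    apply Summable.mul_left
    apply summable_geometric_of_lt_one (Real.exp_pos _).le
    rw [Real.exp_lt_one_iff]; linarith
  have h2 : Summable (fun x : Fin n × ℕ => (fun _ => (1 : ℝ)) x.1 *
      (fun l : ℕ => 2 * Real.exp δ * (Real.exp (-(2 * δ))) ^ l) x.2) :=
    Summable.mul_of_nonneg (Summable.of_finite) h1 (fun _ => zero_le_one)
      (fun l => by positivity)
  have h3 := h2.comp_injective hinj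
  refine h3.congr fun s => ?_
  simp only [Function.comp, one_mul, eps, gap, ← Real.exp_nat_mul, mul_assoc, ← Real.exp_add]
  congr 2; ring

def D (s : ℕ) : ℝ := Real.exp (∑ r ∈ Finset.range s, p.eps δ r)

def Dinf : ℝ := Real.exp (∑' r, p.eps δ r)

theorem eps_nonneg (s) : 0 ≤ p.eps δ s := by unfold eps; positivity

theorem D_le (hδ : 0 < δ) (s) : p.D δ s ≤ p.Dinf δ :=
  Real.exp_le_exp.2 ((p.summable_eps δ hδ).sum_le_tsum _ fun r _ => p.eps_nonneg δ r)

theorem D_pos (s) : 0 < p.D δ s := Real.exp_pos _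

theorem one_le_D (s) : 1 ≤ p.D δ s :=
  Real.one_le_exp (Finset.sum_nonneg fun r _ => p.eps_nonneg δ r)

theorem D_succ (s) : p.D δ s * (1 + p.eps δ s) ≤ p.D δ (s + 1) := by
  unfold D
  rw [Finset.sum_range_succ, Real.exp_add]
  gcongr
  rw [add_comm]
  exact Real.add_one_le_exp _

theorem D_le_succ (s) : p.D δ s ≤ p.D δ (s + 1) := by
  have := p.D_succ δ s
  have h2 := p.eps_nonneg δ s
  have h3 := p.D_pos δ s
  nlinarith

/-- height of the riser at the end of step `s` -/
def b (s : ℕ) : ℝ := p.a δ (s + 1) (p.k s)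

open Classical in
def c (s : ℕ) : ℕ :=
  if p.k (s + 1) = p.k s then 0 else ⌈Real.exp (p.b δ s - p.a δ (s + 1) (p.k (s + 1)))⌉₊

theorem gap_le_rise (hδ : 0 < δ) (s) : p.gap δ s ≤ p.b δ s - p.a δ s (p.k s) := by
  unfold gap b a
  have h : (p.lev s (p.k s) : ℝ) + 1 ≤ p.lev (s + 1) (p.k s) := by exact_mod_cast p.rise s
  have h0 : (0 : ℝ) ≤ p.lev s (p.k s) := Nat.cast_nonneg _
  rw [← mul_sub]
  apply mul_le_mul_of_nonneg_left _ hδ.le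
  nlinarith

theorem gap_le_sw (hδ : 0 < δ) (s) (h : p.k (s + 1) ≠ p.k s) :
    p.gap δ s ≤ p.b δ s - p.a δ (s + 1) (p.k (s + 1)) := by
  unfold gap b a
  have h : (p.lev (s + 1) (p.k (s + 1)) : ℝ) + 1 ≤ p.lev (s + 1) (p.k s) := by
    exact_mod_cast p.sw s h
  have h0 : (0 : ℝ) ≤ p.lev (s + 1) (p.k (s + 1)) := Nat.cast_nonneg _
  rw [← mul_sub]
  apply mul_le_mul_of_nonneg_left _ hδ.le
  nlinarith

theorem c_ge (s) (h : p.k (s + 1) ≠ p.k s) :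
    Real.exp (p.b δ s - p.a δ (s + 1) (p.k (s + 1))) ≤ p.c δ s := by
  unfold c; rw [if_neg h]; exact Nat.le_ceil _

theorem c_le (s) (h : p.k (s + 1) ≠ p.k s) :
    (p.c δ s : ℝ) ≤ Real.exp (p.b δ s - p.a δ (s + 1) (p.k (s + 1))) + 1 := by
  unfold c; rw [if_neg h]; exact (Nat.ceil_lt_add_one (Real.exp_pos _).le).le

theorem c_same (s) (h : p.k (s + 1) = p.k s) : p.c δ s = 0 := by
  unfold c; rw [if_pos h]

theorem τ_succ (s) : p.τ δ (s + 1) = p.τ δ s + (p.b δ s - p.a δ s (p.k s)) := by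
  have := congrFun (p.a_succ δ s) (p.k s)
  simp at this
  unfold b
  linarith

/-- propagation of bounds for the dual basis -/
theorem dual_bound (hδ : 0 < δ) (y : ℕ → Fin n → ℝ) (t : ℕ) (B : ℝ) (hB : 0 ≤ B)
    (hstep : ∀ s l, y (s + 1) l = y s l + if l = p.k (s + 1) then p.c δ s * y s (p.k s) else 0)
    (h0 : ∀ l, 0 ≤ y t l) (h1 : ∀ l, y t l ≤ B * Real.exp (p.τ δ t - p.a δ t l)) :
    ∀ s, t ≤ s → ∀ l, 0 ≤ y s l ∧ y s l ≤ B * p.D δ s * Real.exp (p.τ δ s - p.a δ s l) := by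
  intro s hs
  induction s, hs using Nat.le_induction with
  | base =>
    intro l
    refine ⟨h0 l, (h1 l).trans ?_⟩
    have := p.one_le_D δ t
    gcongr
    nlinarith
  | succ s hs ih =>
    intro l
    have hk := ih (p.k s)
    have hl := ih l
    have hD := p.D_le_succ δ s
    have hD0 := p.D_pos δ s
    have hD1 := p.D_pos δ (s + 1)
    have hr := p.a_rise δ hδ s
    -- monotonicity of the exponent
    have hexp : p.τ δ s - p.a δ s l ≤ p.τ δ (s + 1) - p.a δ (s + 1) l := by
      rw [p.τ_succ]
      by_cases h : l = p.k s
      · subst h; unfold b; linarith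
      · rw [p.a_stay δ s l h]; unfold b; linarith
    rw [hstep]
    by_cases hlk : l = p.k (s + 1)
    · rw [if_pos hlk]
      by_cases hkk : p.k (s + 1) = p.k s
      · rw [p.c_same δ s hkk]
        simp only [Nat.cast_zero, zero_mul, add_zero]
        refine ⟨hl.1, hl.2.trans ?_⟩
        gcongr
      · refine ⟨add_nonneg hl.1 (mul_nonneg (Nat.cast_nonneg _) hk.1), ?_⟩
        set E := Real.exp (p.τ δ (s + 1) - p.a δ (s + 1) l) with hE
        have hE0 : 0 < E := Real.exp_pos _
        have hsub : l ≠ p.k s := by rw [hlk]; exact hkk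
        have hal := p.a_stay δ s l hsub
        set g := Real.exp (-p.gap δ s) with hg
        have e1 : Real.exp (p.τ δ s - p.a δ s l) ≤ E * g := by
          rw [hE, hg, ← Real.exp_add, Real.exp_le_exp, hal, p.τ_succ]
          linarith [p.gap_le_rise δ hδ s]
        have e2 : p.c δ s * Real.exp (p.τ δ s - p.a δ s (p.k s)) ≤ E * (1 + g) := by
          have h2 : Real.exp (p.τ δ s - p.a δ s (p.k s)) ≤ E * g := by
            rw [hE, hg, ← Real.exp_add, Real.exp_le_exp, p.τ_succ, hlk]
            linarith [p.gap_le_sw δ hδ s hkk]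
          have h3 : Real.exp (p.b δ s - p.a δ (s + 1) (p.k (s + 1))) *
              Real.exp (p.τ δ s - p.a δ s (p.k s)) = E := by
            rw [hE, ← Real.exp_add, p.τ_succ, hlk]; congr 1; ring
          calc p.c δ s * Real.exp (p.τ δ s - p.a δ s (p.k s))
              ≤ (Real.exp (p.b δ s - p.a δ (s + 1) (p.k (s + 1))) + 1) *
                Real.exp (p.τ δ s - p.a δ s (p.k s)) := by
                  gcongr; exact p.c_le δ s hkk
            _ = E + Real.exp (p.τ δ s - p.a δ s (p.k s)) := by rw [add_mul, h3, one_mul]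
            _ ≤ E * (1 + g) := by linarith
        have hBD : 0 ≤ B * p.D δ s := by positivity
        calc y s l + p.c δ s * y s (p.k s)
            ≤ B * p.D δ s * Real.exp (p.τ δ s - p.a δ s l) +
              p.c δ s * (B * p.D δ s * Real.exp (p.τ δ s - p.a δ s (p.k s))) := by
                gcongr
                · exact hl.2
                · exact hk.2
          _ = B * p.D δ s * (Real.exp (p.τ δ s - p.a δ s l) +
              p.c δ s * Real.exp (p.τ δ s - p.a δ s (p.k s))) := by ring
          _ ≤ B * p.D δ s * (E * g + E * (1 + g)) := by gcongr
          _ = B * (p.D δ s * (1 + p.eps δ s)) * E := by unfold eps; ring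
          _ ≤ B * p.D δ (s + 1) * E := by
                gcongr
                exact p.D_succ δ s
    · rw [if_neg hlk, add_zero]
      refine ⟨hl.1, hl.2.trans ?_⟩
      gcongr

/-- the integer basis -/
def X : ℕ → Fin n → Fin n → ℤ
  | 0 => fun j => Pi.single j 1
  | s + 1 => fun j => X s j - if j = p.k s then (p.c δ s : ℤ) • X s (p.k (s + 1)) else 0

/-- the dual basis -/
def Y : ℕ → Fin n → Fin n → ℝ
  | 0 => fun j => Pi.single j 1
  | s + 1 => fun l => Y s l + if l = p.k (s + 1) then (p.c δ s : ℝ) • Y s (p.k s) else 0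

theorem Y_succ (s l i) : p.Y δ (s + 1) l i =
    p.Y δ s l i + if l = p.k (s + 1) then (p.c δ s : ℝ) * p.Y δ s (p.k s) i else 0 := by
  simp only [Y, Pi.add_apply]
  split_ifs <;> simp

theorem X_succ (s j i) : p.X δ (s + 1) j i =
    p.X δ s j i - if j = p.k s then (p.c δ s : ℤ) * p.X δ s (p.k (s + 1)) i else 0 := by
  simp only [X, Pi.sub_apply]
  split_ifs <;> simp

theorem X_stay (s j) (h : j ≠ p.k s) : p.X δ (s + 1) j = p.X δ s j := by
  funext i; rw [X_succ, if_neg h, sub_zero]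

def dot (x : Fin n → ℤ) (y : Fin n → ℝ) : ℝ := ∑ i, (x i : ℝ) * y i

theorem dot_Y_succ (x) (s l) : dot x (p.Y δ (s + 1) l) =
    dot x (p.Y δ s l) + if l = p.k (s + 1) then (p.c δ s : ℝ) * dot x (p.Y δ s (p.k s)) else 0 := by
  unfold dot
  simp only [Y_succ, mul_add, Finset.sum_add_distrib]
  congr 1
  split_ifs
  · rw [Finset.mul_sum]; refine Finset.sum_congr rfl fun i _ => by ring
  · simp

theorem dual (s : ℕ) : ∀ j l, dot (p.X δ s j) (p.Y δ s l) = if j = l then 1 else 0 := by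
  induction s with
  | zero =>
    intro j l
    unfold dot
    simp only [X, Y, Pi.single_apply]
    by_cases h : j = l
    · simp [h]
    · simp [h, Ne.symm h]
  | succ s ih =>
    intro j l
    have hx : ∀ y, dot (p.X δ (s + 1) j) y = dot (p.X δ s j) y -
        if j = p.k s then (p.c δ s : ℝ) * dot (p.X δ s (p.k (s + 1))) y else 0 := by
      intro y
      unfold dot
      simp only [X_succ]
      by_cases hj : j = p.k s
      · simp only [if_pos hj, Int.cast_sub, Int.cast_mul, Int.cast_natCast, sub_mul, Finset.sum_sub_distrib,
          Finset.mul_sum]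
        congr 1
        refine Finset.sum_congr rfl fun i _ => by ring
      · simp [hj]
    rw [dot_Y_succ, hx, hx, ih, ih, ih, ih]
    by_cases hkk : p.k (s + 1) = p.k s
    · rw [p.c_same δ s hkk]; simp
    · by_cases hj : j = p.k s
      · by_cases hl : l = p.k (s + 1)
        · simp [hj, hl, hkk, Ne.symm hkk]
        · simp [hj, hl, hkk, Ne.symm hl]
      · simp [hj]

theorem Y_bound (hδ : 0 < δ) (s l i) :
    0 ≤ p.Y δ s l i ∧ p.Y δ s l i ≤ p.D δ s * Real.exp (p.τ δ s - p.a δ s l) := by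
  have := p.dual_bound δ hδ (fun s l => p.Y δ s l i) 0 1 zero_le_one
    (fun s l => p.Y_succ δ s l i) (fun l => by simp only [Y, Pi.single_apply]; split_ifs <;> simp)
    (fun l => by
      have h1 : 1 ≤ Real.exp (p.τ δ 0 - p.a δ 0 l) :=
        Real.one_le_exp (sub_nonneg.2 (p.a_le_τ δ hδ 0 l))
      simp only [Y, Pi.single_apply]
      split_ifs <;> linarith) s (Nat.zero_le s) l
  simpa using this

theorem X_bound (hδ : 0 < δ) (s j i) : |(p.X δ s j i : ℝ)| ≤ p.D δ s * Real.exp (p.a δ s j) := by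
  induction s generalizing j with
  | zero =>
    have h1 : 1 ≤ Real.exp (p.a δ 0 j) := Real.one_le_exp (p.a_nonneg δ hδ 0 j)
    have h2 := p.one_le_D δ 0
    simp only [X, Pi.single_apply]
    split_ifs
    · simp; nlinarith
    · simp; positivity
  | succ s ih =>
    have hD := p.D_le_succ δ s
    have hD0 := p.D_pos δ s
    have hD1 := p.D_pos δ (s + 1)
    have hm : p.a δ s j ≤ p.a δ (s + 1) j := p.a_mono δ hδ j (Nat.le_succ s)
    rw [X_succ]
    by_cases hj : j = p.k s
    · rw [if_pos hj]
      by_cases hkk : p.k (s + 1) = p.k s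
      · rw [p.c_same δ s hkk]
        simp only [Nat.cast_zero, zero_mul, sub_zero]
        refine (ih j).trans ?_
        gcongr
      · set g := Real.exp (-p.gap δ s) with hg
        set E := Real.exp (p.a δ (s + 1) j) with hE
        have hEb : E = Real.exp (p.b δ s) := by rw [hE, hj]; rfl
        have e1 : Real.exp (p.a δ s j) ≤ E * g := by
          rw [hEb, hg, ← Real.exp_add, Real.exp_le_exp, hj]
          linarith [p.gap_le_rise δ hδ s]
        have ha := p.a_stay δ s _ hkk
        have e2 : p.c δ s * Real.exp (p.a δ s (p.k (s + 1))) ≤ E * (1 + g) := by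
          have h2 : Real.exp (p.a δ s (p.k (s + 1))) ≤ E * g := by
            rw [hEb, hg, ← Real.exp_add, Real.exp_le_exp, ← ha]
            linarith [p.gap_le_sw δ hδ s hkk]
          have h3 : Real.exp (p.b δ s - p.a δ (s + 1) (p.k (s + 1))) *
              Real.exp (p.a δ s (p.k (s + 1))) = E := by
            rw [hEb, ← Real.exp_add, ha]; congr 1; ring
          calc p.c δ s * Real.exp (p.a δ s (p.k (s + 1)))
              ≤ (Real.exp (p.b δ s - p.a δ (s + 1) (p.k (s + 1))) + 1) *
                Real.exp (p.a δ s (p.k (s + 1))) := by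
                  gcongr; exact p.c_le δ s hkk
            _ = E + Real.exp (p.a δ s (p.k (s + 1))) := by rw [add_mul, h3, one_mul]
            _ ≤ E * (1 + g) := by linarith
        push_cast
        calc |(p.X δ s j i : ℝ) - p.c δ s * p.X δ s (p.k (s + 1)) i|
            ≤ |(p.X δ s j i : ℝ)| + |(p.c δ s : ℝ) * p.X δ s (p.k (s + 1)) i| := abs_sub _ _
          _ = |(p.X δ s j i : ℝ)| + p.c δ s * |(p.X δ s (p.k (s + 1)) i : ℝ)| := by
              rw [abs_mul, Nat.abs_cast]
          _ ≤ p.D δ s * Real.exp (p.a δ s j) +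
              p.c δ s * (p.D δ s * Real.exp (p.a δ s (p.k (s + 1)))) := by
              gcongr
              · exact ih j
              · exact ih _
          _ = p.D δ s * (Real.exp (p.a δ s j) + p.c δ s * Real.exp (p.a δ s (p.k (s + 1)))) := by ring
          _ ≤ p.D δ s * (E * g + E * (1 + g)) := by gcongr
          _ = p.D δ s * (1 + p.eps δ s) * E := by unfold eps; ring
          _ ≤ p.D δ (s + 1) * E := by
                gcongr
                exact p.D_succ δ s
    · rw [if_neg hj, sub_zero]
      refine (ih j).trans ?_
      gcongr

open Classical in
def N : ℕ → ℝ
  | 0 => Real.exp (p.τ δ 0 - p.a δ 0 (p.k 0))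
  | s + 1 => if p.k (s + 1) = p.k s then N s else p.c δ s * N s

theorem N_ge (hδ : 0 < δ) (s) : Real.exp (p.τ δ s - p.a δ s (p.k s)) ≤ p.N δ s := by
  induction s with
  | zero => exact le_rfl
  | succ s ih =>
    unfold N
    split_ifs with h
    · refine le_of_eq_of_le ?_ ih
      rw [h, p.τ_succ]; unfold b; congr 1; ring
    · calc Real.exp (p.τ δ (s + 1) - p.a δ (s + 1) (p.k (s + 1)))
          = Real.exp (p.b δ s - p.a δ (s + 1) (p.k (s + 1))) *
            Real.exp (p.τ δ s - p.a δ s (p.k s)) := by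
            rw [← Real.exp_add, p.τ_succ]; congr 1; ring
        _ ≤ p.c δ s * p.N δ s := by
            gcongr
            exact p.c_ge δ s h

theorem N_pos (hδ : 0 < δ) (s) : 0 < p.N δ s := (Real.exp_pos _).trans_le (p.N_ge δ hδ s)

def v (s : ℕ) (i : Fin n) : ℝ := p.Y δ s (p.k s) i / p.N δ s

theorem v_mono (hδ : 0 < δ) (i) : Monotone (fun s => p.v δ s i) := by
  apply monotone_nat_of_le_succ
  intro s
  have hN := p.N_pos δ hδ s
  unfold v
  rw [Y_succ, if_pos rfl]
  by_cases h : p.k (s + 1) = p.k s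
  · rw [p.c_same δ s h]
    simp [N, h]
  · have hc : 0 < (p.c δ s : ℝ) := (Real.exp_pos _).trans_le (p.c_ge δ s h)
    simp only [N, if_neg h]
    rw [div_le_div_iff₀ hN (by positivity)]
    have := (p.Y_bound δ hδ s (p.k (s + 1)) i).1
    have h2 : 0 ≤ p.Y δ s (p.k (s + 1)) i * p.N δ s := by positivity
    linarith

theorem v_le (hδ : 0 < δ) (s i) : p.v δ s i ≤ p.Dinf δ := by
  unfold v
  rw [div_le_iff₀ (p.N_pos δ hδ s)]
  refine (p.Y_bound δ hδ s (p.k s) i).2.trans ?_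
  have h1 := p.D_le δ hδ s
  have h2 := p.N_ge δ hδ s
  have : 0 ≤ p.Dinf δ := (Real.exp_pos _).le
  gcongr

/-- the limit point -/
def u (i : Fin n) : ℝ := ⨆ s, p.v δ s i

theorem v_tendsto (hδ : 0 < δ) (i) : Tendsto (fun s => p.v δ s i) atTop (nhds (p.u δ i)) :=
  tendsto_atTop_ciSup (p.v_mono δ hδ i) ⟨p.Dinf δ, by rintro _ ⟨s, rfl⟩; exact p.v_le δ hδ s i⟩

theorem dot_u_bound (hδ : 0 < δ) (t j) : |dot (p.X δ t j) (p.u δ)| ≤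
    p.Dinf δ * Real.exp (p.a δ t j - p.τ δ t) := by
  have hlim : Tendsto (fun s => dot (p.X δ t j) (p.v δ s)) atTop (nhds (dot (p.X δ t j) (p.u δ))) := by
    unfold dot
    exact tendsto_finsetSum _ fun i _ => (p.v_tendsto δ hδ i).const_mul _
  have hb := p.dual_bound δ hδ (fun s l => dot (p.X δ t j) (p.Y δ s l)) t
    (Real.exp (p.a δ t j - p.τ δ t)) (Real.exp_pos _).le (fun s l => p.dot_Y_succ δ _ s l)
    (fun l => by simp only [p.dual δ t j l]; split_ifs <;> simp)
    (fun l => by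
      simp only [p.dual δ t j l]
      split_ifs with h
      · rw [← Real.exp_add, h]; simp
      · positivity)
  have hv : ∀ s, dot (p.X δ t j) (p.v δ s) = dot (p.X δ t j) (p.Y δ s (p.k s)) / p.N δ s := by
    intro s
    unfold dot v
    rw [Finset.sum_div]
    exact Finset.sum_congr rfl fun i _ => by ring
  rw [abs_of_nonneg]
  · refine le_of_tendsto hlim ?_
    filter_upwards [eventually_ge_atTop t] with s hs
    rw [hv, div_le_iff₀ (p.N_pos δ hδ s)]
    refine (hb s hs (p.k s)).2.trans ?_
    have h1 := p.D_le δ hδ s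
    have h2 := p.N_ge δ hδ s
    have : 0 ≤ p.Dinf δ := (Real.exp_pos _).le
    rw [mul_comm (p.Dinf δ)]
    gcongr
  · refine ge_of_tendsto hlim ?_
    filter_upwards [eventually_ge_atTop t] with s hs
    rw [hv]
    exact div_nonneg (hb s hs _).1 (p.N_pos δ hδ s).le

theorem u_pos (hδ : 0 < δ) : 0 < p.u δ (p.k 0) := by
  have h1 : p.v δ 0 (p.k 0) ≤ p.u δ (p.k 0) :=
    le_ciSup (f := fun s => p.v δ s (p.k 0)) ⟨p.Dinf δ, by rintro _ ⟨s, rfl⟩; exact p.v_le δ hδ s _⟩ 0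
  have h2 : 0 < p.v δ 0 (p.k 0) := by
    unfold v
    simp only [Y, Pi.single_eq_same]
    exact div_pos one_pos (p.N_pos δ hδ 0)
  linarith

def uE : EuclideanSpace ℝ (Fin n) := WithLp.toLp 2 (p.u δ)

def xE (s : ℕ) (j : Fin n) : EuclideanSpace ℝ (Fin n) := WithLp.toLp 2 fun i => (p.X δ s j i : ℝ)

theorem xE_indep (s) : LinearIndependent ℝ (p.xE δ s) := by
  rw [Fintype.linearIndependent_iff]
  intro g hg l
  have h1 : ∀ i, ∑ j, g j * (p.X δ s j i : ℝ) = 0 := by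
    intro i
    have := congrArg (fun x : EuclideanSpace ℝ (Fin n) => x i) hg
    simpa [xE] using this
  have h2 : ∑ j, g j * dot (p.X δ s j) (p.Y δ s l) = 0 := by
    unfold dot
    simp only [Finset.mul_sum]
    rw [Finset.sum_comm]
    apply Finset.sum_eq_zero
    intro i _
    have : ∑ j, g j * ((p.X δ s j i : ℝ) * p.Y δ s l i) = (∑ j, g j * (p.X δ s j i : ℝ)) * p.Y δ s l i := by
      rw [Finset.sum_mul]; exact Finset.sum_congr rfl fun j _ => by ring
    rw [this, h1, zero_mul]
  simpa [p.dual δ s] using h2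

theorem xE_body (hδ : 0 < δ) {s : ℕ} {q : ℝ} (h1 : p.τ δ s ≤ q) (h2 : q ≤ p.τ δ (s + 1)) (j) :
    InBody (p.uE δ) q ((n + 1) * p.Dinf δ * Real.exp (p.w δ q j)) (p.xE δ s j) := by
  have hD : 0 < p.Dinf δ := Real.exp_pos _
  have haw := p.a_le_w δ hδ h1 h2 j
  refine ⟨fun k => ⟨_, rfl⟩, ?_, ?_⟩
  · have hb : ∀ i, ‖p.xE δ s j i‖ ≤ p.Dinf δ * Real.exp (p.w δ q j) := by
      intro i
      refine (p.X_bound δ hδ s j i).trans ?_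
      have := p.D_le δ hδ s
      gcongr
    have h3 : ‖p.xE δ s j‖ ≤ ∑ i, ‖p.xE δ s j i‖ := by
      rw [EuclideanSpace.norm_eq]
      apply Real.sqrt_le_iff.2
      refine ⟨Finset.sum_nonneg fun i _ => norm_nonneg _, ?_⟩
      exact Finset.sum_sq_le_sq_sum_of_nonneg fun i _ => norm_nonneg _
    refine h3.trans ((Finset.sum_le_sum fun i _ => hb i).trans ?_)
    rw [Finset.sum_const, Finset.card_univ, Fintype.card_fin, nsmul_eq_mul]
    have : 0 < p.Dinf δ * Real.exp (p.w δ q j) := by positivity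
    nlinarith
  · have e : ⟪p.xE δ s j, p.uE δ⟫ = dot (p.X δ s j) (p.u δ) := by
      rw [PiLp.inner_apply]
      unfold dot
      exact Finset.sum_congr rfl fun i _ => by simp [xE, uE, mul_comm]
    rw [e]
    have key : |dot (p.X δ s j) (p.u δ)| ≤ p.Dinf δ * Real.exp (p.w δ q j) * Real.exp (-q) := by
      rw [mul_assoc, ← Real.exp_add]
      by_cases hj : j = p.k s
      · refine (p.dot_u_bound δ hδ s j).trans ?_
        rw [p.w_eq δ hδ h1 h2]
        subst hj
        simp only [Pi.add_apply, Pi.single_eq_same]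
        apply le_of_eq
        congr 2; ring
      · rw [← p.X_stay δ s j hj]
        refine (p.dot_u_bound δ hδ (s + 1) j).trans ?_
        rw [p.a_stay δ s j hj]
        gcongr
        linarith
    refine key.trans ?_
    have : 0 < p.Dinf δ * Real.exp (p.w δ q j) * Real.exp (-q) := by positivity
    have hn : (0 : ℝ) ≤ n := Nat.cast_nonneg n
    nlinarith

theorem Lu_le (hδ : 0 < δ) {q : ℝ} (hq : p.τ δ 0 ≤ q) (i : Fin n) :
    Lu n (p.uE δ) q i ≤ p.P δ q i + Real.log ((n + 1) * p.Dinf δ) := by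
  obtain ⟨s, h1, h2⟩ := p.exists_seg δ hδ q hq
  have hD : 1 ≤ p.Dinf δ := (p.one_le_D δ 0).trans (p.D_le δ hδ 0)
  have hn : (0 : ℝ) ≤ n := Nat.cast_nonneg n
  have hi : (i : ℕ) + 1 ≤ n := i.2
  have hl := one_le_lamMin (p.uE δ) q hi
  have hnD : 1 ≤ (n + 1) * p.Dinf δ := by nlinarith
  have hP0 : 0 ≤ p.P δ q i := (p.a_nonneg δ hδ s _).trans (p.a_le_w δ hδ h1 h2.le _)
  have key : lamMin n (p.uE δ) q (i + 1) ≤ (n + 1) * p.Dinf δ * Real.exp (p.P δ q i) := by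
    apply lamMin_le (by nlinarith [Real.one_le_exp hP0])
      (fun l => p.xE δ s (Tuple.sort (p.w δ q) (Fin.castLE hi l)))
    · exact (p.xE_indep δ s).comp _ ((Equiv.injective _).comp (Fin.castLE_injective hi))
    · intro l
      apply (p.xE_body δ hδ h1 h2.le _).mono
      have : p.P δ q (Fin.castLE hi l) ≤ p.P δ q i := by
        apply p.P_mono
        rw [Fin.le_def]
        simp only [Fin.val_castLE]
        omega
      change (n + 1) * p.Dinf δ * Real.exp (p.P δ q (Fin.castLE hi l)) ≤ _
      gcongr
  unfold Lu
  refine (Real.log_le_log (by linarith) key).trans ?_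
  rw [Real.log_mul (by positivity) (by positivity), Real.log_exp]
  linarith

theorem exists_point (hδ : 0 < δ) : ∃ u : EuclideanSpace ℝ (Fin n),
    LinearIndependent ℚ (fun i : Fin n => u i) ∧
    ∃ C, ∀ q, p.τ δ 0 ≤ q → ∀ i, |Lu n u q i - p.P δ q i| ≤ C := by
  have hu0 : p.uE δ ≠ 0 := by
    intro h
    have := congrArg (fun x : EuclideanSpace ℝ (Fin n) => x (p.k 0)) h
    have h2 := p.u_pos δ hδ
    simp [uE] at this
    linarith
  obtain ⟨C, hC⟩ := prod_lamMin_ge (p.uE δ) hu0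
  set E := max (Real.log ((n + 1) * p.Dinf δ)) (max C 0) with hE
  have hE0 : 0 ≤ E := (le_max_right _ _).trans (le_max_right _ _)
  have hbound : ∀ q, p.τ δ 0 ≤ q → ∀ i, |Lu n (p.uE δ) q i - p.P δ q i| ≤ (n + 1) * E := by
    intro q hq i
    apply abs_le_of_sum_eq hE0
    · intro j
      have := p.Lu_le δ hδ hq j
      have h2 : Real.log ((n + 1) * p.Dinf δ) ≤ E := le_max_left _ _
      linarith
    · rw [p.sum_P δ hδ hq]
      have h1 := hC q
      have h2 : C ≤ E := (le_max_left _ _).trans (le_max_right _ _)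
      linarith
  refine ⟨p.uE δ, ?_, (n + 1) * E, hbound⟩
  by_contra h
  have hn : 0 < n := (p.k 0).pos
  obtain ⟨B, hB⟩ := Lu_zero_bdd hn _ h
  obtain ⟨q1, hq1⟩ := ((p.P_proper δ hδ ⟨0, hn⟩).eventually_gt_atTop (B + (n + 1) * E)
    |>.and (eventually_ge_atTop (p.τ δ 0))).exists
  have h3 := abs_le.1 (hbound q1 hq1.2 ⟨0, hn⟩)
  have h4 := hB q1
  linarith [h3.1]

end LPath

/-! ## Part IV: tracking a weak generalized system by a path -/

structure WeakG (n : ℕ) (q0 : ℝ) (F : ℝ → ℕ → ℝ) : Prop where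
  sorted : ∀ q, q0 ≤ q → ∀ i j, i ≤ j → j < n → F q i ≤ F q j
  nonneg : ∀ q, q0 ≤ q → ∀ i, i < n → 0 ≤ F q i
  sum : ∀ q, q0 ≤ q → ∑ i ∈ Finset.range n, F q i = q
  mono : ∀ i, i < n → ∀ q q', q0 ≤ q → q ≤ q' → F q i ≤ F q' i
  dich : ∀ j, j + 1 < n → ∀ a m b, q0 ≤ a → a ≤ m → m ≤ b →
    (∀ t, a ≤ t → t ≤ b → F t j < F t (j + 1)) →
    (∑ i ∈ Finset.range (j + 1), F m i = ∑ i ∈ Finset.range (j + 1), F a i) ∨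
    (∑ i ∈ Finset.range (j + 1), F b i - ∑ i ∈ Finset.range (j + 1), F m i = b - m)
  proper : Tendsto (fun q => F q 0) atTop atTop

namespace Track

def NN (n : ℕ) (δ v : ℝ) : ℕ := ⌈Real.sqrt (v / δ) / n⌉₊

theorem NN_mono {n : ℕ} {δ v v' : ℝ} (hδ : 0 < δ) (h : v ≤ v') : NN n δ v ≤ NN n δ v' := by
  unfold NN
  apply Nat.ceil_mono
  gcongr

theorem le_NN {n : ℕ} (hn : 0 < n) {δ v : ℝ} (hδ : 0 < δ) : v ≤ δ * ((n * NN n δ v : ℕ) : ℝ) ^ 2 := by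
  have h1 : Real.sqrt (v / δ) / n ≤ NN n δ v := Nat.le_ceil _
  have hn' : (0 : ℝ) < n := by exact_mod_cast hn
  rw [div_le_iff₀ hn'] at h1
  have h2 : Real.sqrt (v / δ) ≤ ((n * NN n δ v : ℕ) : ℝ) := by push_cast; linarith
  have h3 := (Real.sqrt_le_iff.1 h2).2
  rw [div_le_iff₀ hδ] at h3
  linarith

theorem NN_le {n : ℕ} (hn : 0 < n) {δ v : ℝ} (hδ : 0 < δ) (hv : 0 ≤ v) :
    δ * ((n * NN n δ v : ℕ) + n : ℝ) ^ 2 ≤ v + 4 * n * Real.sqrt (v * δ) + 4 * n ^ 2 * δ := by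
  have hn' : (0 : ℝ) < n := by exact_mod_cast hn
  have h1 : (NN n δ v : ℝ) < Real.sqrt (v / δ) / n + 1 := Nat.ceil_lt_add_one (by positivity)
  have h2 : ((n * NN n δ v : ℕ) + n : ℝ) ≤ Real.sqrt (v / δ) + 2 * n := by
    push_cast
    have : n * (NN n δ v : ℝ) ≤ n * (Real.sqrt (v / δ) / n + 1) := by gcongr
    have e : n * (Real.sqrt (v / δ) / n + 1) = Real.sqrt (v / δ) + n := by field_simp
    linarith
  have h3 : δ * ((n * NN n δ v : ℕ) + n : ℝ) ^ 2 ≤ δ * (Real.sqrt (v / δ) + 2 * n) ^ 2 := by gcongr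
  refine h3.trans (le_of_eq ?_)
  have e1 : Real.sqrt (v / δ) ^ 2 = v / δ := Real.sq_sqrt (by positivity)
  have e2 : δ * Real.sqrt (v / δ) = Real.sqrt (v * δ) := by
    have : v * δ = δ ^ 2 * (v / δ) := by field_simp
    rw [this, Real.sqrt_mul (by positivity), Real.sqrt_sq hδ.le]
  calc δ * (Real.sqrt (v / δ) + 2 * n) ^ 2 = δ * Real.sqrt (v / δ) ^ 2 + 4 * n * (δ * Real.sqrt (v / δ)) + 4 * n ^ 2 * δ := by ring
    _ = _ := by rw [e1, e2]; field_simp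

section
variable (n : ℕ) (δ q0 : ℝ) (F : ℝ → ℕ → ℝ)

def tt (i : ℕ) : ℝ := q0 + i

/-- chain-linked indices at time `i` -/
def chain (i l r : ℕ) : Prop :=
  l ≤ r ∧ r < n ∧ ∀ j, l ≤ j → j < r → F (tt q0 i) (j + 1) - F (tt q0 i) j ≤ 1

open Classical in
def clos (i : ℕ) (f : ℕ → ℕ) (l : ℕ) : ℕ :=
  ((Finset.range n).filter (fun r => chain n q0 F i l r)).sup f

def S : ℕ → ℕ → ℕ
  | 0 => clos n q0 F 0 (fun r => NN n δ (F (tt q0 0) r))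
  | i + 1 => clos n q0 F (i + 1) (fun r => max (S i r) (NN n δ (F (tt q0 (i + 1)) r)))

end

section
variable {n : ℕ} {δ q0 : ℝ} {F : ℝ → ℕ → ℝ}

theorem le_clos {i l r : ℕ} {f : ℕ → ℕ} (h : chain n q0 F i l r) : f r ≤ clos n q0 F i f l := by
  classical
  unfold clos
  apply Finset.le_sup (f := f)
  simp [h, h.2.1]

theorem clos_le {i l : ℕ} {f : ℕ → ℕ} {B : ℕ} (h : ∀ r, chain n q0 F i l r → f r ≤ B) :
    clos n q0 F i f l ≤ B := by
  classical
  unfold clos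
  apply Finset.sup_le
  intro r hr
  simp at hr
  exact h r hr.2

theorem chain_self {i l : ℕ} (h : l < n) : chain n q0 F i l l :=
  ⟨le_rfl, h, fun j h1 h2 => by omega⟩

theorem self_le_clos {i l : ℕ} {f : ℕ → ℕ} (h : l < n) : f l ≤ clos n q0 F i f l :=
  le_clos (chain_self h)

theorem clos_sorted {i : ℕ} {f : ℕ → ℕ} (hf : ∀ l l', l ≤ l' → l' < n → f l ≤ f l') {l l' : ℕ}
    (h : l ≤ l') (hl' : l' < n) : clos n q0 F i f l ≤ clos n q0 F i f l' := by
  apply clos_le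
  intro r hr
  rcases le_total l' r with h1 | h1
  · exact le_clos ⟨h1, hr.2.1, fun j h2 h3 => hr.2.2 j (by omega) h3⟩
  · exact (hf r l' h1 hl').trans (self_le_clos hl')

theorem clos_linked {i : ℕ} {f : ℕ → ℕ} (hf : ∀ l l', l ≤ l' → l' < n → f l ≤ f l') {l : ℕ}
    (hl : l + 1 < n) (hlink : F (tt q0 i) (l + 1) - F (tt q0 i) l ≤ 1) :
    clos n q0 F i f l = clos n q0 F i f (l + 1) := by
  apply le_antisymm (clos_sorted hf (Nat.le_succ l) hl)
  apply clos_le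
  intro r hr
  apply le_clos
  refine ⟨by have := hr.1; omega, hr.2.1, fun j h1 h2 => ?_⟩
  rcases h1.eq_or_lt with h | h
  · subst h; exact hlink
  · exact hr.2.2 j h h2

variable (hδ : 0 < δ) (hF : WeakG n q0 F)
include hF

theorem tt_ge (i : ℕ) : q0 ≤ tt q0 i := by unfold tt; have : (0:ℝ) ≤ i := Nat.cast_nonneg i; linarith

theorem F_lip {q q' : ℝ} (h0 : q0 ≤ q) (h : q ≤ q') {i : ℕ} (hi : i < n) : F q' i ≤ F q i + (q' - q) := by
  have h1 := hF.sum q h0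
  have h2 := hF.sum q' (h0.trans h)
  have h3 : ∑ j ∈ (Finset.range n).erase i, F q j ≤ ∑ j ∈ (Finset.range n).erase i, F q' j := by
    apply Finset.sum_le_sum
    intro j hj
    exact hF.mono j (by simp at hj; exact hj.2) q q' h0 h
  have h4 := Finset.add_sum_erase (Finset.range n) (F q) (Finset.mem_range.2 hi)
  have h5 := Finset.add_sum_erase (Finset.range n) (F q') (Finset.mem_range.2 hi)
  linarith

include hδ

theorem NF_sorted (i l l' : ℕ) (h : l ≤ l') (h' : l' < n) :
    NN n δ (F (tt q0 i) l) ≤ NN n δ (F (tt q0 i) l') :=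
  NN_mono hδ (hF.sorted _ (tt_ge hF i) l l' h h')

theorem S_sorted (i l l' : ℕ) (h : l ≤ l') (h' : l' < n) : S n δ q0 F i l ≤ S n δ q0 F i l' := by
  induction i generalizing l l' with
  | zero => exact clos_sorted (NF_sorted hδ hF 0) h h'
  | succ i ih =>
    exact clos_sorted (fun l l' h1 h2 => max_le_max (ih l l' h1 h2) (NF_sorted hδ hF _ l l' h1 h2)) h h'

theorem S_linked (i l : ℕ) (hl : l + 1 < n) (h : F (tt q0 i) (l + 1) - F (tt q0 i) l ≤ 1) :
    S n δ q0 F i l = S n δ q0 F i (l + 1) := by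
  cases i with
  | zero => exact clos_linked (NF_sorted hδ hF 0) hl h
  | succ i =>
    exact clos_linked (fun l l' h1 h2 => max_le_max (S_sorted hδ hF i l l' h1 h2)
      (NF_sorted hδ hF _ l l' h1 h2)) hl h

theorem S_chain (i l r : ℕ) (h : chain n q0 F i l r) : S n δ q0 F i l = S n δ q0 F i r := by
  obtain ⟨h1, h2, h3⟩ := h
  induction r, h1 using Nat.le_induction with
  | base => rfl
  | succ r hr ih =>
    rw [ih (by omega) (fun j h4 h5 => h3 j h4 (by omega))]
    exact S_linked hδ hF i r h2 (h3 r hr (by omega))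

omit hδ hF in
theorem S_le_succ (i l : ℕ) (hl : l < n) : S n δ q0 F i l ≤ S n δ q0 F (i + 1) l :=
  (le_max_left _ _).trans (self_le_clos (f := fun r => max (S n δ q0 F i r)
    (NN n δ (F (tt q0 (i + 1)) r))) hl)

omit hδ hF in
theorem N_le_S (i l : ℕ) (hl : l < n) : NN n δ (F (tt q0 i) l) ≤ S n δ q0 F i l := by
  cases i with
  | zero => exact self_le_clos (f := fun r => NN n δ (F (tt q0 0) r)) hl
  | succ i => exact (le_max_right _ _).trans (self_le_clos (f := fun r => max (S n δ q0 F i r)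
    (NN n δ (F (tt q0 (i + 1)) r))) hl)

omit hδ hF in
theorem chain_F {i l r : ℕ} (h : chain n q0 F i l r) :
    F (tt q0 i) r ≤ F (tt q0 i) l + ((r : ℝ) - l) := by
  obtain ⟨h1, h2, h3⟩ := h
  induction r, h1 using Nat.le_induction with
  | base => simp
  | succ r hr ih =>
    have h4 := ih (by omega) (fun j h4 h5 => h3 j h4 (by omega))
    have h5 := h3 r hr (by omega)
    push_cast
    linarith

theorem S_le (i l : ℕ) : S n δ q0 F i l ≤ NN n δ (F (tt q0 i) l + ((n : ℝ) - l)) := by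
  induction i generalizing l with
  | zero =>
    apply clos_le
    intro r hr
    apply NN_mono hδ
    have h1 := chain_F hr
    have h2 : (r : ℝ) ≤ n := by exact_mod_cast hr.2.1.le
    linarith
  | succ i ih =>
    apply clos_le
    intro r hr
    have h1 := chain_F hr
    have h2 : (r : ℝ) ≤ n := by exact_mod_cast hr.2.1.le
    apply max_le
    · refine (ih r).trans (NN_mono hδ ?_)
      have h3 := hF.mono r hr.2.1 (tt q0 i) (tt q0 (i + 1)) (tt_ge hF i) (by unfold tt; push_cast; linarith)
      linarith
    · apply NN_mono hδ
      linarith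

/-- stationarity -/
theorem S_stat (i l R : ℕ) (hl : l < n) (hR : ∀ r, chain n q0 F (i + 1) l r → r ≤ R)
    (hc : ∀ x, l ≤ x → x ≤ R → x < n → F (tt q0 (i + 1)) x = F (tt q0 i) x) :
    S n δ q0 F (i + 1) l = S n δ q0 F i l := by
  apply le_antisymm _ (S_le_succ i l hl)
  apply clos_le
  intro r hr
  have hrR := hR r hr
  have hch : chain n q0 F i l r := by
    refine ⟨hr.1, hr.2.1, fun j h1 h2 => ?_⟩
    rw [← hc j h1 (by omega) (by have := hr.2.1; omega),
      ← hc (j + 1) (by omega) (by omega) (by have := hr.2.1; omega)]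
    exact hr.2.2 j h1 h2
  rw [S_chain hδ hF i l r hch]
  apply max_le le_rfl
  rw [hc r hr.1 hrR hr.2.1]
  exact N_le_S i r hr.2.1

theorem legal {i i' p r : ℕ} (hii : i < i') (hpr : p < r) (hr : r < n)
    (hconst : ∀ i'', i + 1 ≤ i'' → i'' ≤ i' → ∀ x, x < n → S n δ q0 F i'' x = S n δ q0 F i' x)
    (hp : S n δ q0 F i p < S n δ q0 F (i + 1) p) (hr' : S n δ q0 F i' r < S n δ q0 F (i' + 1) r) :
    S n δ q0 F i' p = S n δ q0 F i' r := by
  by_contra hne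
  -- find a jump
  have hex : ∃ j, p ≤ j ∧ j < r ∧ S n δ q0 F i' j ≠ S n δ q0 F i' (j + 1) := by
    by_contra hc
    push Not at hc
    apply hne
    have : ∀ x, p ≤ x → x ≤ r → S n δ q0 F i' p = S n δ q0 F i' x := by
      intro x hx
      induction x, hx using Nat.le_induction with
      | base => intro _; rfl
      | succ x hx ih => intro h; rw [ih (by omega), hc x hx (by omega)]
    exact this r hpr.le le_rfl
  obtain ⟨j, hj1, hj2, hj3⟩ := hex
  have hunl : ∀ i'', i + 1 ≤ i'' → i'' ≤ i' → 1 < F (tt q0 i'') (j + 1) - F (tt q0 i'') j := by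
    intro i'' h1 h2
    by_contra hc
    push Not at hc
    have := S_linked hδ hF i'' j (by omega) hc
    rw [hconst i'' h1 h2 j (by omega), hconst i'' h1 h2 (j + 1) (by omega)] at this
    exact hj3 this
  have htt : ∀ {x y : ℕ}, x ≤ y → tt q0 x ≤ tt q0 y := by
    intro x y h; unfold tt; have : (x : ℝ) ≤ y := by exact_mod_cast h
    linarith
  have htt1 : ∀ x : ℕ, tt q0 (x + 1) = tt q0 x + 1 := by intro x; unfold tt; push_cast; ring
  have hgap : ∀ t, tt q0 i ≤ t → t ≤ tt q0 (i' + 1) → F t j < F t (j + 1) := by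
    intro t h1 h2
    rcases le_total t (tt q0 (i + 1)) with h | h
    · have h3 := hunl (i + 1) le_rfl hii
      have h4 := hF.mono j (by omega) t _ ((tt_ge hF i).trans h1) h
      have h5 := F_lip hF ((tt_ge hF i).trans h1) h (i := j + 1) (by omega)
      have h6 := htt1 i
      linarith
    · -- find i'' with t in window
      have key : ∀ y, i + 1 ≤ y → y ≤ i' + 1 → t ≤ tt q0 y → F t j < F t (j + 1) := by
        intro y hy
        induction y, hy using Nat.le_induction with
        | base =>
          intro _ ht
          have : t = tt q0 (i + 1) := le_antisymm ht h
          rw [this]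
          linarith [hunl (i + 1) le_rfl hii]
        | succ y hy ih =>
          intro h3 h4
          rcases le_total t (tt q0 y) with h5 | h5
          · exact ih (by omega) h5
          · have h6 := hunl y hy (by omega)
            have h7 := F_lip hF (tt_ge hF y) h5 (i := j) (by omega)
            have h8 := hF.mono (j + 1) (by omega) _ t (tt_ge hF y) h5
            have h9 := htt1 y
            linarith
      exact key (i' + 1) (by omega) le_rfl h2
  rcases hF.dich j (by omega) (tt q0 i) (tt q0 (i + 1)) (tt q0 (i' + 1)) (tt_ge hF i)
    (htt (by omega)) (htt (by omega)) hgap with h | h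
  · -- lower part constant on window i
    have heq : ∀ x ∈ Finset.range (j + 1), F (tt q0 i) x = F (tt q0 (i + 1)) x := by
      rw [← Finset.sum_eq_sum_iff_of_le]
      · exact h.symm
      · intro x hx
        exact hF.mono x (by simp at hx; omega) _ _ (tt_ge hF i) (htt (by omega))
    have := S_stat hδ hF i p j (by omega) (by
        intro x hx
        by_contra hc
        push Not at hc
        have h1 := hx.2.2 j hj1 hc
        linarith [hunl (i + 1) le_rfl hii])
      (fun x h1 h2 _ => (heq x (by simp; omega)).symm)
    omega
  · have hs1 := hF.sum _ (tt_ge hF (i' + 1))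
    have hs2 := hF.sum _ (tt_ge hF (i + 1))
    have hsp : ∀ q, ∑ x ∈ Finset.range n, F q x = ∑ x ∈ Finset.range (j + 1), F q x +
        ∑ x ∈ Finset.Ico (j + 1) n, F q x := fun q => (Finset.sum_range_add_sum_Ico _ (by omega)).symm
    rw [hsp] at hs1 hs2
    have heq : ∀ x ∈ Finset.Ico (j + 1) n, F (tt q0 (i + 1)) x = F (tt q0 (i' + 1)) x := by
      rw [← Finset.sum_eq_sum_iff_of_le]
      · linarith
      · intro x hx
        exact hF.mono x (by simp at hx; omega) _ _ (tt_ge hF _) (htt (by omega))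
    have := S_stat hδ hF i' r n hr (fun x hx => hx.2.1.le) (by
      intro x h1 _ h2
      have h3 := heq x (by simp; omega)
      have h4 := hF.mono x h2 (tt q0 (i + 1)) (tt q0 i') (tt_ge hF _) (htt hii)
      have h5 := hF.mono x h2 (tt q0 i') (tt q0 (i' + 1)) (tt_ge hF _) (htt (by omega))
      linarith)
    omega

theorem S_tendsto (hn : 0 < n) (l : ℕ) (hl : l < n) : Tendsto (fun i => S n δ q0 F i l) atTop atTop := by
  rw [tendsto_atTop]
  intro B
  have h1 : Tendsto (fun i => F (tt q0 i) 0) atTop atTop := by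
    apply hF.proper.comp
    unfold tt
    exact tendsto_atTop_add_const_left _ _ tendsto_natCast_atTop_atTop
  filter_upwards [h1.eventually_gt_atTop (δ * ((n * B : ℕ) : ℝ) ^ 2)] with i hi
  have h2 := hF.sorted _ (tt_ge hF i) 0 l (Nat.zero_le _) hl
  have h3 := le_NN hn hδ (v := F (tt q0 i) l)
  have h4 : δ * ((n * B : ℕ) : ℝ) ^ 2 < δ * ((n * NN n δ (F (tt q0 i) l) : ℕ) : ℝ) ^ 2 := by linarith
  have h5 := lt_of_mul_lt_mul_left h4 hδ.le
  have h6 : ((n * B : ℕ) : ℝ) < ((n * NN n δ (F (tt q0 i) l) : ℕ) : ℝ) :=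
    lt_of_pow_lt_pow_left₀ 2 (by positivity) h5
  have h7 : n * B < n * NN n δ (F (tt q0 i) l) := by exact_mod_cast h6
  have h8 := Nat.lt_of_mul_lt_mul_left h7
  exact h8.le.trans (N_le_S i l hl)

end

end Track

namespace Track

/-- label processed at micro step `e` -/
def lab (n e : ℕ) : ℕ := n - 1 - e % n

/-- micro levels -/
def Lv (n : ℕ) (δ q0 : ℝ) (F : ℝ → ℕ → ℝ) (e x : ℕ) : ℕ :=
  n * S n δ q0 F (if lab n e < x then e / n + 1 else e / n) x + (n - 1 - x)

def Act (n : ℕ) (δ q0 : ℝ) (F : ℝ → ℕ → ℝ) (e : ℕ) : Prop :=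
  S n δ q0 F (e / n) (lab n e) < S n δ q0 F (e / n + 1) (lab n e)

variable {n : ℕ} {δ q0 : ℝ} {F : ℝ → ℕ → ℝ}

theorem lab_lt (hn : 0 < n) (e : ℕ) : lab n e < n := by unfold lab; omega

theorem div_mod_succ (hn : 0 < n) (e : ℕ) :
    ((e + 1) / n = e / n ∧ lab n (e + 1) + 1 = lab n e) ∨
    ((e + 1) / n = e / n + 1 ∧ lab n e = 0 ∧ lab n (e + 1) = n - 1) := by
  have h1 := Nat.mod_lt e hn
  unfold lab
  have h3 := Nat.div_add_mod e n
  by_cases h : e % n + 1 < n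
  · left
    have e1 : e + 1 = (e % n + 1) + n * (e / n) := by omega
    have h5 : (e + 1) / n = e / n := by
      rw [e1, Nat.add_mul_div_left _ _ hn, Nat.div_eq_of_lt h, zero_add]
    have h6 : (e + 1) % n = e % n + 1 := by
      rw [e1, Nat.add_mul_mod_self_left, Nat.mod_eq_of_lt h]
    omega
  · right
    have e1 : e + 1 = n * (e / n + 1) := by rw [mul_add, mul_one]; omega
    have h5 : (e + 1) / n = e / n + 1 := by rw [e1, Nat.mul_div_cancel_left _ hn]
    have h6 : (e + 1) % n = 0 := by rw [e1]; exact Nat.mul_mod_right _ _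
    omega

theorem Lv_self (e : ℕ) : Lv n δ q0 F e (lab n e) = n * S n δ q0 F (e / n) (lab n e) + (n - 1 - lab n e) := by
  unfold Lv; simp

theorem Lv_succ_self (hn : 0 < n) (e : ℕ) : Lv n δ q0 F (e + 1) (lab n e) =
    n * S n δ q0 F (e / n + 1) (lab n e) + (n - 1 - lab n e) := by
  unfold Lv
  rcases div_mod_succ hn e with ⟨h1, h2⟩ | ⟨h1, h2, h3⟩
  · rw [if_pos (by omega), h1]
  · rw [if_neg (by omega), h1]

theorem Lv_succ_ne (hn : 0 < n) (e x : ℕ) (hx : x < n) (h : x ≠ lab n e) :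
    Lv n δ q0 F (e + 1) x = Lv n δ q0 F e x := by
  unfold Lv
  rcases div_mod_succ hn e with ⟨h1, h2⟩ | ⟨h1, h2, h3⟩
  · rw [h1]
    by_cases h4 : lab n e < x
    · rw [if_pos (by omega), if_pos h4]
    · rw [if_neg (by omega), if_neg h4]
  · rw [if_neg (by omega), if_pos (by omega), h1]

theorem Lv_mul (hn : 0 < n) (i x : ℕ) (hx : x < n) :
    Lv n δ q0 F (n * i) x = n * S n δ q0 F i x + (n - 1 - x) := by
  unfold Lv
  have h : lab n (n * i) = n - 1 := by unfold lab; rw [Nat.mul_mod_right]; omega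
  rw [if_neg (by omega), Nat.mul_div_cancel_left _ hn]

theorem Lv_succ_of_not_act (hn : 0 < n) (e x : ℕ) (hx : x < n) (h : ¬ Act n δ q0 F e) :
    Lv n δ q0 F (e + 1) x = Lv n δ q0 F e x := by
  by_cases hxe : x = lab n e
  · subst hxe
    rw [Lv_succ_self hn, Lv_self]
    unfold Act at h
    have := S_le_succ (δ := δ) (q0 := q0) (F := F) (e / n) (lab n e) hx
    have h2 : S n δ q0 F (e / n + 1) (lab n e) = S n δ q0 F (e / n) (lab n e) := by omega
    rw [h2]
  · exact Lv_succ_ne hn e x hx hxe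

theorem Lv_const (hn : 0 < n) {e e' : ℕ} (h : e ≤ e') (hact : ∀ f, e ≤ f → f < e' → ¬ Act n δ q0 F f)
    (x : ℕ) (hx : x < n) : Lv n δ q0 F e' x = Lv n δ q0 F e x := by
  induction e', h using Nat.le_induction with
  | base => rfl
  | succ e' he ih =>
    rw [Lv_succ_of_not_act hn e' x hx (hact e' he (by omega)),
      ih (fun f h1 h2 => hact f h1 (by omega))]

theorem S_mono {i i' : ℕ} (h : i ≤ i') {x : ℕ} (hx : x < n) : S n δ q0 F i x ≤ S n δ q0 F i' x := by
  induction i', h using Nat.le_induction with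
  | base => rfl
  | succ i' he ih => exact ih.trans (S_le_succ i' x hx)

theorem Lv_ge (e x : ℕ) (hx : x < n) : n * S n δ q0 F (e / n) x ≤ Lv n δ q0 F e x := by
  unfold Lv
  have : S n δ q0 F (e / n) x ≤ S n δ q0 F (if lab n e < x then e / n + 1 else e / n) x := by
    apply S_mono _ hx
    split_ifs <;> omega
  have := Nat.mul_le_mul_left n this
  omega

theorem Lv_le (e x : ℕ) (hx : x < n) : Lv n δ q0 F e x ≤ n * S n δ q0 F (e / n + 1) x + n := by
  unfold Lv
  have : S n δ q0 F (if lab n e < x then e / n + 1 else e / n) x ≤ S n δ q0 F (e / n + 1) x := by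
    apply S_mono _ hx
    split_ifs <;> omega
  have := Nat.mul_le_mul_left n this
  omega

theorem Lv_inj {e x y : ℕ} (hx : x < n) (hy : y < n) (h : Lv n δ q0 F e x = Lv n δ q0 F e y) : x = y := by
  unfold Lv at h
  have h1 := congrArg (· % n) h
  simp only [Nat.mul_add_mod] at h1
  rw [Nat.mod_eq_of_lt (by omega), Nat.mod_eq_of_lt (by omega)] at h1
  omega

theorem Lv_switch (hδ : 0 < δ) (hF : WeakG n q0 F) (hn : 0 < n) {e e' : ℕ} (hee : e < e')
    (hact : ∀ f, e + 1 ≤ f → f < e' → ¬ Act n δ q0 F f)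
    (he : Act n δ q0 F e) (he' : Act n δ q0 F e') (hne : lab n e' ≠ lab n e) :
    Lv n δ q0 F e' (lab n e') < Lv n δ q0 F e' (lab n e) := by
  have hlp := lab_lt hn e
  have hlr := lab_lt hn e'
  have hc : ∀ x, x < n → Lv n δ q0 F e' x = Lv n δ q0 F (e + 1) x := Lv_const hn hee hact
  rcases lt_or_gt_of_ne hne with h | h
  · -- lower label
    have h1 : Lv n δ q0 F e' (lab n e') = n * S n δ q0 F (e / n) (lab n e') + (n - 1 - lab n e') := by
      rw [hc _ hlr, Lv_succ_ne hn e _ hlr hne]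
      unfold Lv
      rw [if_neg (by omega)]
    rw [h1, hc _ hlp, Lv_succ_self hn]
    have h2 := S_sorted hδ hF (e / n) _ _ h.le hlp
    have h3 : S n δ q0 F (e / n) (lab n e') + 1 ≤ S n δ q0 F (e / n + 1) (lab n e) := by
      unfold Act at he; omega
    have h4 := Nat.mul_le_mul_left n h3
    rw [mul_add, mul_one] at h4
    omega
  · have hii : e / n < e' / n := by
      by_contra hc'
      have h1 : e / n ≤ e' / n := Nat.div_le_div_right hee.le
      have h2 : e / n = e' / n := by omega
      unfold lab at h
      have h3 := Nat.div_add_mod e n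
      have h4 := Nat.div_add_mod e' n
      rw [h2] at h3
      omega
    have hSc : ∀ i'', e / n + 1 ≤ i'' → i'' ≤ e' / n → ∀ x, x < n →
        Lv n δ q0 F e' x = n * S n δ q0 F i'' x + (n - 1 - x) := by
      intro i'' h1 h2 x hx
      rw [← Lv_mul hn i'' x hx]
      have h3 : e + 1 ≤ n * i'' := by
        have h4 := Nat.div_add_mod e n
        have h5 := Nat.mod_lt e hn
        have h6 := Nat.mul_le_mul_left n h1
        rw [mul_add, mul_one] at h6
        omega
      have h4 : n * i'' ≤ e' := by
        have h4 := Nat.div_add_mod e' n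
        have h6 := Nat.mul_le_mul_left n h2
        omega
      exact Lv_const hn h4 (fun f h5 h6 => hact f (by omega) h6) x hx
    have heq := legal hδ hF hii h hlr (by
      intro i'' h1 h2 x hx
      have h3 := hSc i'' h1 h2 x hx
      have h4 := hSc (e' / n) hii le_rfl x hx
      rw [h3] at h4
      have h5 : n * S n δ q0 F i'' x = n * S n δ q0 F (e' / n) x := by omega
      exact Nat.eq_of_mul_eq_mul_left hn h5) he he'
    rw [hSc (e' / n) hii le_rfl _ hlp, hSc (e' / n) hii le_rfl _ hlr, heq]
    omega

theorem act_infinite (hδ : 0 < δ) (hF : WeakG n q0 F) (hn : 0 < n) :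
    {e | Act n δ q0 F e}.Infinite := by
  intro hfin
  obtain ⟨B, hB⟩ := hfin.bddAbove
  have hc : ∀ e, B + 1 ≤ e → Lv n δ q0 F e 0 = Lv n δ q0 F (B + 1) 0 := by
    intro e he
    apply Lv_const hn he _ 0 hn
    intro f h1 _ h3
    have := hB h3
    omega
  obtain ⟨i, hi1, hi2⟩ := ((S_tendsto hδ hF hn 0 hn).eventually_gt_atTop (Lv n δ q0 F (B + 1) 0)
    |>.and (eventually_ge_atTop (B + 1))).exists
  have h1 := hc (n * i) (by nlinarith)
  rw [Lv_mul hn i 0 hn] at h1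
  nlinarith

/-- enumeration of the actual rises -/
def ee (n : ℕ) (δ q0 : ℝ) (F : ℝ → ℕ → ℝ) (s : ℕ) : ℕ := Nat.nth (Act n δ q0 F) s

theorem ee_lt (hδ : 0 < δ) (hF : WeakG n q0 F) (hn : 0 < n) (s : ℕ) :
    ee n δ q0 F s < ee n δ q0 F (s + 1) := Nat.nth_strictMono (act_infinite hδ hF hn) (Nat.lt_succ_self s)

theorem ee_act (hδ : 0 < δ) (hF : WeakG n q0 F) (hn : 0 < n) (s : ℕ) :
    Act n δ q0 F (ee n δ q0 F s) := Nat.nth_mem_of_infinite (act_infinite hδ hF hn) s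

theorem ee_between (hδ : 0 < δ) (hF : WeakG n q0 F) (hn : 0 < n) (s : ℕ) (f : ℕ)
    (h1 : ee n δ q0 F s + 1 ≤ f) (h2 : f < ee n δ q0 F (s + 1)) : ¬ Act n δ q0 F f := by
  intro hf
  have h3 := act_infinite hδ hF hn
  have hm := Nat.nth_strictMono h3
  have h4 : f ∈ range (Nat.nth (Act n δ q0 F)) := by
    rw [Nat.range_nth_of_infinite h3]; exact hf
  obtain ⟨r, hr⟩ := h4
  unfold ee at h1 h2
  rw [← hr] at h1 h2
  have h5 := hm.lt_iff_lt.1 h2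
  have h6 := hm.lt_iff_lt.1 (show Nat.nth (Act n δ q0 F) s < Nat.nth (Act n δ q0 F) r by omega)
  omega

theorem Lv_ee_succ (hδ : 0 < δ) (hF : WeakG n q0 F) (hn : 0 < n) (s x : ℕ) (hx : x < n) :
    Lv n δ q0 F (ee n δ q0 F (s + 1)) x = Lv n δ q0 F (ee n δ q0 F s + 1) x :=
  Lv_const hn (ee_lt hδ hF hn s) (ee_between hδ hF hn s) x hx

def path (hδ : 0 < δ) (hF : WeakG n q0 F) (hn : 0 < n) : LPath n where
  lev s j := Lv n δ q0 F (ee n δ q0 F s) j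
  k s := ⟨lab n (ee n δ q0 F s), lab_lt hn _⟩
  stay s j h := by
    rw [Lv_ee_succ hδ hF hn s j j.2]
    exact Lv_succ_ne hn _ _ j.2 (fun h' => h (Fin.ext h'))
  rise s := by
    rw [Lv_ee_succ hδ hF hn s _ (lab_lt hn _)]
    simp only
    rw [Lv_succ_self hn, Lv_self]
    have := Nat.mul_lt_mul_of_pos_left (ee_act hδ hF hn s) hn
    omega
  sw s h := by
    apply Lv_switch hδ hF hn (ee_lt hδ hF hn s) (ee_between hδ hF hn s) (ee_act hδ hF hn s)
      (ee_act hδ hF hn (s + 1))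
    intro h'
    exact h (Fin.ext h')
  inj s := by
    intro i j h
    exact Fin.ext (Lv_inj i.2 j.2 h)
  prop j := by
    have h1 : Tendsto (fun s => S n δ q0 F (ee n δ q0 F s / n) j) atTop atTop := by
      apply (S_tendsto hδ hF hn j j.2).comp
      apply (Nat.tendsto_div_const_atTop hn.ne').comp
      exact (Nat.nth_strictMono (act_infinite hδ hF hn)).tendsto_atTop
    refine tendsto_atTop_mono (fun s => ?_) h1
    have := Lv_ge (δ := δ) (q0 := q0) (F := F) (ee n δ q0 F s) j j.2
    nlinarith

theorem track (hδ : 0 < δ) (hF : WeakG n q0 F) (hn : 0 < n) :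
    ∃ p : LPath n, ∀ i : Fin n, Tendsto (fun q => (p.P δ q i - F q i) / q) atTop (nhds 0) := by
  let p := path hδ hF hn
  refine ⟨p, ?_⟩
  set E : ℝ → ℝ := fun q => (n + 1) + 4 * n * Real.sqrt ((q + (n + 1)) * δ) + 4 * n ^ 2 * δ with hE
  have hτ : ∀ s, tt q0 (ee n δ q0 F s / n) ≤ p.τ δ s := by
    intro s
    set i := ee n δ q0 F s / n with hi
    rw [← hF.sum _ (tt_ge hF i), ← Fin.sum_univ_eq_sum_range]
    apply Finset.sum_le_sum
    intro j _
    refine (le_NN hn hδ).trans ?_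
    have h1 := N_le_S (δ := δ) (q0 := q0) (F := F) i j j.2
    have h2 := Lv_ge (δ := δ) (q0 := q0) (F := F) (ee n δ q0 F s) j j.2
    have h3 : n * NN n δ (F (tt q0 i) j) ≤ p.lev s j := (Nat.mul_le_mul_left n h1).trans h2
    unfold LPath.a
    gcongr
  have hw : ∀ q, p.τ δ 0 ≤ q → ∀ j : Fin n, p.w δ q j ≤ F q j + E q := by
    intro q hq j
    obtain ⟨s, h1, h2⟩ := p.exists_seg δ hδ q hq
    refine (p.w_le_a δ hδ h1 h2.le j).trans ?_
    set i := ee n δ q0 F s / n with hi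
    have hqi : tt q0 i ≤ q := (hτ s).trans h1
    have hq0 : q0 ≤ q := (tt_ge hF i).trans hqi
    have hlev : p.lev (s + 1) j ≤ n * S n δ q0 F (i + 1) j + n := by
      have e1 : p.lev (s + 1) j = Lv n δ q0 F (ee n δ q0 F s + 1) j := Lv_ee_succ hδ hF hn s j j.2
      rw [e1]
      by_cases hj : (j : ℕ) = lab n (ee n δ q0 F s)
      · have e2 := Lv_succ_self (δ := δ) (q0 := q0) (F := F) hn (ee n δ q0 F s)
        rw [← hi, ← hj] at e2
        rw [e2]; omega
      · rw [Lv_succ_ne hn _ _ j.2 hj]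
        exact Lv_le _ _ j.2
    have hF1 : F (tt q0 (i + 1)) j ≤ F q j + 1 := by
      have h3 := F_lip hF (tt_ge hF i) (show tt q0 i ≤ tt q0 (i + 1) by unfold tt; push_cast; linarith) j.2
      have h4 := hF.mono j j.2 _ _ (tt_ge hF i) hqi
      have h5 : tt q0 (i + 1) - tt q0 i = 1 := by unfold tt; push_cast; ring
      linarith
    have hS : S n δ q0 F (i + 1) j ≤ NN n δ (F q j + (n + 1)) := by
      refine (S_le hδ hF (i + 1) j).trans (NN_mono hδ ?_)
      have : (0 : ℝ) ≤ (j : ℕ) := Nat.cast_nonneg _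
      linarith
    have hF0 := hF.nonneg q hq0 j j.2
    have hFq : F q j ≤ q := by
      conv_rhs => rw [← hF.sum q hq0]
      exact Finset.single_le_sum (f := fun i => F q i) (fun i hi => hF.nonneg q hq0 i (Finset.mem_range.1 hi))
        (Finset.mem_range.2 j.2)
    have h6 := NN_le hn hδ (v := F q j + (n + 1)) (by positivity)
    have h7 : (p.lev (s + 1) j : ℝ) ≤ (n * NN n δ (F q j + (n + 1)) : ℕ) + n := by
      have := hlev.trans (Nat.add_le_add_right (Nat.mul_le_mul_left n hS) n)
      exact_mod_cast this
    unfold LPath.a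
    calc δ * (p.lev (s + 1) j : ℝ) ^ 2 ≤ δ * ((n * NN n δ (F q j + (n + 1)) : ℕ) + n : ℝ) ^ 2 := by gcongr
      _ ≤ _ := h6
      _ ≤ F q j + (n + 1) + 4 * n * Real.sqrt ((q + (n + 1)) * δ) + 4 * n ^ 2 * δ := by gcongr
      _ = F q j + E q := by simp only [hE]; ring
  have hE0 : ∀ q, 0 ≤ E q := by intro q; simp only [hE]; positivity
  have hclose : ∀ q, p.τ δ 0 ≤ q → q0 ≤ q → ∀ i : Fin n, |p.P δ q i - F q i| ≤ (n + 1) * E q := by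
    intro q hq hq0 i
    apply abs_le_of_sum_eq (F := fun i : Fin n => F q i) (hE0 q)
    · intro j
      exact sort_le_of_le (F := fun i : Fin n => F q i) (Tuple.monotone_sort (p.w δ q))
        (fun i j hij => hF.sorted q hq0 i j hij j.2) (hw q hq) j
    · rw [p.sum_P δ hδ hq, Fin.sum_univ_eq_sum_range (fun i => F q i), hF.sum q hq0]
      linarith [hE0 q]
  intro i
  set K : ℝ := (n + 1) * ((n + 1) + 4 * n * Real.sqrt ((n + 2) * δ) + 4 * n ^ 2 * δ) with hK
  have hlim : Tendsto (fun q : ℝ => K / Real.sqrt q) atTop (nhds 0) :=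
    Real.tendsto_sqrt_atTop.const_div_atTop K
  apply squeeze_zero_norm' _ hlim
  filter_upwards [eventually_ge_atTop (p.τ δ 0), eventually_ge_atTop q0, eventually_ge_atTop 1]
    with q h1 h2 h3
  have hq : 0 < q := by linarith
  have hs1 : 1 ≤ Real.sqrt q := Real.one_le_sqrt.2 h3
  have hEq : E q ≤ ((n + 1) + 4 * n * Real.sqrt ((n + 2) * δ) + 4 * n ^ 2 * δ) * Real.sqrt q := by
    have e : Real.sqrt ((q + (n + 1)) * δ) ≤ Real.sqrt ((n + 2) * δ) * Real.sqrt q := by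
      rw [← Real.sqrt_mul (by positivity)]
      apply Real.sqrt_le_sqrt
      have : q + (n + 1) ≤ (n + 2) * q := by
        have hn0 : (0 : ℝ) ≤ n := Nat.cast_nonneg n
        nlinarith
      nlinarith
    have e2 : 4 * n * Real.sqrt ((q + (n + 1)) * δ) ≤ 4 * n * (Real.sqrt ((n + 2) * δ) * Real.sqrt q) := by gcongr
    have e3 : ((n : ℝ) + 1) ≤ (n + 1) * Real.sqrt q := le_mul_of_one_le_right (by positivity) hs1
    have e4 : 4 * (n : ℝ) ^ 2 * δ ≤ 4 * n ^ 2 * δ * Real.sqrt q := le_mul_of_one_le_right (by positivity) hs1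
    simp only [hE]
    linarith
  rw [Real.norm_eq_abs, abs_div, abs_of_pos hq, div_le_div_iff₀ hq (by positivity)]
  calc |p.P δ q i - F q i| * Real.sqrt q ≤ ((n + 1) * E q) * Real.sqrt q := by
        gcongr; exact hclose q h1 h2 i
    _ ≤ ((n + 1) * (((n + 1) + 4 * n * Real.sqrt ((n + 2) * δ) + 4 * n ^ 2 * δ) * Real.sqrt q)) * Real.sqrt q := by
        gcongr
    _ = K * (Real.sqrt q * Real.sqrt q) := by rw [hK]; ring
    _ = K * q := by rw [Real.mul_self_sqrt hq.le]

end Track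

/-! ## Part VI: n-systems, generalized n-systems, weak systems -/

theorem chain_rel {q0 : ℝ} (R : ℝ → ℝ → Prop) (hrefl : ∀ x, R x x)
    (htr : ∀ x y z, x ≤ y → y ≤ z → R x y → R y z → R x z)
    (hloc : ∀ q, q0 ≤ q → ∃ ε > 0, (∀ t, q0 ≤ t → q - ε ≤ t → t ≤ q → R t q) ∧
      (∀ t, q ≤ t → t ≤ q + ε → R q t)) {x y : ℝ} (hx : q0 ≤ x) (hxy : x ≤ y) : R x y := by
  set S : Set ℝ := {t | t ∈ Icc x y ∧ R x t} with hS
  have hne : S.Nonempty := ⟨x, ⟨le_refl _, hxy⟩, hrefl x⟩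
  have hbdd : BddAbove S := ⟨y, fun t ht => ht.1.2⟩
  set s := sSup S with hs
  have hxs : x ≤ s := le_csSup hbdd ⟨⟨le_refl _, hxy⟩, hrefl x⟩
  have hsy : s ≤ y := csSup_le hne fun t ht => ht.1.2
  obtain ⟨ε, hε, h1, h2⟩ := hloc s (hx.trans hxs)
  have hRs : R x s := by
    obtain ⟨t, ht, hts⟩ := exists_lt_of_lt_csSup hne (show s - ε < s by linarith)
    have htle : t ≤ s := le_csSup hbdd ht
    exact htr _ _ _ ht.1.1 htle ht.2 (h1 t (hx.trans ht.1.1) hts.le htle)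
  rcases hsy.eq_or_lt with h | h
  · rwa [← h]
  · exfalso
    have hm : s < min y (s + ε) := lt_min h (by linarith)
    have : min y (s + ε) ∈ S := ⟨⟨by linarith, min_le_left _ _⟩,
      htr _ _ _ hxs hm.le hRs (h2 _ hm.le (min_le_right _ _))⟩
    have := le_csSup hbdd this
    linarith

theorem slope_dich {f : ℝ → ℝ} {a b : ℝ}
    (hm : ∀ x y, a ≤ x → x ≤ y → y ≤ b → 0 ≤ f y - f x ∧ f y - f x ≤ y - x)
    (hloc : ∀ q, a ≤ q → q ≤ b → ∃ ε > 0, ∃ sl sr : Prop,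
      (∀ t, a ≤ t → q - ε ≤ t → t ≤ q → (sl → f q - f t = q - t) ∧ (¬ sl → f q = f t)) ∧
      (∀ t, q ≤ t → t ≤ q + ε → t ≤ b → (sr → f t - f q = t - q) ∧ (¬ sr → f t = f q)) ∧
      (a < q → q < b → sl → sr))
    {m : ℝ} (ham : a ≤ m) (hmb : m ≤ b) : f m = f a ∨ f b - f m = b - m := by
  set S : Set ℝ := {t | t ∈ Icc a b ∧ f t = f a} with hS
  have hne : S.Nonempty := ⟨a, ⟨le_refl _, ham.trans hmb⟩, rfl⟩
  have hbdd : BddAbove S := ⟨b, fun t ht => ht.1.2⟩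
  set s := sSup S with hs
  have has : a ≤ s := le_csSup hbdd ⟨⟨le_refl _, ham.trans hmb⟩, rfl⟩
  have hsb : s ≤ b := csSup_le hne fun t ht => ht.1.2
  have hfs : f s = f a := by
    apply le_antisymm _ (by linarith [(hm a s le_rfl has hsb).1])
    apply le_of_forall_pos_le_add
    intro ε hε
    obtain ⟨t, ht, hts⟩ := exists_lt_of_lt_csSup hne (show s - ε < s by linarith)
    have htle : t ≤ s := le_csSup hbdd ht
    have := (hm t s ht.1.1 htle hsb).2
    have := ht.2
    linarith
  rcases le_or_gt m s with hms | hms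
  · left
    linarith [(hm a m le_rfl ham hmb).1, (hm m s ham hms hsb).1]
  right
  set U : Set ℝ := {t | t ∈ Icc s b ∧ f t - f s = t - s} with hU
  have hsU : s ∈ U := ⟨⟨le_refl _, hsb⟩, by simp⟩
  have hneU : U.Nonempty := ⟨s, hsU⟩
  have hbddU : BddAbove U := ⟨b, fun t ht => ht.1.2⟩
  set s' := sSup U with hs'
  have hss' : s ≤ s' := le_csSup hbddU hsU
  have hs'b : s' ≤ b := csSup_le hneU fun t ht => ht.1.2
  have hfs' : f s' - f s = s' - s := by
    apply le_antisymm (hm s s' has hss' hs'b).2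
    apply le_of_forall_pos_le_add
    intro ε hε
    obtain ⟨t, ht, hts⟩ := exists_lt_of_lt_csSup hneU (show s' - ε < s' by linarith)
    have htle : t ≤ s' := le_csSup hbddU ht
    have := (hm t s' (has.trans ht.1.1) htle hs'b).1
    have := ht.2
    linarith
  have key : s' = b := by
    by_contra hne'
    have hlt : s' < b := lt_of_le_of_ne hs'b hne'
    obtain ⟨ε, hε, sl, sr, h1, h2, h3⟩ := hloc s' (has.trans hss') hs'b
    have hsr : sr := by
      by_contra hsr
      rcases hss'.eq_or_lt with h | h
      · have hmm : s' < min b (s' + ε) := lt_min hlt (by linarith)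
        have e := (h2 (min b (s' + ε)) hmm.le (min_le_right _ _) (min_le_left _ _)).2 hsr
        have : min b (s' + ε) ∈ S := ⟨⟨by linarith, min_le_left _ _⟩, by rw [e, ← h, hfs]⟩
        have := le_csSup hbdd this
        linarith
      · have hsl : ¬ sl := fun hsl => hsr (h3 (by linarith) hlt hsl)
        have hmm : max s (s' - ε) < s' := max_lt h (by linarith)
        have e := (h1 (max s (s' - ε)) (has.trans (le_max_left _ _)) (le_max_right _ _) hmm.le).2 hsl
        have := (hm s (max s (s' - ε)) has (le_max_left _ _) (by linarith)).2
        linarith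
    have hmm : s' < min b (s' + ε) := lt_min hlt (by linarith)
    have e := (h2 (min b (s' + ε)) hmm.le (min_le_right _ _) (min_le_left _ _)).1 hsr
    have : min b (s' + ε) ∈ U := ⟨⟨by linarith, min_le_left _ _⟩, by linarith⟩
    have := le_csSup hbddU this
    linarith
  rw [key] at hfs'
  linarith [(hm s m has hms.le hmb).2, (hm m b ham hmb le_rfl).2]

theorem slope_of_dich {H : Set ℝ} {f : ℝ → ℝ}
    (hm : ∀ x ∈ H, ∀ y ∈ H, x ≤ y → 0 ≤ f y - f x ∧ f y - f x ≤ y - x)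
    (hbd : ∀ x ∈ H, 0 ≤ f x)
    (hd : ∀ a ∈ H, ∀ m ∈ H, ∀ b ∈ H, a ≤ m → m ≤ b → f m = f a ∨ f b - f m = b - m)
    (htop : ∀ v, (∀ x ∈ H, f x = v) → BddAbove H) : SlopeZeroOneOn H f := by
  rcases H.eq_empty_or_nonempty with rfl | hne
  · exact ⟨0, 0, by simp⟩
  have hb : BddBelow (f '' H) := ⟨0, by rintro _ ⟨x, hx, rfl⟩; exact hbd x hx⟩
  set v := sInf (f '' H) with hv
  have hvle : ∀ x ∈ H, v ≤ f x := fun x hx => csInf_le hb ⟨x, hx, rfl⟩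
  have hlt : ∀ x ∈ H, v < f x → ∃ a ∈ H, f a < f x ∧ a ≤ x := by
    intro x hx h
    obtain ⟨_, ⟨a, ha, rfl⟩, h2⟩ := exists_lt_of_csInf_lt (hne.image f) h
    refine ⟨a, ha, h2, ?_⟩
    by_contra hax
    linarith [(hm x hx a ha (not_le.1 hax).le).1]
  by_cases h : ∃ t0 ∈ H, v < f t0
  · obtain ⟨t0, ht0, hv0⟩ := h
    refine ⟨t0 - f t0 + v, v, fun t ht => ?_⟩
    rcases le_total t0 t with htt | htt
    · obtain ⟨a, ha, h1, h2⟩ := hlt t0 ht0 hv0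
      rcases hd a ha t0 ht0 t ht h2 htt with h3 | h3
      · linarith
      · rw [max_eq_left (by linarith)]; linarith
    · rcases (hvle t ht).eq_or_lt with h3 | h3
      · rw [max_eq_right (by linarith [(hm t ht t0 ht0 htt).2])]; linarith
      · obtain ⟨a, ha, h1, h2⟩ := hlt t ht h3
        rcases hd a ha t ht t0 ht0 h2 htt with h4 | h4
        · linarith
        · rw [max_eq_left (by linarith)]; linarith
  · push Not at h
    have hc : ∀ x ∈ H, f x = v := fun x hx => le_antisymm (h x hx) (hvle x hx)
    obtain ⟨c, hc'⟩ := htop v hc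
    exact ⟨c, v, fun t ht => by rw [max_eq_right (by linarith [hc' ht]), hc t ht, add_zero]⟩

theorem IsNSystem.coord {n : ℕ} {q0 : ℝ} {P : ℝ → Fin n → ℝ} (h : IsNSystem n (Ici q0) P)
    (i : Fin n) {x y : ℝ} (hx : q0 ≤ x) (hxy : x ≤ y) :
    0 ≤ P y i - P x i ∧ P y i - P x i ≤ y - x := by
  refine chain_rel (q0 := q0) (fun x y => 0 ≤ P y i - P x i ∧ P y i - P x i ≤ y - x)
    (by simp) (fun x y z _ _ h1 h2 => ⟨by linarith [h1.1, h2.1], by linarith [h1.2, h2.2]⟩) ?_ hx hxy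
  intro q hq
  obtain ⟨-, ε, hε, k, l, h1, h2, -⟩ := h q hq
  refine ⟨ε, hε, fun t ht ht1 ht2 => ?_, fun t ht1 ht2 => ?_⟩
  · rw [h1 t ⟨ht, ht1, ht2⟩, Pi.add_apply, Pi.single_apply]
    split_ifs <;> constructor <;> linarith
  · rw [h2 t ⟨hq.trans ht1, ht1, ht2⟩, Pi.add_apply, Pi.single_apply]
    split_ifs <;> constructor <;> linarith

theorem IsNSystem.psum_coord {n : ℕ} {q0 : ℝ} {P : ℝ → Fin n → ℝ} (h : IsNSystem n (Ici q0) P)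
    (j : ℕ) {x y : ℝ} (hx : q0 ≤ x) (hxy : x ≤ y) :
    0 ≤ (∑ i : Fin n, if (i : ℕ) ≤ j then P y i else 0) - (∑ i : Fin n, if (i : ℕ) ≤ j then P x i else 0)
    ∧ (∑ i : Fin n, if (i : ℕ) ≤ j then P y i else 0) - (∑ i : Fin n, if (i : ℕ) ≤ j then P x i else 0)
      ≤ y - x := by
  rw [← Finset.sum_sub_distrib]
  constructor
  · apply Finset.sum_nonneg
    intro i _
    have := (h.coord i hx hxy).1
    split_ifs <;> simp; linarith
  · have e : y - x = ∑ i, (P y i - P x i) := by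
      rw [Finset.sum_sub_distrib, (h y (hx.trans hxy)).1.2.2, (h x hx).1.2.2]
    rw [e]
    apply Finset.sum_le_sum
    intro i _
    have := (h.coord i hx hxy).1
    split_ifs <;> linarith

theorem psum_add_single {n : ℕ} (j : ℕ) (p : Fin n → ℝ) (l : Fin n) (c : ℝ) :
    (∑ i : Fin n, if (i : ℕ) ≤ j then (p + Pi.single l c : Fin n → ℝ) i else 0) =
    (∑ i : Fin n, if (i : ℕ) ≤ j then p i else 0) + if (l : ℕ) ≤ j then c else 0 := by
  have : ∀ i : Fin n, (if (i : ℕ) ≤ j then (p + Pi.single l c : Fin n → ℝ) i else 0) =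
    (if (i : ℕ) ≤ j then p i else 0) + if i = l then (if (l : ℕ) ≤ j then c else 0) else 0 := by
    intro i
    rw [Pi.add_apply, Pi.single_apply]
    by_cases h : i = l
    · subst h; split_ifs <;> simp
    · simp [h]
  rw [Finset.sum_congr rfl (fun i _ => this i), Finset.sum_add_distrib]
  simp

theorem IsNSystem.isGen {n : ℕ} {q0 : ℝ} {P : ℝ → Fin n → ℝ} (h : IsNSystem n (Ici q0) P)
    (hp : IsProper n P) : IsGenNSystem n (Ici q0) P := by
  have hlip : ∀ i : Fin n, LipschitzOnWith 1 (fun q => P q i) (Ici q0) := by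
    intro i
    apply LipschitzOnWith.of_dist_le_mul
    intro x hx y hy
    rw [Real.dist_eq, Real.dist_eq, NNReal.coe_one, one_mul]
    rcases le_total x y with hxy | hxy
    · have := h.coord i hx hxy
      rw [abs_sub_comm, abs_sub_comm x y, abs_of_nonneg this.1, abs_of_nonneg (by linarith)]
      exact this.2
    · have := h.coord i hy hxy
      rw [abs_of_nonneg this.1, abs_of_nonneg (by linarith)]
      exact this.2
  refine ⟨continuousOn_pi.2 fun i => (hlip i).continuousOn, ?_, fun q hq => (h q hq).1,
    fun i => ⟨fun x hx y hy hxy => by simpa using (h.coord i hx hxy).1, hlip i⟩, ?_⟩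
  · intro q hq
    obtain ⟨-, ε, hε, k, l, h1, h2, -⟩ := h q hq
    refine ⟨ε, hε, Pi.single l 1, fun i => P q i - (Pi.single l 1 : Fin n → ℝ) i * q, Pi.single k 1,
      fun i => P q i - (Pi.single k 1 : Fin n → ℝ) i * q, fun t ht i => ?_, fun t ht i => ?_⟩
    · simp only [h1 t ht, Pi.add_apply, Pi.single_apply]
      split_ifs <;> ring
    · simp only [h2 t ht, Pi.add_apply, Pi.single_apply]
      split_ifs <;> ring
  · intro j hj H hHI hH hlt
    apply slope_of_dich
    · intro x hx y hy hxy
      exact h.psum_coord j (hHI hx) hxy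
    · intro x hx
      apply Finset.sum_nonneg
      intro i _
      have := (h x (hHI hx)).1.1 i
      split_ifs <;> simp [this]
    · intro a ha m hm b hb ham hmb
      refine slope_dich (f := fun q => ∑ i : Fin n, if (i : ℕ) ≤ j then P q i else 0)
        (fun x y hx hxy _ => h.psum_coord j ((hHI ha : q0 ≤ a).trans hx) hxy) ?_ ham hmb
      intro q haq hqb
      have hqH : q ∈ H := hH.out ha hb ⟨haq, hqb⟩
      have hq0a : q0 ≤ a := hHI ha
      obtain ⟨-, ε, hε, k, l, h1, h2, h3⟩ := h q (hHI hqH)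
      refine ⟨ε, hε, (l : ℕ) ≤ j, (k : ℕ) ≤ j, fun t hat ht1 ht2 => ?_, fun t ht1 ht2 htb => ?_, ?_⟩
      · have e := h1 t ⟨hq0a.trans hat, ht1, ht2⟩
        simp only [e, psum_add_single]
        constructor <;> intro hl <;> simp [hl]
      · have e := h2 t ⟨(hq0a.trans haq).trans ht1, ht1, ht2⟩
        simp only [e, psum_add_single]
        constructor <;> intro hl <;> simp [hl]
      · intro haq' _ hl
        by_contra hk
        have h4 := h3 (by rw [interior_Ici]; exact lt_of_le_of_lt hq0a haq') (by rw [Fin.lt_def]; omega)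
        have e1 := h4 ⟨j, Nat.lt_of_succ_lt hj⟩ (by rw [Fin.le_def]; exact hl) (by rw [Fin.le_def]; simp; omega)
        have e2 := h4 ⟨j + 1, hj⟩ (by rw [Fin.le_def]; simp; omega) (by rw [Fin.le_def]; simp; omega)
        have := hlt q hqH
        rw [e1, e2] at this
        exact lt_irrefl _ this
    · intro v hv
      by_contra hnb
      rw [not_bddAbove_iff] at hnb
      have h0 := hp ⟨0, by omega⟩
      obtain ⟨B, hB⟩ := eventually_atTop.1 (h0.eventually_gt_atTop v)
      obtain ⟨x, hx, hBx⟩ := hnb B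
      have e1 := hv x hx
      have e2 := hB x hBx.le
      have e3 : (if ((⟨0, by omega⟩ : Fin n) : ℕ) ≤ j then P x ⟨0, by omega⟩ else 0) ≤
          ∑ i : Fin n, if (i : ℕ) ≤ j then P x i else 0 :=
        Finset.single_le_sum (f := fun i : Fin n => if (i : ℕ) ≤ j then P x i else 0) (fun i _ => by
          have := (h x (hHI hx)).1.1 i
          split_ifs <;> simp [this]) (Finset.mem_univ _)
      simp at e3
      linarith

theorem sum_range_ext {n j : ℕ} (hj : j + 1 ≤ n) (g : Fin n → ℝ) :
    ∑ i ∈ Finset.range (j + 1), (if h : i < n then g ⟨i, h⟩ else 0) =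
    ∑ i : Fin n, if (i : ℕ) ≤ j then g i else 0 := by
  have : ∀ i : Fin n, (if (i : ℕ) ≤ j then g i else 0) =
    (fun i : ℕ => if i ≤ j then (if h : i < n then g ⟨i, h⟩ else 0) else 0) i := by
    intro i; simp
  rw [Finset.sum_congr rfl fun i _ => this i,
    Fin.sum_univ_eq_sum_range (fun i : ℕ => if i ≤ j then (if h : i < n then g ⟨i, h⟩ else 0) else 0),
    ← Finset.sum_filter]
  apply Finset.sum_congr _ (fun _ _ => rfl)
  ext i; simp; omega

theorem IsGenNSystem.weakG {n : ℕ} (hn : 0 < n) {q0 : ℝ} {P : ℝ → Fin n → ℝ}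
    (h : IsGenNSystem n (Ici q0) P) (hp : IsProper n P) :
    WeakG n q0 (fun q i => if h : i < n then P q ⟨i, h⟩ else 0) := by
  obtain ⟨-, -, h1, h2, h3⟩ := h
  constructor
  · intro q hq i j hij hj
    rw [dif_pos hj, dif_pos (lt_of_le_of_lt hij hj)]
    exact (h1 q hq).2.1 hij
  · intro q hq i hi
    rw [dif_pos hi]
    exact (h1 q hq).1 _
  · intro q hq
    rw [← Fin.sum_univ_eq_sum_range (fun i => if h : i < n then P q ⟨i, h⟩ else 0)]
    simp [(h1 q hq).2.2]
  · intro i hi q q' hq hqq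
    simp only [dif_pos hi]
    exact (h2 ⟨i, hi⟩).1 hq (hq.trans hqq) hqq
  · intro j hj a m b ha ham hmb hlt
    simp only [sum_range_ext hj.le]
    obtain ⟨c, v, hcv⟩ := h3 j hj (Icc a b) (fun t ht => ha.trans ht.1) ordConnected_Icc (by
      intro q hq
      have := hlt q hq.1 hq.2
      rwa [dif_pos hj, dif_pos (Nat.lt_of_succ_lt hj)] at this)
    have ea := hcv a ⟨le_rfl, ham.trans hmb⟩
    have em := hcv m ⟨ham, hmb⟩
    have eb := hcv b ⟨ham.trans hmb, le_rfl⟩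
    simp only at ea em eb
    rw [ea, em, eb]
    rcases le_total m c with hmc | hmc
    · left; rw [max_eq_right (by linarith), max_eq_right (by linarith)]
    · right; rw [max_eq_left (by linarith), max_eq_left (by linarith)]; ring
  · simp only [dif_pos hn]
    exact hp _

/-! ## Part V.1: convex hulls and an abstract Harder-Narasimhan argument -/

structure IsHull (n : ℕ) (p F : ℕ → ℝ) : Prop where
  sorted : ∀ i j, i ≤ j → j < n → F i ≤ F j
  le : ∀ j, j ≤ n → ∑ i ∈ Finset.range j, F i ≤ p j - p 0
  top : ∑ i ∈ Finset.range n, F i = p n - p 0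
  gap : ∀ j, j + 1 < n → F j < F (j + 1) → ∑ i ∈ Finset.range (j + 1), F i = p (j + 1) - p 0
  lower : ∀ s, (∀ k, k ≤ n → s * k ≤ p k - p 0) → ∀ i, i < n → s ≤ F i

theorem exists_hull (n : ℕ) : ∀ p : ℕ → ℝ, ∃ F, IsHull n p F := by
  induction n using Nat.strong_induction_on with
  | _ n ih =>
  intro p
  rcases Nat.eq_zero_or_pos n with rfl | hn
  · exact ⟨fun _ => 0, by intros; omega, by intro j hj; simp [Nat.le_zero.1 hj], by simp,
      by intros; omega, by intros; omega⟩
  obtain ⟨k, hk, hmin⟩ := Finset.exists_min_image (Finset.Icc 1 n) (fun k => (p k - p 0) / k)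
    ⟨1, by simp; omega⟩
  rw [Finset.mem_Icc] at hk
  set s := (p k - p 0) / k with hs
  have hk0 : (0 : ℝ) < k := by exact_mod_cast hk.1
  have hsk : s * k = p k - p 0 := by rw [hs]; field_simp
  have hsle : ∀ i, i ≤ n → s * i ≤ p i - p 0 := by
    intro i hi
    rcases Nat.eq_zero_or_pos i with rfl | hi0
    · simp
    · have := hmin i (by rw [Finset.mem_Icc]; omega)
      rwa [le_div_iff₀ (by exact_mod_cast hi0)] at this
  obtain ⟨F', hF'⟩ := ih (n - k) (by omega) (fun i => p (k + i))
  have hF's : ∀ i, i < n - k → s ≤ F' i := by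
    apply hF'.lower
    intro i hi
    have := hsle (k + i) (by omega)
    push_cast at this
    simp only [add_zero]
    linarith
  set F : ℕ → ℝ := fun i => if i < k then s else F' (i - k) with hF
  have hsum1 : ∀ j, j ≤ k → ∑ i ∈ Finset.range j, F i = s * j := by
    intro j hj
    rw [Finset.sum_congr rfl (g := fun _ => s)]
    · simp [mul_comm]
    · intro i hi
      rw [Finset.mem_range] at hi
      simp only [hF]; rw [if_pos (by omega)]
  have hsum2 : ∀ j, ∑ i ∈ Finset.range (k + j), F i = p k - p 0 + ∑ i ∈ Finset.range j, F' i := by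
    intro j
    rw [Finset.sum_range_add, hsum1 k le_rfl, hsk]
    congr 1
    apply Finset.sum_congr rfl
    intro i _
    simp only [hF]; rw [if_neg (by omega)]; congr 1; omega
  refine ⟨F, ?_, ?_, ?_, ?_, ?_⟩
  · intro i j hij hj
    simp only [hF]
    by_cases h1 : j < k
    · rw [if_pos h1, if_pos (by omega)]
    · rw [if_neg h1]
      by_cases h2 : i < k
      · rw [if_pos h2]; exact hF's _ (by omega)
      · rw [if_neg h2]; exact hF'.sorted _ _ (by omega) (by omega)
  · intro j hj
    rcases le_total j k with h | h
    · rw [hsum1 j h]; exact hsle j hj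
    · obtain ⟨i, rfl⟩ := Nat.exists_eq_add_of_le h
      rw [hsum2]
      have := hF'.le i (by omega)
      simp only [add_zero] at this
      linarith
  · obtain ⟨i, rfl⟩ := Nat.exists_eq_add_of_le hk.2
    rw [hsum2]
    have := hF'.top
    simp only [add_zero, Nat.add_sub_cancel_left] at this
    linarith
  · intro j hj hlt
    rcases lt_trichotomy (j + 1) k with h | h | h
    · simp only [hF] at hlt
      rw [if_pos h, if_pos (by omega)] at hlt
      exact absurd hlt (lt_irrefl _)
    · rw [hsum1 _ h.le, h, hsk]
    · obtain ⟨i, hi⟩ := Nat.exists_eq_add_of_lt h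
      have hj' : j = k + i := by omega
      subst hj'
      have e1 : F (k + i) = F' i := by simp only [hF]; rw [if_neg (by omega)]; congr 1; omega
      have e2 : F (k + i + 1) = F' (i + 1) := by simp only [hF]; rw [if_neg (by omega)]; congr 1; omega
      rw [e1, e2] at hlt
      have := hF'.gap i (by omega) hlt
      simp only [add_zero] at this
      rw [show k + i + 1 = k + (i + 1) by ring, hsum2, this]; ring
  · intro s' hs' i hi
    have hss : s' ≤ s := by
      rw [hs, le_div_iff₀ hk0]; exact hs' k hk.2
    simp only [hF]
    split_ifs with h
    · exact hss
    · exact hss.trans (hF's _ (by omega))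

theorem sorted_count {n : ℕ} {F : ℕ → ℝ} (h : ∀ i j, i ≤ j → j < n → F i ≤ F j) (s : ℝ) :
    ∃ i0 ≤ n, (∀ i, i < i0 → F i < s) ∧ ∀ i, i0 ≤ i → i < n → s ≤ F i := by
  classical
  by_cases hex : ∃ i, i < n ∧ s ≤ F i
  · refine ⟨Nat.find hex, (Nat.find_spec hex).1.le, fun i hi => ?_, fun i hi hin => ?_⟩
    · have := Nat.find_min hex hi
      push Not at this
      exact this (hi.trans (Nat.find_spec hex).1)
    · exact (Nat.find_spec hex).2.trans (h _ _ hi hin)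
  · push Not at hex
    exact ⟨n, le_rfl, fun i hi => hex i hi, by intros; omega⟩

theorem IsHull.eq_of_slope {n : ℕ} {p F : ℕ → ℝ} (h : IsHull n p F) {s : ℝ} {i0 : ℕ} (hi0 : i0 ≤ n)
    (h1 : ∀ i, i < i0 → F i < s) (h2 : ∀ i, i0 ≤ i → i < n → s ≤ F i) :
    ∑ i ∈ Finset.range i0, F i = p i0 - p 0 := by
  rcases Nat.eq_zero_or_pos i0 with rfl | hpos
  · simp
  rcases hi0.eq_or_lt with rfl | hlt
  · exact h.top
  · obtain ⟨j, rfl⟩ := Nat.exists_eq_succ_of_ne_zero hpos.ne'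
    exact h.gap j hlt (lt_of_lt_of_le (h1 j (by omega)) (h2 (j + 1) le_rfl hlt))

theorem IsHull.minimizer {n : ℕ} {p F : ℕ → ℝ} (h : IsHull n p F) {s : ℝ} {i0 : ℕ} (hi0 : i0 ≤ n)
    (h1 : ∀ i, i < i0 → F i < s) (h2 : ∀ i, i0 ≤ i → i < n → s ≤ F i) :
    (∀ i, i ≤ n → p i0 - s * i0 ≤ p i - s * i) ∧ (∀ i, i < i0 → p i0 - s * i0 < p i - s * i) := by
  have e := h.eq_of_slope hi0 h1 h2
  have hst : ∀ i, i < i0 → p i0 - s * i0 < p i - s * i := by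
    intro i hi
    have hle := h.le i (hi.le.trans hi0)
    obtain ⟨d, rfl⟩ := Nat.exists_eq_add_of_lt hi
    rw [add_assoc, Finset.sum_range_add] at e
    have : ∑ x ∈ Finset.range (d + 1), F (i + x) < ∑ x ∈ Finset.range (d + 1), s := by
      apply Finset.sum_lt_sum_of_nonempty ⟨0, by simp⟩
      intro x hx
      rw [Finset.mem_range] at hx
      exact h1 _ (by omega)
    rw [Finset.sum_const, Finset.card_range, nsmul_eq_mul] at this
    push_cast at this ⊢
    rw [← add_assoc] at e
    linarith
  refine ⟨fun i hi => ?_, hst⟩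
  rcases lt_or_ge i i0 with hlt | hge
  · exact (hst i hlt).le
  · have hle := h.le i hi
    obtain ⟨d, rfl⟩ := Nat.exists_eq_add_of_le hge
    rw [Finset.sum_range_add] at hle
    have : ∑ x ∈ Finset.range d, s ≤ ∑ x ∈ Finset.range d, F (i0 + x) := by
      apply Finset.sum_le_sum
      intro x hx
      rw [Finset.mem_range] at hx
      exact h2 _ (by omega) (by omega)
    rw [Finset.sum_const, Finset.card_range, nsmul_eq_mul] at this
    push_cast
    linarith

/-- upper bound for the slopes -/
theorem IsHull.upper {n : ℕ} {p F : ℕ → ℝ} (h : IsHull n p F) {s : ℝ} {j : ℕ} (hj : j < n)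
    (hs : ∀ i, i ≤ j → p (j + 1) - p i < s * ((j + 1 : ℕ) - i : ℝ)) : F j < s := by
  obtain ⟨i0, hi0, h1, h2⟩ := sorted_count h.sorted s
  rcases lt_or_ge j i0 with hlt | hge
  · exact h1 j hlt
  · have := (h.minimizer hi0 h1 h2).1 (j + 1) hj
    have := hs i0 hge
    linarith

structure HNData {V : Type*} [Lattice V] (n : ℕ) (rk : V → ℕ) (f : V → ℝ → ℝ) (q1 c : ℝ) : Prop where
  rk_strict : ∀ v w, v < w → rk v < rk w
  rk_le : ∀ v, rk v ≤ n
  rk_add : ∀ v w, rk (v ⊔ w) + rk (v ⊓ w) = rk v + rk w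
  mono : ∀ v w, v ≤ w → ∀ q q', q ≤ q' → f w q - f v q ≤ f w q' - f v q'
  min : ∀ q j, j ≤ n → ∃ v, rk v = j ∧ ∀ w, rk w = j → f v q ≤ f w q
  sub : ∀ v w q, f (v ⊔ w) q + f (v ⊓ w) q ≤ f v q + f w q
  form : ∀ v a m b, a ≤ m → m ≤ b → f v m = f v a ∨ f v b - f v m = b - m
  zero : ∀ v q, rk v = 0 → f v q = 0
  top : ∀ v q, rk v = n → q1 ≤ q → f v q = q + c

namespace HNData
variable {V : Type*} [Lattice V] {n : ℕ} {rk : V → ℕ} {f : V → ℝ → ℝ} {q1 c : ℝ}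

theorem key (h : HNData n rk f q1 c) {q q' s : ℝ} (hq : q ≤ q') {v w : V}
    (hv : ∀ x, f v q - s * rk v ≤ f x q - s * rk x)
    (hw : ∀ x, rk x < rk w → f w q' - s * rk w < f x q' - s * rk x) : w ≤ v := by
  by_contra hle
  have hlt : v ⊓ w < w := by
    refine lt_of_le_of_ne inf_le_right fun e => hle ?_
    rw [← e]; exact inf_le_left
  have h1 := hw _ (h.rk_strict _ _ hlt)
  have h2 := h.mono _ _ hlt.le q q' hq
  have h3 := h.sub v w q
  have h4 := hv (v ⊔ w)
  have h5 : (rk (v ⊔ w) : ℝ) + rk (v ⊓ w) = rk v + rk w := by exact_mod_cast h.rk_add v w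
  have h6 : s * rk (v ⊔ w) + s * rk (v ⊓ w) = s * rk v + s * rk w := by
    rw [← mul_add, h5, mul_add]
  linarith

def mv (h : HNData n rk f q1 c) (q : ℝ) (j : ℕ) : V :=
  if hj : j ≤ n then (h.min q j hj).choose else (h.min q 0 (Nat.zero_le n)).choose

theorem mv_rk (h : HNData n rk f q1 c) (q : ℝ) {j : ℕ} (hj : j ≤ n) : rk (h.mv q j) = j := by
  unfold mv; rw [dif_pos hj]; exact (h.min q j hj).choose_spec.1

theorem mv_min (h : HNData n rk f q1 c) (q : ℝ) {j : ℕ} (hj : j ≤ n) (w : V) (hw : rk w = j) :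
    f (h.mv q j) q ≤ f w q := by
  unfold mv; rw [dif_pos hj]; exact (h.min q j hj).choose_spec.2 w hw

def p (h : HNData n rk f q1 c) (q : ℝ) (j : ℕ) : ℝ := f (h.mv q j) q

theorem p_zero (h : HNData n rk f q1 c) (q : ℝ) : h.p q 0 = 0 :=
  h.zero _ _ (h.mv_rk q (Nat.zero_le n))

theorem p_top (h : HNData n rk f q1 c) {q : ℝ} (hq : q1 ≤ q) : h.p q n = q + c :=
  h.top _ _ (h.mv_rk q le_rfl) hq

theorem p_le (h : HNData n rk f q1 c) (q : ℝ) (w : V) : h.p q (rk w) ≤ f w q :=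
  h.mv_min q (h.rk_le w) w rfl

def F (h : HNData n rk f q1 c) (q : ℝ) : ℕ → ℝ := (exists_hull n (h.p q)).choose

theorem hull (h : HNData n rk f q1 c) (q : ℝ) : IsHull n (h.p q) (h.F q) :=
  (exists_hull n (h.p q)).choose_spec

/-- comparison of minimizers at two times for the same slope -/
theorem compare (h : HNData n rk f q1 c) {q q' s : ℝ} (hq : q ≤ q') {i j : ℕ} (hi : i ≤ n) (hj : j ≤ n)
    (hi1 : ∀ k, k < i → h.F q k < s) (hi2 : ∀ k, i ≤ k → k < n → s ≤ h.F q k)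
    (hj1 : ∀ k, k < j → h.F q' k < s) (hj2 : ∀ k, j ≤ k → k < n → s ≤ h.F q' k) :
    h.mv q' j ≤ h.mv q i := by
  have m1 := (h.hull q).minimizer hi hi1 hi2
  have m2 := (h.hull q').minimizer hj hj1 hj2
  apply h.key hq (s := s)
  · intro x
    rw [h.mv_rk q hi]
    have e1 := m1.1 (rk x) (h.rk_le x)
    have e2 := h.p_le q x
    unfold p at e1 e2
    linarith
  · intro x hx
    rw [h.mv_rk q' hj] at hx ⊢
    have e1 := m2.2 (rk x) hx
    have e2 := h.p_le q' x
    unfold p at e1 e2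
    linarith

theorem rk_mono (h : HNData n rk f q1 c) {v w : V} (hvw : v ≤ w) : rk v ≤ rk w := by
  rcases hvw.eq_or_lt with rfl | hlt
  · exact le_rfl
  · exact (h.rk_strict _ _ hlt).le

theorem F_mono (h : HNData n rk f q1 c) {q q' : ℝ} (hq : q ≤ q') {j : ℕ} (hj : j < n) :
    h.F q j ≤ h.F q' j := by
  apply le_of_forall_gt_imp_ge_of_dense
  intro s hs
  obtain ⟨i0, hi0, h1, h2⟩ := sorted_count (h.hull q).sorted s
  obtain ⟨i1, hi1, h3, h4⟩ := sorted_count (h.hull q').sorted s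
  have hc := h.rk_mono (h.compare hq hi0 hi1 h1 h2 h3 h4)
  rw [h.mv_rk q hi0, h.mv_rk q' hi1] at hc
  have : j < i1 := by
    by_contra hcon
    linarith [h4 j (by omega) hj]
  exact (h1 j (by omega)).le

theorem F_sum (h : HNData n rk f q1 c) {q : ℝ} (hq : q1 ≤ q) :
    ∑ i ∈ Finset.range n, h.F q i = q + c := by
  rw [(h.hull q).top, h.p_zero, h.p_top hq, sub_zero]

theorem F_lip (h : HNData n rk f q1 c) {q q' : ℝ} (hq1 : q1 ≤ q) (hq : q ≤ q') {j : ℕ} (hj : j < n) :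
    h.F q' j - h.F q j ≤ q' - q := by
  have e1 := h.F_sum hq1
  have e2 := h.F_sum (hq1.trans hq)
  have : h.F q' j - h.F q j ≤ ∑ i ∈ Finset.range n, (h.F q' i - h.F q i) :=
    Finset.single_le_sum (f := fun i => h.F q' i - h.F q i)
      (fun i hi => sub_nonneg.2 (h.F_mono hq (Finset.mem_range.1 hi))) (Finset.mem_range.2 hj)
  rw [Finset.sum_sub_distrib] at this
  linarith

theorem F_dich (h : HNData n rk f q1 c) {j : ℕ} (hj : j + 1 < n) {a m b : ℝ} (ha : q1 ≤ a)
    (ham : a ≤ m) (hmb : m ≤ b) (hlt : ∀ t, a ≤ t → t ≤ b → h.F t j < h.F t (j + 1)) :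
    (∑ i ∈ Finset.range (j + 1), h.F m i = ∑ i ∈ Finset.range (j + 1), h.F a i) ∨
    (∑ i ∈ Finset.range (j + 1), h.F b i - ∑ i ∈ Finset.range (j + 1), h.F m i = b - m) := by
  have hcmp : ∀ q q' s, q ≤ q' → h.F q j < s → s ≤ h.F q (j + 1) → h.F q' j < s → s ≤ h.F q' (j + 1) →
      h.mv q (j + 1) = h.mv q' (j + 1) := by
    intro q q' s hq h1 h2 h3 h4
    have hle : h.mv q' (j + 1) ≤ h.mv q (j + 1) := by
      apply h.compare hq hj.le hj.le (s := s)
      · intro k hk; exact lt_of_le_of_lt ((h.hull q).sorted k j (by omega) (by omega)) h1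
      · intro k hk hkn; exact h2.trans ((h.hull q).sorted _ k hk hkn)
      · intro k hk; exact lt_of_le_of_lt ((h.hull q').sorted k j (by omega) (by omega)) h3
      · intro k hk hkn; exact h4.trans ((h.hull q').sorted _ k hk hkn)
    rcases hle.eq_or_lt with e | e
    · exact e.symm
    · have := h.rk_strict _ _ e
      rw [h.mv_rk q hj.le, h.mv_rk q' hj.le] at this
      omega
  have hconst : ∀ x y, a ≤ x → x ≤ y → y ≤ b → h.mv x (j + 1) = h.mv y (j + 1) := by
    intro x y hax hxy hyb
    refine chain_rel (q0 := a) (fun x y => y ≤ b → h.mv x (j + 1) = h.mv y (j + 1)) (fun _ _ => rfl)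
      (fun x y z _ hyz h1 h2 hz => (h1 (hyz.trans hz)).trans (h2 hz)) ?_ hax hxy hyb
    intro q hq
    rcases le_or_gt q b with hqb | hqb
    · have hg := hlt q hq hqb
      set d := h.F q (j + 1) - h.F q j with hd
      have hd0 : 0 < d := by rw [hd]; linarith
      refine ⟨d / 4, by positivity, fun t hat ht1 ht2 _ => ?_, fun t ht1 ht2 htb => ?_⟩
      · have e1 := h.F_mono ht2 (show j < n by omega)
        have e2 := h.F_lip (ha.trans hat) ht2 hj
        exact hcmp t q (h.F q j + d / 2) ht2 (by linarith) (by linarith) (by linarith) (by linarith)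
      · have e1 := h.F_mono ht1 hj
        have e2 := h.F_lip (ha.trans hq) ht1 (show j < n by omega)
        exact hcmp q t (h.F q j + d / 2) ht1 (by linarith) (by linarith) (by linarith) (by linarith)
    · refine ⟨1, one_pos, fun t _ _ _ hb => by linarith, fun t _ _ hb => by linarith⟩
  have hval : ∀ t, a ≤ t → t ≤ b → ∑ i ∈ Finset.range (j + 1), h.F t i = f (h.mv a (j + 1)) t := by
    intro t hat htb
    rw [(h.hull t).gap j hj (hlt t hat htb), h.p_zero, sub_zero, hconst a t le_rfl hat htb]
    rfl
  rw [hval a le_rfl (ham.trans hmb), hval m ham hmb, hval b (ham.trans hmb) le_rfl]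
  exact h.form _ _ _ _ ham hmb

end HNData

theorem HNData.close {V : Type*} [Lattice V] {n : ℕ} {rk : V → ℕ} {f : V → ℝ → ℝ} {q1 c : ℝ}
    (h : HNData n rk f q1 c) {L : ℕ → ℝ} (hL : ∀ i j, i ≤ j → j < n → L i ≤ L j) {C q : ℝ} (hC : 0 ≤ C)
    (hp : ∀ j, j ≤ n → |h.p q j - ∑ i ∈ Finset.range j, L i| ≤ C) {j : ℕ} (hj : j < n) :
    |h.F q j - L j| ≤ (n + 1) * (2 * C) := by
  have hup : ∀ j, j < n → h.F q j ≤ L j + 2 * C := by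
    intro j hj
    apply le_of_forall_gt_imp_ge_of_dense
    intro s hs
    apply le_of_lt
    apply (h.hull q).upper hj
    intro i hi
    obtain ⟨d, rfl⟩ := Nat.exists_eq_add_of_le hi
    have e1 := (abs_le.1 (hp (i + d + 1) hj)).2
    have e2 := (abs_le.1 (hp i (by omega))).1
    rw [add_assoc, Finset.sum_range_add] at e1
    have e3 : ∑ x ∈ Finset.range (d + 1), L (i + x) ≤ ∑ x ∈ Finset.range (d + 1), L (i + d) := by
      apply Finset.sum_le_sum
      intro x hx
      rw [Finset.mem_range] at hx
      exact hL _ _ (by omega) hj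
    rw [Finset.sum_const, Finset.card_range, nsmul_eq_mul] at e3
    rw [← add_assoc] at e1
    have e4 : ((i + d + 1 : ℕ) - i : ℝ) = d + 1 := by push_cast; ring
    rw [e4]
    push_cast at e3
    have hd : (0 : ℝ) ≤ d := Nat.cast_nonneg d
    have e5 : (d + 1 : ℝ) * (L (i + d) + 2 * C) < (d + 1) * s := by gcongr
    nlinarith
  refine abs_le_of_sum_eq (n := n) (P := fun i => h.F q i) (F := fun i => L i) (E := 2 * C) (by linarith)
    (fun i => hup i i.2) ?_ ⟨j, hj⟩
  rw [Fin.sum_univ_eq_sum_range (fun i => L i), Fin.sum_univ_eq_sum_range (fun i => h.F q i)]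
  have e1 := (abs_le.1 (hp n le_rfl)).1
  have e2 := (h.hull q).top
  rw [h.p_zero] at e2
  linarith

theorem HNData.weakG {V : Type*} [Lattice V] {n : ℕ} {rk : V → ℕ} {f : V → ℝ → ℝ} {q1 c : ℝ}
    (h : HNData n rk f q1 c) (hn : 0 < n) {L : ℝ → ℕ → ℝ}
    (hL : ∀ q i j, i ≤ j → j < n → L q i ≤ L q j)
    (hL0 : Tendsto (fun q => L q 0) atTop atTop) {C : ℝ} (hC : 0 ≤ C)
    (hp : ∀ q, q1 ≤ q → ∀ j, j ≤ n → |h.p q j - ∑ i ∈ Finset.range j, L q i| ≤ C) :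
    ∃ q0 F, WeakG n q0 F ∧ ∃ C', ∀ q, q0 ≤ q → ∀ i, i < n → |F q i - L q i| ≤ C' := by
  have hclose : ∀ q, q1 ≤ q → ∀ j, j < n → |h.F q j - L q j| ≤ (n + 1) * (2 * C) :=
    fun q hq j hj => h.close (hL q) hC (hp q hq) hj
  have hpr : Tendsto (fun q => h.F q 0) atTop atTop := by
    apply tendsto_atTop_mono' _ _ (tendsto_atTop_add_const_right atTop (-((n + 1) * (2 * C))) hL0)
    filter_upwards [eventually_ge_atTop q1] with q hq
    have := (abs_le.1 (hclose q hq 0 hn)).1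
    linarith
  have hpr' : Tendsto (fun q => h.F (q - c) 0) atTop atTop :=
    hpr.comp (tendsto_atTop_add_const_right atTop (-c) tendsto_id)
  obtain ⟨q2, hq2⟩ := eventually_atTop.1 (hpr'.eventually_ge_atTop 0)
  have hq3 : ∀ q, max (q1 + |c|) q2 ≤ q → q1 ≤ q - c ∧ q1 ≤ q ∧ q2 ≤ q := by
    intro q hq
    have := le_abs_self c
    have := abs_nonneg c
    refine ⟨?_, ?_, (le_max_right _ _).trans hq⟩ <;> linarith [(le_max_left (q1 + |c|) q2).trans hq]
  refine ⟨max (q1 + |c|) q2, fun q i => h.F (q - c) i, ⟨?_, ?_, ?_, ?_, ?_, hpr'⟩,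
    (n + 1) * (2 * C) + |c|, ?_⟩
  · intro q _ i j hij hj
    exact (h.hull _).sorted i j hij hj
  · intro q hq i hi
    exact (hq2 q (hq3 q hq).2.2).trans ((h.hull _).sorted 0 i (Nat.zero_le _) hi)
  · intro q hq
    rw [h.F_sum (hq3 q hq).1]; ring
  · intro i hi q q' hq hqq
    exact h.F_mono (by linarith) hi
  · intro j hj a m b ha ham hmb hlt
    have := h.F_dich hj (hq3 a ha).1 (show a - c ≤ m - c by linarith) (show m - c ≤ b - c by linarith)
      (fun t ht1 ht2 => by
        have := hlt (t + c) (by linarith) (by linarith)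
        simpa using this)
    simpa using this
  · intro q hq i hi
    obtain ⟨h1, h2, -⟩ := hq3 q hq
    have e1 := hclose q h2 i hi
    have e2 : |h.F (q - c) i - h.F q i| ≤ |c| := by
      rcases le_total 0 c with hc | hc
      · have := h.F_mono (show q - c ≤ q by linarith) hi
        have := h.F_lip h1 (show q - c ≤ q by linarith) hi
        rw [abs_le, abs_of_nonneg hc]; constructor <;> linarith
      · have := h.F_mono (show q ≤ q - c by linarith) hi
        have := h.F_lip h2 (show q ≤ q - c by linarith) hi
        rw [abs_le, abs_of_nonpos hc]; constructor <;> linarith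
    calc |h.F (q - c) i - L q i| = |(h.F (q - c) i - h.F q i) + (h.F q i - L q i)| := by ring_nf
      _ ≤ |h.F (q - c) i - h.F q i| + |h.F q i - L q i| := abs_add_le _ _
      _ ≤ _ := by linarith

/-! ## Part V.2: Gram determinants -/

section Gram
variable {H : Type*} [NormedAddCommGroup H] [InnerProductSpace ℝ H]
variable {H' : Type*} [NormedAddCommGroup H'] [InnerProductSpace ℝ H']
variable {ι κ μ : Type*} [Fintype ι] [DecidableEq ι] [Fintype κ] [DecidableEq κ]
  [Fintype μ] [DecidableEq μ]

def gd (b : ι → H) : ℝ := (Matrix.gram ℝ b).det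

theorem gd_nonneg (b : ι → H) : 0 ≤ gd b := (Matrix.posSemidef_gram ℝ b).det_nonneg

theorem gd_pos {b : ι → H} (hb : LinearIndependent ℝ b) : 0 < gd b :=
  (Matrix.posDef_gram_of_linearIndependent hb).det_pos

theorem gd_comp_equiv (b : ι → H) (e : κ ≃ ι) : gd (b ∘ e) = gd b := by
  unfold gd
  rw [← Matrix.det_submatrix_equiv_self e (Matrix.gram ℝ b)]
  rfl

theorem gd_matrix (b b' : ι → H) (A : Matrix ι ι ℝ) (h : ∀ i, b' i = ∑ k, A k i • b k) :
    gd b' = A.det ^ 2 * gd b := by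
  have : Matrix.gram ℝ b' = A.transpose * Matrix.gram ℝ b * A := by
    ext i j
    simp only [Matrix.gram_apply, h, Matrix.mul_apply, Matrix.transpose_apply, sum_inner, inner_sum,
      inner_smul_left, inner_smul_right, Finset.sum_mul, Finset.mul_sum, conj_trivial]
    refine Finset.sum_congr rfl fun x _ => Finset.sum_congr rfl fun y _ => ?_
    ring
  unfold gd
  rw [this, Matrix.det_mul, Matrix.det_mul, Matrix.det_transpose]
  ring

theorem gd_block (X : ι → H) (Y Y' : κ → H) (C : Matrix ι κ ℝ)
    (hY : ∀ k, Y k = Y' k + ∑ i, C i k • X i) (ho : ∀ i k, ⟪X i, Y' k⟫ = 0) :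
    gd (Sum.elim X Y) = gd X * gd Y' := by
  have h1 := gd_matrix (Sum.elim X Y') (Sum.elim X Y) (Matrix.fromBlocks 1 C 0 1) (by
    rintro (i | k)
    · simp [Matrix.one_apply]
    · simp [Matrix.one_apply, hY, add_comm])
  rw [h1, Matrix.det_fromBlocks_zero₂₁]
  simp only [Matrix.det_one, one_mul, mul_one, one_pow]
  have h2 : Matrix.gram ℝ (Sum.elim X Y') =
      Matrix.fromBlocks (Matrix.gram ℝ X) 0 0 (Matrix.gram ℝ Y') := by
    ext i j
    rcases i with i | i <;> rcases j with j | j <;> simp [Matrix.gram_apply, ho]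
    rw [real_inner_comm]; exact ho _ _
  unfold gd
  rw [h2, Matrix.det_fromBlocks_zero₂₁]

instance finSpan (X : ι → H) : FiniteDimensional ℝ (Submodule.span ℝ (Set.range X)) :=
  FiniteDimensional.span_of_finite ℝ (Set.finite_range X)

/-- projection onto the orthogonal complement of a finite family -/
def pr (X : ι → H) : H →ₗ[ℝ] H :=
  LinearMap.id - ((Submodule.span ℝ (Set.range X)).starProjection : H →ₗ[ℝ] H)

omit [DecidableEq ι] in
theorem pr_apply (X : ι → H) (y : H) : pr X y = y - (Submodule.span ℝ (Set.range X)).starProjection y := rfl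

omit [DecidableEq ι] in
theorem pr_orth (X : ι → H) (y : H) {z : H} (hz : z ∈ Submodule.span ℝ (Set.range X)) : ⟪z, pr X y⟫ = 0 := by
  rw [real_inner_comm, pr_apply]
  exact Submodule.starProjection_inner_eq_zero _ _ hz

omit [DecidableEq ι] in
theorem sub_pr_mem (X : ι → H) (y : H) : y - pr X y ∈ Submodule.span ℝ (Set.range X) := by
  rw [pr_apply, sub_sub_cancel]
  exact Submodule.starProjection_apply_mem _ _

omit [DecidableEq ι] in
theorem pr_norm_le (X : ι → H) (y : H) {z : H} (hz : z ∈ Submodule.span ℝ (Set.range X)) :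
    ‖pr X y‖ ≤ ‖y - z‖ := by
  have e : y - z = pr X y + ((y - pr X y) - z) := by abel
  have ho : ⟪pr X y, (y - pr X y) - z⟫ = 0 := by
    rw [real_inner_comm]
    exact pr_orth X y (Submodule.sub_mem _ (sub_pr_mem X y) hz)
  have := norm_add_sq_eq_norm_sq_add_norm_sq_of_inner_eq_zero _ _ ho
  rw [← e] at this
  nlinarith [norm_nonneg (pr X y), norm_nonneg (y - z), mul_self_nonneg ‖(y - pr X y) - z‖]

omit [DecidableEq ι] in
theorem pr_norm_le_self (X : ι → H) (y : H) : ‖pr X y‖ ≤ ‖y‖ := by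
  simpa using pr_norm_le X y (Submodule.zero_mem _)

omit [DecidableEq ι] in
theorem pr_eq_zero (X : ι → H) {z : H} (hz : z ∈ Submodule.span ℝ (Set.range X)) : pr X z = 0 := by
  have := pr_norm_le X z hz
  rw [sub_self, norm_zero] at this
  exact norm_le_zero_iff.1 this

theorem gd_sum (X : ι → H) (Y : κ → H) :
    gd (Sum.elim X Y) = gd X * gd (pr X ∘ Y) := by
  have h : ∀ k, ∃ c : ι → ℝ, ∑ i, c i • X i = Y k - pr X (Y k) := fun k =>
    (Submodule.mem_span_range_iff_exists_fun ℝ).1 (sub_pr_mem X (Y k))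
  choose c hc using h
  refine gd_block X Y _ (fun i k => c k i) (fun k => ?_) (fun i k => ?_)
  · rw [hc]; simp
  · exact pr_orth X _ (Submodule.subset_span ⟨i, rfl⟩)

theorem gd_unique [Unique μ] (y : μ → H) : gd y = ‖y default‖ ^ 2 := by
  unfold gd
  rw [Matrix.det_unique, Matrix.gram_apply, real_inner_self_eq_norm_sq]

theorem gd_snoc {j : ℕ} (Z : Fin (j + 1) → H) :
    gd Z = gd (fun i : Fin j => Z i.castSucc) * ‖pr (fun i : Fin j => Z i.castSucc) (Z (Fin.last j))‖ ^ 2 := by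
  rw [← gd_comp_equiv Z (finSumFinEquiv (m := j) (n := 1))]
  have : Z ∘ (finSumFinEquiv (m := j) (n := 1)) =
      Sum.elim (fun i : Fin j => Z i.castSucc) (fun _ : Fin 1 => Z (Fin.last j)) := by
    ext (i | i)
    · rfl
    · simp only [Function.comp_apply, Sum.elim_inr]
      congr 1
      ext
      simp
  rw [this, gd_sum, gd_unique (μ := Fin 1)]
  rfl

theorem gd_cons {j : ℕ} (Z : Fin (j + 1) → H) :
    gd Z = ‖Z 0‖ ^ 2 * gd (pr (fun _ : Fin 1 => Z 0) ∘ (fun i : Fin j => Z i.succ)) := by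
  rw [← gd_comp_equiv Z (finSumFinEquiv.trans (finCongr (show 1 + j = j + 1 by omega)))]
  have : Z ∘ (finSumFinEquiv.trans (finCongr (show 1 + j = j + 1 by omega))) =
      Sum.elim (fun _ : Fin 1 => Z 0) (fun i : Fin j => Z i.succ) := by
    ext (i | i)
    · simp only [Function.comp_apply, Sum.elim_inl]
      congr 1
      ext
      simp
    · simp only [Function.comp_apply, Sum.elim_inr]
      congr 1
      ext
      simp
  rw [this, gd_sum, gd_unique (μ := Fin 1)]

theorem gd_contract_fin (T : H →ₗ[ℝ] H') (hT : ∀ x, ‖T x‖ ≤ ‖x‖) :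
    ∀ {j : ℕ} (Z : Fin j → H), gd (T ∘ Z) ≤ gd Z := by
  intro j
  induction j with
  | zero => intro Z; simp [gd]
  | succ j ih =>
    intro Z
    rw [gd_snoc, gd_snoc Z]
    have h1 := ih (fun i => Z i.castSucc)
    have h2 : ‖pr (fun i : Fin j => (T ∘ Z) i.castSucc) ((T ∘ Z) (Fin.last j))‖ ≤
        ‖pr (fun i : Fin j => Z i.castSucc) (Z (Fin.last j))‖ := by
      have hmem : T (Z (Fin.last j) - pr (fun i : Fin j => Z i.castSucc) (Z (Fin.last j))) ∈
          Submodule.span ℝ (Set.range fun i : Fin j => (T ∘ Z) i.castSucc) := by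
        have := Submodule.mem_map_of_mem (f := T) (sub_pr_mem (fun i : Fin j => Z i.castSucc) (Z (Fin.last j)))
        rw [Submodule.map_span, ← Set.range_comp] at this
        exact this
      refine (pr_norm_le _ _ hmem).trans ?_
      have e : (T ∘ Z) (Fin.last j) - T (Z (Fin.last j) - pr (fun i : Fin j => Z i.castSucc) (Z (Fin.last j)))
          = T (pr (fun i : Fin j => Z i.castSucc) (Z (Fin.last j))) := by
        rw [map_sub]; simp
      rw [e]
      exact hT _
    gcongr
    · exact gd_nonneg _
    · exact h1

theorem gd_contract (T : H →ₗ[ℝ] H') (hT : ∀ x, ‖T x‖ ≤ ‖x‖) (Z : ι → H) : gd (T ∘ Z) ≤ gd Z := by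
  rw [← gd_comp_equiv Z (Fintype.equivFin ι).symm, ← gd_comp_equiv (T ∘ Z) (Fintype.equivFin ι).symm]
  exact gd_contract_fin T hT _

theorem gd_hadamard : ∀ {j : ℕ} (Z : Fin j → H), gd Z ≤ ∏ i, ‖Z i‖ ^ 2 := by
  intro j
  induction j with
  | zero => intro Z; simp [gd]
  | succ j ih =>
    intro Z
    rw [gd_snoc, Fin.prod_univ_castSucc]
    have := ih (fun i => Z i.castSucc)
    have := pr_norm_le_self (fun i : Fin j => Z i.castSucc) (Z (Fin.last j))
    gcongr

theorem gd_fischer (X : ι → H) (Y : κ → H) (Z : μ → H) :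
    gd (Sum.elim X (Sum.elim Y Z)) * gd X ≤ gd (Sum.elim X Y) * gd (Sum.elim X Z) := by
  rw [gd_sum, gd_sum X Y, gd_sum X Z]
  have e : pr X ∘ Sum.elim Y Z = Sum.elim (pr X ∘ Y) (pr X ∘ Z) := by
    ext (i | i) <;> rfl
  rw [e, gd_sum]
  have h1 := gd_contract (pr (pr X ∘ Y)) (pr_norm_le_self _) (pr X ∘ Z)
  have h2 := gd_nonneg X
  have h3 := gd_nonneg (pr X ∘ Y)
  calc gd X * (gd (pr X ∘ Y) * gd (pr (pr X ∘ Y) ∘ pr X ∘ Z)) * gd X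
      ≤ gd X * (gd (pr X ∘ Y) * gd (pr X ∘ Z)) * gd X := by gcongr
    _ = _ := by ring

end Gram

section Reduction
variable {H : Type*} [NormedAddCommGroup H] [InnerProductSpace ℝ H]

theorem li_of_gd_pos {ι : Type*} [Fintype ι] [DecidableEq ι] {b : ι → H} (h : 0 < gd b) :
    LinearIndependent ℝ b :=
  Matrix.linearIndependent_of_det_gram_ne_zero h.ne'

theorem gd_le_of_mem {ι : Type*} [Fintype ι] [DecidableEq ι] {b b' : ι → H}
    (hb' : 0 < gd b') (hm : ∀ i, b' i ∈ Submodule.span ℤ (Set.range b)) : gd b ≤ gd b' := by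
  have h : ∀ i, ∃ c : ι → ℤ, ∑ k, c k • b k = b' i := fun i =>
    (Submodule.mem_span_range_iff_exists_fun ℤ).1 (hm i)
  choose c hc using h
  set A : Matrix ι ι ℤ := fun k i => c i k with hA
  have e := gd_matrix b b' (A.map (Int.castRingHom ℝ)) (fun i => by
    rw [← hc]
    refine Finset.sum_congr rfl fun k _ => ?_
    show c i k • b k = ((c i k : ℤ) : ℝ) • b k
    exact (Int.cast_smul_eq_zsmul ℝ _ _).symm)
  have hdet : (A.map (Int.castRingHom ℝ)).det = ((A.det : ℤ) : ℝ) := by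
    have := (Int.castRingHom ℝ).map_det A
    rw [RingHom.mapMatrix_apply] at this
    rw [← this]; rfl
  rw [hdet] at e
  have hne : A.det ≠ 0 := by
    intro h0
    rw [h0] at e
    simp at e
    linarith
  have h1 : (1 : ℝ) ≤ ((A.det : ℤ) : ℝ) ^ 2 := by
    have : 1 ≤ A.det ^ 2 := by
      have := sq_pos_of_ne_zero hne
      omega
    exact_mod_cast this
  rw [e]
  exact le_mul_of_one_le_left (gd_nonneg b) h1

theorem span_int_lower {j : ℕ} {b : Fin j → H} (hb : LinearIndependent ℝ b) :
    ∃ c > 0, ∀ v ∈ Submodule.span ℤ (Set.range b), v ≠ 0 → c ≤ ‖v‖ := by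
  set T : (Fin j → ℝ) →ₗ[ℝ] H := Fintype.linearCombination ℝ b with hT
  have hker : LinearMap.ker T = ⊥ := by
    rw [LinearMap.ker_eq_bot]
    exact hb.fintypeLinearCombination_injective
  obtain ⟨K, hK, hanti⟩ := LinearMap.exists_antilipschitzWith T hker
  refine ⟨(K : ℝ)⁻¹, by positivity, fun v hv hv0 => ?_⟩
  obtain ⟨m, rfl⟩ := (Submodule.mem_span_range_iff_exists_fun ℤ).1 hv
  have h1 := hanti.le_mul_dist (fun i => (m i : ℝ)) 0
  rw [map_zero, dist_zero_right, dist_zero_right] at h1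
  have e : T (fun i => (m i : ℝ)) = ∑ i, m i • b i := by
    rw [hT, Fintype.linearCombination_apply]
    exact Finset.sum_congr rfl fun i _ => Int.cast_smul_eq_zsmul ℝ _ _
  rw [e] at h1
  have hm : ∃ i, m i ≠ 0 := by
    by_contra hcon
    push Not at hcon
    exact hv0 (by simp [hcon])
  obtain ⟨i, hi⟩ := hm
  have h2 : (1 : ℝ) ≤ ‖fun i => (m i : ℝ)‖ := by
    refine le_trans ?_ (norm_le_pi_norm (fun i => (m i : ℝ)) i)
    rw [Real.norm_eq_abs, ← Int.cast_abs]
    exact_mod_cast Int.one_le_abs hi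
  rw [inv_le_iff_one_le_mul₀ (by exact_mod_cast hK)]
  linarith

theorem reduction (j : ℕ) : ∃ C : ℝ, 0 < C ∧ ∀ b : Fin j → H, 0 < gd b →
    ∃ b' : Fin j → H, (∀ i, b' i ∈ Submodule.span ℤ (Set.range b)) ∧ gd b' = gd b ∧
      ∏ i, ‖b' i‖ ^ 2 ≤ C * gd b := by
  induction j with
  | zero => exact ⟨1, one_pos, fun b hb => ⟨b, fun i => i.elim0, rfl, by simp [gd]⟩⟩
  | succ j ih =>
  obtain ⟨C, hC, ih⟩ := ih
  refine ⟨2 ^ j * C, by positivity, fun b hb => ?_⟩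
  obtain ⟨c, hc, hlow⟩ := span_int_lower (li_of_gd_pos hb)
  set S : Set ℝ := {x | ∃ b' : Fin (j + 1) → H, (∀ i, b' i ∈ Submodule.span ℤ (Set.range b)) ∧
    gd b' = gd b ∧ ‖b' 0‖ = x} with hS
  have hSne : S.Nonempty := ⟨_, b, fun i => Submodule.subset_span ⟨i, rfl⟩, rfl, rfl⟩
  have hSlow : ∀ x ∈ S, c ≤ x := by
    rintro x ⟨b', h1, h2, rfl⟩
    exact hlow _ (h1 0) ((li_of_gd_pos (h2 ▸ hb)).ne_zero 0)
  have hSb : BddBelow S := ⟨c, hSlow⟩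
  set r := sInf S with hr
  have hr0 : 0 < r := lt_of_lt_of_le hc (le_csInf hSne hSlow)
  obtain ⟨_, ⟨b1, hb1, hgd1, rfl⟩, hlt⟩ := exists_lt_of_csInf_lt hSne (show r < 7 / 5 * r by linarith)
  set X : Fin 1 → H := fun _ => b1 0 with hX
  set tl : Fin j → H := fun i => b1 i.succ with htl
  have hcons : gd b1 = ‖b1 0‖ ^ 2 * gd (pr X ∘ tl) := gd_cons b1
  have hb1pos : 0 < gd b1 := by rw [hgd1]; exact hb
  have htpos : 0 < gd (pr X ∘ tl) := by
    rcases (gd_nonneg (pr X ∘ tl)).eq_or_lt with h | h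
    · rw [← h, mul_zero] at hcons; linarith
    · exact h
  obtain ⟨t', ht1, ht2, ht3⟩ := ih (pr X ∘ tl) htpos
  have hy : ∀ i, ∃ y ∈ Submodule.span ℤ (Set.range tl), pr X y = t' i := by
    intro i
    have := ht1 i
    rw [Set.range_comp] at this
    have e : (pr X : H → H) '' Set.range tl = ((pr X).restrictScalars ℤ : H →ₗ[ℤ] H) '' Set.range tl := rfl
    rw [e, ← Submodule.map_span] at this
    obtain ⟨y, hy, hy2⟩ := this
    exact ⟨y, hy, hy2⟩
  choose y hy1 hy2 using hy
  have hθ : ∀ i, ∃ θ : ℝ, y i = t' i + θ • b1 0 := by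
    intro i
    have := sub_pr_mem X (y i)
    rw [hX, Set.range_const, Submodule.mem_span_singleton, ← hX, hy2] at this
    obtain ⟨θ, h⟩ := this
    exact ⟨θ, by rw [h]; simp⟩
  choose θ hθ using hθ
  set b2 : Fin (j + 1) → H := Fin.cons (b1 0) (fun i => y i - round (θ i) • b1 0) with hb2
  have h20 : b2 0 = b1 0 := rfl
  have h2s : ∀ i : Fin j, b2 i.succ = y i - round (θ i) • b1 0 := fun i => by simp [hb2]
  have hmem1 : ∀ i, b2 i ∈ Submodule.span ℤ (Set.range b1) := by
    intro i
    refine Fin.cases ?_ (fun i => ?_) i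
    · rw [h20]; exact Submodule.subset_span ⟨0, rfl⟩
    · rw [h2s]
      apply Submodule.sub_mem
      · refine Submodule.span_mono ?_ (hy1 i)
        rintro _ ⟨k, rfl⟩
        exact ⟨k.succ, rfl⟩
      · exact Submodule.smul_mem _ _ (Submodule.subset_span ⟨0, rfl⟩)
  have hmem : ∀ i, b2 i ∈ Submodule.span ℤ (Set.range b) := by
    intro i
    refine (Submodule.span_le.2 ?_) (hmem1 i)
    rintro _ ⟨k, rfl⟩
    exact hb1 k
  have hpr0 : pr X (b1 0) = 0 := pr_eq_zero X (Submodule.subset_span ⟨0, rfl⟩)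
  have hgd2 : gd b2 = gd b := by
    rw [gd_cons b2, h20, ← hgd1, hcons, ← ht2]
    congr 2
    ext i
    simp only [Function.comp_apply, h2s, map_sub, map_zsmul]
    have e : pr (fun _ : Fin 1 => b1 0) = pr X := rfl
    rw [e, hpr0, hy2]; simp
  refine ⟨b2, hmem, hgd2, ?_⟩
  have hbig : ∀ i, r ≤ ‖b2 i‖ := by
    intro i
    apply csInf_le hSb
    refine ⟨b2 ∘ Equiv.swap 0 i, fun k => hmem _, ?_, by simp⟩
    rw [gd_comp_equiv, hgd2]
  have hnorm : ∀ i : Fin j, ‖b2 i.succ‖ ^ 2 ≤ 2 * ‖t' i‖ ^ 2 := by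
    intro i
    have e : b2 i.succ = t' i + (θ i - round (θ i)) • b1 0 := by
      rw [h2s, hθ, sub_smul, add_sub_assoc, Int.cast_smul_eq_zsmul]
    have ho : ⟪t' i, (θ i - round (θ i)) • b1 0⟫ = 0 := by
      rw [inner_smul_right, real_inner_comm, ← hy2,
        pr_orth X (y i) (Submodule.subset_span ⟨0, rfl⟩), mul_zero]
    have hn := norm_add_sq_eq_norm_sq_add_norm_sq_of_inner_eq_zero _ _ ho
    rw [← e, norm_smul, Real.norm_eq_abs] at hn
    have h1 := abs_sub_round (θ i)
    have h2 := hbig i.succ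
    have h3 : |θ i - round (θ i)| * ‖b1 0‖ ≤ 1 / 2 * (7 / 5 * r) := by gcongr
    have h4 : (|θ i - round (θ i)| * ‖b1 0‖) ^ 2 ≤ (1 / 2 * (7 / 5 * r)) ^ 2 := by gcongr
    have h5 : r ^ 2 ≤ ‖b2 i.succ‖ ^ 2 := by gcongr
    nlinarith
  rw [Fin.prod_univ_succ, h20]
  calc ‖b1 0‖ ^ 2 * ∏ i : Fin j, ‖b2 i.succ‖ ^ 2 ≤ ‖b1 0‖ ^ 2 * ∏ i : Fin j, (2 * ‖t' i‖ ^ 2) := by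
        gcongr with i
        exact hnorm i
    _ = 2 ^ j * (‖b1 0‖ ^ 2 * ∏ i : Fin j, ‖t' i‖ ^ 2) := by
        rw [Finset.prod_mul_distrib]; simp; ring
    _ ≤ 2 ^ j * (‖b1 0‖ ^ 2 * (C * gd (pr X ∘ tl))) := by gcongr
    _ = 2 ^ j * C * gd b := by rw [← hgd1, hcons]; ring

end Reduction

/-! ## Part V.3: rational subspaces and their integer points -/

section Lat
variable {n : ℕ}

/-- cast of integer points to rational points -/
def castQ (n : ℕ) : (Fin n → ℤ) →ₗ[ℤ] (Fin n → ℚ) where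
  toFun x := fun i => (x i : ℚ)
  map_add' x y := by ext i; simp
  map_smul' m x := by ext i; simp

theorem castQ_apply (x : Fin n → ℤ) (i : Fin n) : castQ n x i = (x i : ℚ) := rfl

/-- embedding of integer points in Euclidean space -/
def emb (n : ℕ) : (Fin n → ℤ) →ₗ[ℤ] EuclideanSpace ℝ (Fin n) where
  toFun x := WithLp.toLp 2 (fun i => (x i : ℝ))
  map_add' x y := by ext i; simp
  map_smul' m x := by ext i; simp

theorem emb_apply (x : Fin n → ℤ) (i : Fin n) : emb n x i = (x i : ℝ) := rfl

theorem castQ_inj : Function.Injective (castQ n) := by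
  intro x y h
  ext i
  have := congrFun h i
  simpa [castQ_apply] using this

theorem li_castQ {ι : Type*} {b : ι → Fin n → ℤ} :
    LinearIndependent ℚ (castQ n ∘ b) ↔ LinearIndependent ℤ b :=
  linearIndependent_algebraMap_comp_iff (R := ℤ) (S := ℚ)

theorem li_emb {ι : Type*} {b : ι → Fin n → ℤ} :
    LinearIndependent ℝ (emb n ∘ b) ↔ LinearIndependent ℤ b := by
  rw [← linearIndependent_algebraMap_comp_iff (R := ℤ) (S := ℝ)]
  exact LinearMap.linearIndependent_iff (WithLp.linearEquiv 2 ℝ (Fin n → ℝ)).symm.toLinearMap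
    (v := fun i => algebraMap ℤ ℝ ∘ b i) (LinearEquiv.ker _)

/-- integer points of a rational subspace -/
def Lam (V : Submodule ℚ (Fin n → ℚ)) : Submodule ℤ (Fin n → ℤ) :=
  (V.restrictScalars ℤ).comap (castQ n)

theorem mem_Lam {V : Submodule ℚ (Fin n → ℚ)} {x} : x ∈ Lam V ↔ castQ n x ∈ V := Iff.rfl

theorem Lam_mono {V W : Submodule ℚ (Fin n → ℚ)} (h : V ≤ W) : Lam V ≤ Lam W := fun _ hx => h hx

/-- `b` is a basis of the integer points of `V` -/
def IsB {ι : Type*} (b : ι → Fin n → ℤ) (V : Submodule ℚ (Fin n → ℚ)) : Prop :=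
  LinearIndependent ℤ b ∧ Submodule.span ℤ (Set.range b) = Lam V

theorem exists_denom (v : Fin n → ℚ) : ∃ d : ℤ, d ≠ 0 ∧ ∃ x, castQ n x = (d : ℚ) • v := by
  refine ⟨∏ i, ((v i).den : ℤ), Finset.prod_ne_zero_iff.2 fun i _ => by exact_mod_cast (v i).den_nz,
    fun i => (∏ k ∈ Finset.univ.erase i, ((v k).den : ℤ)) * (v i).num, ?_⟩
  ext i
  rw [castQ_apply, Pi.smul_apply, ← Finset.mul_prod_erase _ _ (Finset.mem_univ i)]
  push_cast
  have := Rat.mul_den_eq_num (v i)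
  rw [smul_eq_mul, ← this]
  ring

theorem span_castQ_Lam (V : Submodule ℚ (Fin n → ℚ)) :
    Submodule.span ℚ (castQ n '' (Lam V : Set (Fin n → ℤ))) = V := by
  apply le_antisymm
  · rw [Submodule.span_le]
    rintro _ ⟨x, hx, rfl⟩
    exact hx
  · intro v hv
    obtain ⟨d, hd, x, hx⟩ := exists_denom v
    have hd' : (d : ℚ) ≠ 0 := by exact_mod_cast hd
    have e : v = (d : ℚ)⁻¹ • castQ n x := by rw [hx, smul_smul, inv_mul_cancel₀ hd', one_smul]
    rw [e]
    apply Submodule.smul_mem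
    apply Submodule.subset_span
    refine ⟨x, ?_, rfl⟩
    show castQ n x ∈ V
    rw [hx]
    exact V.smul_mem _ hv

theorem IsB.li {ι : Type*} {b : ι → Fin n → ℤ} {V} (h : IsB b V) : LinearIndependent ℤ b := h.1

theorem IsB.mem {ι : Type*} {b : ι → Fin n → ℤ} {V} (h : IsB b V) (i) : b i ∈ Lam V := by
  rw [← h.2]; exact Submodule.subset_span ⟨i, rfl⟩

theorem IsB.spanQ {ι : Type*} {b : ι → Fin n → ℤ} {V} (h : IsB b V) :
    Submodule.span ℚ (Set.range (castQ n ∘ b)) = V := by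
  apply le_antisymm
  · rw [Submodule.span_le]
    rintro _ ⟨i, rfl⟩
    exact h.mem i
  · conv_lhs => rw [← span_castQ_Lam V]
    rw [Submodule.span_le]
    rintro _ ⟨x, hx, rfl⟩
    rw [SetLike.mem_coe, ← h.2] at hx
    rw [Set.range_comp]
    have : castQ n x ∈ Submodule.map (castQ n) (Submodule.span ℤ (Set.range b)) := ⟨x, hx, rfl⟩
    rw [Submodule.map_span] at this
    exact Submodule.span_le_restrictScalars ℤ ℚ _ this

theorem IsB.card {ι : Type*} [Fintype ι] {b : ι → Fin n → ℤ} {V} (h : IsB b V) :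
    Fintype.card ι = Module.finrank ℚ V := by
  rw [← h.spanQ]
  exact (finrank_span_eq_card (li_castQ.2 h.1)).symm

theorem isB_of_basis {ι : Type*} {V : Submodule ℚ (Fin n → ℚ)} (b : Module.Basis ι ℤ (Lam V)) :
    IsB (fun i => (b i : Fin n → ℤ)) V := by
  constructor
  · exact b.linearIndependent.map' (Lam V).subtype (Submodule.ker_subtype _)
  · have : Set.range (fun i => (b i : Fin n → ℤ)) = (Lam V).subtype '' Set.range b := by
      rw [← Set.range_comp]; rfl
    rw [this, ← Submodule.map_span, b.span_eq, Submodule.map_top, Submodule.range_subtype]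

theorem exists_isB (V : Submodule ℚ (Fin n → ℚ)) :
    ∃ b : Fin (Module.finrank ℚ V) → Fin n → ℤ, IsB b V := by
  have b := Module.finBasis ℤ (Lam V)
  have h := isB_of_basis b
  have hc := h.card
  rw [Fintype.card_fin] at hc
  rw [← hc]
  exact ⟨_, h⟩

theorem IsB.reindex {ι κ : Type*} {b : ι → Fin n → ℤ} {V} (h : IsB b V) (e : κ ≃ ι) : IsB (b ∘ e) V := by
  refine ⟨h.1.comp e e.injective, ?_⟩
  rw [← h.2, Set.range_comp, e.range_eq_univ, Set.image_univ]

theorem IsB.extend {ι : Type*} [Fintype ι] {X : ι → Fin n → ℤ} {V' V : Submodule ℚ (Fin n → ℚ)} (hX : IsB X V')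
    (hV : V' ≤ V) : ∃ k : ℕ, ∃ Y : Fin k → Fin n → ℤ, IsB (Sum.elim X Y) V := by
  set N : Submodule ℤ (Lam V) := (Lam V').submoduleOf (Lam V) with hN
  have hle := Lam_mono hV
  -- basis of N
  have hXm : ∀ i, X i ∈ Lam V := fun i => hle (hX.mem i)
  let eqv := Submodule.submoduleOfEquivOfLe hle
  let bX : Module.Basis ι ℤ (Lam V') :=
    (Module.Basis.span hX.1).map (LinearEquiv.ofEq _ _ hX.2)
  have hbX : ∀ i, (bX i : Fin n → ℤ) = X i := by
    intro i
    simp [bX, Module.Basis.span_apply]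
  let bN : Module.Basis ι ℤ N := bX.map eqv.symm
  have hbN : ∀ i, ((bN i : Lam V) : Fin n → ℤ) = X i := by
    intro i
    rw [← hbX]
    rfl
  have htf : Module.IsTorsionFree ℤ (Lam V ⧸ N) := by
    rw [Module.isTorsionFree_iff_smul_eq_zero]
    intro r m
    obtain ⟨x, rfl⟩ := N.mkQ_surjective m
    intro h
    by_cases hr : r = 0
    · exact Or.inl hr
    · right
      rw [← map_smul, Submodule.mkQ_apply, Submodule.Quotient.mk_eq_zero] at h
      rw [Submodule.mkQ_apply, Submodule.Quotient.mk_eq_zero]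
      have h1 : castQ n (r • (x : Fin n → ℤ)) ∈ V' := h
      show castQ n (x : Fin n → ℤ) ∈ V'
      rw [map_smul, ← Int.cast_smul_eq_zsmul ℚ] at h1
      exact (V'.smul_mem_iff (by exact_mod_cast hr)).1 h1
  have bQ := Module.finBasis ℤ (Lam V ⧸ N)
  have h := isB_of_basis (Module.Basis.sumQuot bN bQ)
  refine ⟨_, fun j => ((Module.Basis.sumQuot bN bQ (Sum.inr j) : Lam V) : Fin n → ℤ), ?_⟩
  convert h using 1
  ext (i | i) k
  · simp [hbN]
  · rfl

/-- the real span of a rational subspace -/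
def Rsp (V : Submodule ℚ (Fin n → ℚ)) : Submodule ℝ (EuclideanSpace ℝ (Fin n)) :=
  Submodule.span ℝ (emb n '' (Lam V : Set (Fin n → ℤ)))

theorem Rsp_mono {V W : Submodule ℚ (Fin n → ℚ)} (h : V ≤ W) : Rsp V ≤ Rsp W :=
  Submodule.span_mono (Set.image_mono (Lam_mono h))

theorem IsB.spanR {ι : Type*} {b : ι → Fin n → ℤ} {V} (h : IsB b V) :
    Submodule.span ℝ (Set.range (emb n ∘ b)) = Rsp V := by
  apply le_antisymm
  · rw [Submodule.span_le]
    rintro _ ⟨i, rfl⟩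
    exact Submodule.subset_span ⟨_, h.mem i, rfl⟩
  · rw [Rsp, Submodule.span_le]
    rintro _ ⟨x, hx, rfl⟩
    rw [SetLike.mem_coe, ← h.2] at hx
    rw [Set.range_comp]
    have : emb n x ∈ Submodule.map (emb n) (Submodule.span ℤ (Set.range b)) := ⟨x, hx, rfl⟩
    rw [Submodule.map_span] at this
    exact Submodule.span_le_restrictScalars ℤ ℝ _ this

variable {H : Type*} [NormedAddCommGroup H] [InnerProductSpace ℝ H]

theorem IsB.gd_le {ι κ : Type*} [Fintype ι] [DecidableEq ι] [Fintype κ] [DecidableEq κ]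
    {b : ι → Fin n → ℤ} {V} (h : IsB b V) {b' : κ → Fin n → ℤ} (hb' : LinearIndependent ℤ b')
    (hm : ∀ i, b' i ∈ Lam V) (hc : Fintype.card κ = Fintype.card ι)
    (ψ : EuclideanSpace ℝ (Fin n) →ₗ[ℝ] H) (hψ : Function.Injective ψ) :
    gd (ψ ∘ emb n ∘ b) ≤ gd (ψ ∘ emb n ∘ b') := by
  let e : κ ≃ ι := Fintype.equivOfCardEq hc
  rw [← gd_comp_equiv _ e]
  apply gd_le_of_mem
  · exact gd_pos ((li_emb.2 hb').map' ψ (LinearMap.ker_eq_bot.2 hψ))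
  · intro i
    have h1 := hm i
    rw [← (h.reindex e).2] at h1
    have : ((ψ.restrictScalars ℤ).comp (emb n)) (b' i) ∈
      Submodule.map ((ψ.restrictScalars ℤ).comp (emb n)) (Submodule.span ℤ (Set.range (b ∘ e))) :=
      ⟨_, h1, rfl⟩
    rw [Submodule.map_span, ← Set.range_comp] at this
    exact this

theorem IsB.gd_eq {ι κ : Type*} [Fintype ι] [DecidableEq ι] [Fintype κ] [DecidableEq κ]
    {b : ι → Fin n → ℤ} {V} (h : IsB b V) {b' : κ → Fin n → ℤ} (h' : IsB b' V)
    (ψ : EuclideanSpace ℝ (Fin n) →ₗ[ℝ] H) (hψ : Function.Injective ψ) :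
    gd (ψ ∘ emb n ∘ b) = gd (ψ ∘ emb n ∘ b') :=
  le_antisymm (h.gd_le h'.1 h'.mem (h'.card.trans h.card.symm) ψ hψ)
    (h'.gd_le h.1 h.mem (h.card.trans h'.card.symm) ψ hψ)

/-- a chosen basis of the integer points -/
def bas (V : Submodule ℚ (Fin n → ℚ)) : Fin (Module.finrank ℚ V) → Fin n → ℤ :=
  (exists_isB V).choose

theorem bas_isB (V : Submodule ℚ (Fin n → ℚ)) : IsB (bas V) V := (exists_isB V).choose_spec

/-- the (squared) covolume of the integer points of `V` after applying `ψ` -/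
def cov (ψ : EuclideanSpace ℝ (Fin n) →ₗ[ℝ] H) (V : Submodule ℚ (Fin n → ℚ)) : ℝ :=
  gd (ψ ∘ emb n ∘ bas V)

theorem cov_pos (ψ : EuclideanSpace ℝ (Fin n) →ₗ[ℝ] H) (hψ : Function.Injective ψ)
    (V : Submodule ℚ (Fin n → ℚ)) : 0 < cov ψ V :=
  gd_pos ((li_emb.2 (bas_isB V).1).map' ψ (LinearMap.ker_eq_bot.2 hψ))

theorem cov_le (ψ : EuclideanSpace ℝ (Fin n) →ₗ[ℝ] H) (hψ : Function.Injective ψ)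
    {V : Submodule ℚ (Fin n → ℚ)} {κ : Type*} [Fintype κ] [DecidableEq κ] {b' : κ → Fin n → ℤ}
    (hb' : LinearIndependent ℤ b') (hm : ∀ i, b' i ∈ Lam V)
    (hc : Fintype.card κ = Module.finrank ℚ V) : cov ψ V ≤ gd (ψ ∘ emb n ∘ b') :=
  (bas_isB V).gd_le hb' hm (by simpa using hc) ψ hψ

theorem cov_submod (ψ : EuclideanSpace ℝ (Fin n) →ₗ[ℝ] H) (hψ : Function.Injective ψ)
    (V W : Submodule ℚ (Fin n → ℚ)) :
    cov ψ (V ⊔ W) * cov ψ (V ⊓ W) ≤ cov ψ V * cov ψ W := by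
  obtain ⟨k, Y, hY⟩ := (bas_isB (V ⊓ W)).extend (inf_le_left : V ⊓ W ≤ V)
  obtain ⟨l, Z, hZ⟩ := (bas_isB (V ⊓ W)).extend (inf_le_right : V ⊓ W ≤ W)
  set X := bas (V ⊓ W) with hX
  have h := gd_fischer (ψ ∘ emb n ∘ X) (ψ ∘ emb n ∘ Y) (ψ ∘ emb n ∘ Z)
  have e1 : Sum.elim (ψ ∘ emb n ∘ X) (Sum.elim (ψ ∘ emb n ∘ Y) (ψ ∘ emb n ∘ Z)) =
      ψ ∘ emb n ∘ Sum.elim X (Sum.elim Y Z) := by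
    ext (i | i | i) <;> rfl
  have e2 : Sum.elim (ψ ∘ emb n ∘ X) (ψ ∘ emb n ∘ Y) = ψ ∘ emb n ∘ Sum.elim X Y := by
    ext (i | i) <;> rfl
  have e3 : Sum.elim (ψ ∘ emb n ∘ X) (ψ ∘ emb n ∘ Z) = ψ ∘ emb n ∘ Sum.elim X Z := by
    ext (i | i) <;> rfl
  rw [e1, e2, e3] at h
  have hcY := hY.card
  have hcZ := hZ.card
  simp only [Fintype.card_sum, Fintype.card_fin] at hcY hcZ
  have hadd := Submodule.finrank_sup_add_finrank_inf_eq V W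
  have hcard : Fintype.card (Fin (Module.finrank ℚ ↥(V ⊓ W)) ⊕ Fin k ⊕ Fin l) =
      Module.finrank ℚ ↥(V ⊔ W) := by
    simp only [Fintype.card_sum, Fintype.card_fin]
    omega
  have hmem : ∀ i, Sum.elim X (Sum.elim Y Z) i ∈ Lam (V ⊔ W) := by
    rintro (i | i | i)
    · exact Lam_mono (inf_le_left.trans le_sup_left) ((bas_isB (V ⊓ W)).mem i)
    · exact Lam_mono le_sup_left (hY.mem (Sum.inr i))
    · exact Lam_mono le_sup_right (hZ.mem (Sum.inr i))
  have hspan : Submodule.span ℚ (Set.range (castQ n ∘ Sum.elim X (Sum.elim Y Z))) = V ⊔ W := by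
    apply le_antisymm
    · rw [Submodule.span_le]
      rintro _ ⟨i, rfl⟩
      exact hmem i
    · apply sup_le
      · refine hY.spanQ.ge.trans (Submodule.span_mono ?_)
        rintro _ ⟨i | i, rfl⟩
        · exact ⟨Sum.inl i, rfl⟩
        · exact ⟨Sum.inr (Sum.inl i), rfl⟩
      · refine hZ.spanQ.ge.trans (Submodule.span_mono ?_)
        rintro _ ⟨i | i, rfl⟩
        · exact ⟨Sum.inl i, rfl⟩
        · exact ⟨Sum.inr (Sum.inr i), rfl⟩
  have hli : LinearIndependent ℤ (Sum.elim X (Sum.elim Y Z)) := by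
    rw [← li_castQ, linearIndependent_iff_card_eq_finrank_span, Set.finrank, hspan, hcard]
  have h1 := cov_le ψ hψ hli hmem hcard
  have h2 : cov ψ V = gd (ψ ∘ emb n ∘ Sum.elim X Y) := (bas_isB V).gd_eq hY ψ hψ
  have h3 : cov ψ W = gd (ψ ∘ emb n ∘ Sum.elim X Z) := (bas_isB W).gd_eq hZ ψ hψ
  rw [h2, h3]
  refine le_trans ?_ h
  exact mul_le_mul_of_nonneg_right h1 (gd_nonneg _)

end Lat

/-! ## Part V.4: the deformed covolumes -/

section Phi
variable {n : ℕ}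

/-- the deformation `x ↦ (x, e^q x·u)` -/
def phi (u : EuclideanSpace ℝ (Fin n)) (q : ℝ) :
    EuclideanSpace ℝ (Fin n) →ₗ[ℝ] WithLp 2 (EuclideanSpace ℝ (Fin n) × ℝ) where
  toFun x := WithLp.toLp 2 (x, Real.exp q * ⟪x, u⟫)
  map_add' x y := by
    rw [inner_add_left, mul_add]; rfl
  map_smul' c x := by
    rw [inner_smul_left]
    have : Real.exp q * ((starRingEnd ℝ) c * ⟪x, u⟫) = c * (Real.exp q * ⟪x, u⟫) := by
      simp; ring
    rw [this]; rfl

theorem phi_inner (u : EuclideanSpace ℝ (Fin n)) (q : ℝ) (x y) :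
    ⟪phi u q x, phi u q y⟫ = ⟪x, y⟫ + Real.exp q ^ 2 * (⟪x, u⟫ * ⟪y, u⟫) := by
  rw [WithLp.prod_inner_apply]
  simp [phi]
  ring

theorem phi_norm_sq (u : EuclideanSpace ℝ (Fin n)) (q : ℝ) (x) :
    ‖phi u q x‖ ^ 2 = ‖x‖ ^ 2 + (Real.exp q * ⟪x, u⟫) ^ 2 := by
  rw [← real_inner_self_eq_norm_sq, phi_inner, real_inner_self_eq_norm_sq]
  ring

theorem phi_inj (u : EuclideanSpace ℝ (Fin n)) (q : ℝ) : Function.Injective (phi u q) := by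
  intro x y h
  have := congrArg (fun z => (WithLp.ofLp z).1) h
  exact this

theorem norm_le_phi (u : EuclideanSpace ℝ (Fin n)) (q : ℝ) (x) : ‖x‖ ≤ ‖phi u q x‖ := by
  refine (pow_le_pow_iff_left₀ (by positivity) (norm_nonneg _) two_ne_zero).1 ?_
  rw [phi_norm_sq]
  nlinarith [sq_nonneg (Real.exp q * ⟪x, u⟫)]

theorem body_phi (u : EuclideanSpace ℝ (Fin n)) (q : ℝ) (x) (hx : ∀ k, ∃ m : ℤ, x k = (m : ℝ)) :
    InBody u q ‖phi u q x‖ x := by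
  refine (exists_body u q x hx).mono (max_le (norm_le_phi u q x) ?_)
  refine (pow_le_pow_iff_left₀ (by positivity) (norm_nonneg _) two_ne_zero).1 ?_
  rw [phi_norm_sq, mul_pow, sq_abs, ← mul_pow]
  nlinarith [sq_nonneg ‖x‖]

theorem phi_le_of_body {u : EuclideanSpace ℝ (Fin n)} {q lam : ℝ} {x} (h : InBody u q lam x) :
    ‖phi u q x‖ ^ 2 ≤ 2 * lam ^ 2 := by
  rw [phi_norm_sq]
  have h1 : ‖x‖ ^ 2 ≤ lam ^ 2 := by
    have := h.2.1
    gcongr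
  have h2 : (Real.exp q * ⟪x, u⟫) ^ 2 ≤ lam ^ 2 := by
    have : Real.exp q * |⟪x, u⟫| ≤ lam := by
      have := h.2.2
      rwa [Real.exp_neg, ← div_eq_mul_inv, le_div_iff₀ (Real.exp_pos q), mul_comm] at this
    rw [mul_pow, ← sq_abs ⟪x, u⟫, ← mul_pow]
    gcongr
  linarith

theorem gd_phi {ι : Type*} [Fintype ι] [DecidableEq ι] (u : EuclideanSpace ℝ (Fin n)) (q : ℝ)
    (b : ι → EuclideanSpace ℝ (Fin n)) (W : Submodule ℝ (EuclideanSpace ℝ (Fin n)))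
    (hW : Submodule.span ℝ (Set.range b) = W) :
    gd (phi u q ∘ b) = gd b *
      (1 + (Real.exp q * ‖W.starProjection u‖) ^ 2) := by
  set p := W.starProjection u with hp
  have hpW : p ∈ W := Submodule.starProjection_apply_mem _ _
  obtain ⟨c, hc⟩ := (Submodule.mem_span_range_iff_exists_fun ℝ).1 (hW.symm ▸ hpW)
  have hw : ∀ i, ⟪b i, u⟫ = ⟪b i, p⟫ := by
    intro i
    have := Submodule.starProjection_inner_eq_zero (K := W) u (b i)
      (hW ▸ Submodule.subset_span ⟨i, rfl⟩)
    rw [inner_sub_left, sub_eq_zero, ← hp] at this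
    rw [real_inner_comm, this, real_inner_comm]
  have hG : ∀ i, ⟪b i, p⟫ = ∑ k, ⟪b i, b k⟫ * c k := by
    intro i
    rw [← hc, inner_sum]
    refine Finset.sum_congr rfl fun k _ => ?_
    rw [inner_smul_right, mul_comm]
  have key : Matrix.gram ℝ (phi u q ∘ b) = Matrix.gram ℝ b *
      (1 + Matrix.replicateCol Unit (fun k => Real.exp q ^ 2 * c k) * Matrix.replicateRow Unit (fun k => ⟪b k, p⟫)) := by
    rw [mul_add, mul_one, ← Matrix.mul_assoc]
    ext i j
    simp only [Matrix.gram_apply, Function.comp_apply, Matrix.add_apply, phi_inner, Matrix.mul_apply,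
      Matrix.replicateCol_apply, Matrix.replicateRow_apply, Finset.univ_unique, Finset.sum_singleton]
    rw [hw, hw, hG i, Finset.sum_mul, Finset.mul_sum, Finset.sum_mul]
    congr 1
    refine Finset.sum_congr rfl fun k _ => ?_
    ring
  unfold gd
  rw [key, Matrix.det_mul, Matrix.det_one_add_replicateCol_mul_replicateRow]
  congr 2
  simp only [dotProduct]
  have : ⟪p, p⟫ = ∑ k, ⟪b k, p⟫ * c k := by
    conv_lhs => rw [← hc]
    rw [sum_inner]
    simp only [hc]
    refine Finset.sum_congr rfl fun k _ => ?_
    rw [inner_smul_left]; simp; ring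
  rw [mul_pow, ← real_inner_self_eq_norm_sq, this, Finset.mul_sum]
  refine Finset.sum_congr rfl fun k _ => ?_
  ring

/-- length of the projection of `u` on the real span of `V` -/
def rhoV (u : EuclideanSpace ℝ (Fin n)) (V : Submodule ℚ (Fin n → ℚ)) : ℝ := ‖(Rsp V).starProjection u‖

theorem rhoV_mono (u : EuclideanSpace ℝ (Fin n)) {V W : Submodule ℚ (Fin n → ℚ)} (h : V ≤ W) :
    rhoV u V ≤ rhoV u W := by
  have h1 : (Rsp V).starProjection u = (Rsp V).starProjection ((Rsp W).starProjection u) := by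
    have := Submodule.starProjection_comp_starProjection_of_le (Rsp_mono h)
    exact (DFunLike.congr_fun this u).symm
  rw [rhoV, h1]
  exact Submodule.norm_starProjection_apply_le _ _

/-- half the logarithm of the covolume -/
def alV (V : Submodule ℚ (Fin n → ℚ)) : ℝ := 1 / 2 * Real.log (cov LinearMap.id V)

theorem cov_phi (u : EuclideanSpace ℝ (Fin n)) (q : ℝ) (V : Submodule ℚ (Fin n → ℚ)) :
    cov (phi u q) V = cov LinearMap.id V * (1 + (Real.exp q * rhoV u V) ^ 2) := by
  exact gd_phi u q (emb n ∘ bas V) _ (bas_isB V).spanR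

/-- the model function of `V` -/
def fV (u : EuclideanSpace ℝ (Fin n)) (V : Submodule ℚ (Fin n → ℚ)) (q : ℝ) : ℝ :=
  alV V + Real.log (max 1 (Real.exp q * rhoV u V))

theorem fV_close (u : EuclideanSpace ℝ (Fin n)) (q : ℝ) (V : Submodule ℚ (Fin n → ℚ)) :
    fV u V q ≤ 1 / 2 * Real.log (cov (phi u q) V) ∧
    1 / 2 * Real.log (cov (phi u q) V) ≤ fV u V q + 1 / 2 * Real.log 2 := by
  have hc : 0 < cov LinearMap.id V := cov_pos _ (fun _ _ h => h) V
  have hs : 0 ≤ Real.exp q * rhoV u V := mul_nonneg (Real.exp_pos _).le (norm_nonneg _)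
  rw [cov_phi, fV, alV, Real.log_mul hc.ne' (by positivity)]
  set s := Real.exp q * rhoV u V with hs'
  set t := max 1 s with ht
  have h1 : 1 ≤ t := le_max_left _ _
  have h2 : s ≤ t := le_max_right _ _
  have e : Real.log t = 1 / 2 * Real.log (t ^ 2) := by rw [Real.log_pow]; push_cast; ring
  constructor
  · have : Real.log (t ^ 2) ≤ Real.log (1 + s ^ 2) := by
      apply Real.log_le_log (by positivity)
      rcases max_choice 1 s with h | h <;> rw [ht, h] <;> nlinarith [sq_nonneg s]
    linarith
  · have : Real.log (1 + s ^ 2) ≤ Real.log (2 * t ^ 2) := by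
      apply Real.log_le_log (by positivity)
      nlinarith
    rw [Real.log_mul (by norm_num) (by positivity)] at this
    linarith

end Phi

/-! ## Part V.5: the Harder-Narasimhan data attached to a point -/

section HNPoint
variable {n : ℕ}

theorem emb_inj : Function.Injective (emb n) := by
  intro x y h
  ext i
  have : emb n x i = emb n y i := by rw [h]
  rw [emb_apply, emb_apply] at this
  exact Int.cast_injective this

theorem one_le_norm_emb {x : Fin n → ℤ} (hx : x ≠ 0) : 1 ≤ ‖emb n x‖ := by
  obtain ⟨i, hi⟩ : ∃ i, x i ≠ 0 := by
    by_contra h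
    push Not at h
    exact hx (funext h)
  refine le_trans ?_ (PiLp.norm_apply_le (emb n x) i)
  rw [emb_apply, Real.norm_eq_abs, ← Int.cast_abs]
  exact_mod_cast Int.one_le_abs hi

theorem finite_emb (B : ℝ) : {x : Fin n → ℤ | ‖emb n x‖ ≤ B}.Finite := by
  apply (Set.Finite.pi' (fun _ : Fin n => Set.finite_Icc (-⌈B⌉) ⌈B⌉)).subset
  intro x hx i
  have h1 := (PiLp.norm_apply_le (emb n x) i).trans hx
  rw [emb_apply, Real.norm_eq_abs, abs_le] at h1
  have h2 := Int.le_ceil B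
  constructor
  · have : -((⌈B⌉ : ℤ) : ℝ) ≤ x i := by linarith
    exact_mod_cast this
  · have : (x i : ℝ) ≤ ((⌈B⌉ : ℤ) : ℝ) := by linarith
    exact_mod_cast this

theorem exists_red (n : ℕ) (H : Type*) [NormedAddCommGroup H] [InnerProductSpace ℝ H] (j : ℕ) :
    ∃ C : ℝ, 0 < C ∧
    ∀ (V : Submodule ℚ (Fin n → ℚ)) (ψ : EuclideanSpace ℝ (Fin n) →ₗ[ℝ] H), Module.finrank ℚ V = j →
      Function.Injective ψ → ∃ x : Fin j → Fin n → ℤ, LinearIndependent ℤ x ∧ (∀ i, x i ∈ Lam V) ∧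
        ∏ i, ‖ψ (emb n (x i))‖ ^ 2 ≤ C * cov ψ V := by
  obtain ⟨C, hC, hred⟩ := reduction (H := H) j
  refine ⟨C, hC, fun V ψ hV hψ => ?_⟩
  subst hV
  obtain ⟨b', h1, h2, h3⟩ := hred (ψ ∘ emb n ∘ bas V) (cov_pos ψ hψ V)
  have hx : ∀ i, ∃ x ∈ Lam V, ψ (emb n x) = b' i := by
    intro i
    have := h1 i
    have e : ψ ∘ emb n ∘ bas V = ((ψ.restrictScalars ℤ).comp (emb n)) ∘ bas V := rfl
    rw [e, Set.range_comp, ← Submodule.map_span, (bas_isB V).2] at this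
    obtain ⟨x, hx, hx2⟩ := this
    exact ⟨x, hx, hx2⟩
  choose x hx1 hx2 using hx
  refine ⟨x, ?_, hx1, ?_⟩
  · have hli : LinearIndependent ℝ b' := li_of_gd_pos (by rw [h2]; exact cov_pos ψ hψ V)
    have e : b' = ψ ∘ (emb n ∘ x) := by ext1 i; exact (hx2 i).symm
    rw [e] at hli
    exact li_emb.1 hli.of_comp
  · simp only [hx2]
    exact h3

theorem span_eq_of_li {j : ℕ} {V : Submodule ℚ (Fin n → ℚ)} (hV : Module.finrank ℚ V = j)
    {x : Fin j → Fin n → ℤ} (hx : LinearIndependent ℤ x) (hm : ∀ i, x i ∈ Lam V) :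
    Submodule.span ℚ (Set.range (castQ n ∘ x)) = V := by
  apply Submodule.eq_of_le_of_finrank_eq
  · rw [Submodule.span_le]
    rintro _ ⟨i, rfl⟩
    exact hm i
  · rw [finrank_span_eq_card (li_castQ.2 hx), hV, Fintype.card_fin]

theorem finite_cov (n j : ℕ) (B : ℝ) :
    {V : Submodule ℚ (Fin n → ℚ) | Module.finrank ℚ V = j ∧ cov LinearMap.id V ≤ B}.Finite := by
  obtain ⟨C, hC, hred⟩ := exists_red n (EuclideanSpace ℝ (Fin n)) j
  have hfin : (Set.pi Set.univ (fun _ : Fin j => {x : Fin n → ℤ | ‖emb n x‖ ≤ C * B})).Finite :=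
    Set.Finite.pi fun _ => finite_emb _
  apply (hfin.image (fun t => Submodule.span ℚ (Set.range (castQ n ∘ t)))).subset
  rintro V ⟨hV, hB⟩
  obtain ⟨x, hx1, hx2, hx3⟩ := hred V LinearMap.id hV (fun _ _ h => h)
  refine ⟨x, fun i _ => ?_, span_eq_of_li hV hx1 hx2⟩
  have hone : ∀ i, 1 ≤ ‖emb n (x i)‖ := fun i => one_le_norm_emb (hx1.ne_zero i)
  have h1 : ‖emb n (x i)‖ ^ 2 ≤ ∏ i, ‖emb n (x i)‖ ^ 2 := by
    rw [← Finset.mul_prod_erase _ _ (Finset.mem_univ i)]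
    apply le_mul_of_one_le_right (by positivity)
    exact Finset.prod_induction _ (fun t : ℝ => 1 ≤ t) (fun a b => one_le_mul_of_one_le_of_one_le)
      le_rfl fun k _ => one_le_pow₀ (hone k)
  have h2 : ‖emb n (x i)‖ ≤ ‖emb n (x i)‖ ^ 2 := by nlinarith [hone i]
  show ‖emb n (x i)‖ ≤ C * B
  calc _ ≤ _ := h2
    _ ≤ _ := h1
    _ ≤ C * cov LinearMap.id V := hx3
    _ ≤ C * B := by gcongr

theorem exists_rank (n j : ℕ) (hj : j ≤ n) : ∃ V : Submodule ℚ (Fin n → ℚ), Module.finrank ℚ V = j := by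
  have h := (Pi.basisFun ℚ (Fin n)).linearIndependent.comp _ (Fin.castLE_injective hj)
  exact ⟨_, by rw [finrank_span_eq_card h, Fintype.card_fin]⟩

/-- the corrected model function -/
def gV (u : EuclideanSpace ℝ (Fin n)) (V : Submodule ℚ (Fin n → ℚ)) (q : ℝ) : ℝ :=
  fV u V q + Real.log 2 / 2 * ((Module.finrank ℚ V : ℝ) * (n - Module.finrank ℚ V))

theorem fV_sub (u : EuclideanSpace ℝ (Fin n)) (V W : Submodule ℚ (Fin n → ℚ)) (q : ℝ) :
    fV u (V ⊔ W) q + fV u (V ⊓ W) q ≤ fV u V q + fV u W q + Real.log 2 := by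
  have h1 := (fV_close u q (V ⊔ W)).1
  have h2 := (fV_close u q (V ⊓ W)).1
  have h3 := (fV_close u q V).2
  have h4 := (fV_close u q W).2
  have h := cov_submod (phi u q) (phi_inj u q) V W
  have p := fun V => cov_pos (phi u q) (phi_inj u q) V
  have h5 := Real.log_le_log (mul_pos (p _) (p _)) h
  rw [Real.log_mul (p _).ne' (p _).ne', Real.log_mul (p _).ne' (p _).ne'] at h5
  linarith

theorem gV_sub (u : EuclideanSpace ℝ (Fin n)) (V W : Submodule ℚ (Fin n → ℚ)) (q : ℝ) :
    gV u (V ⊔ W) q + gV u (V ⊓ W) q ≤ gV u V q + gV u W q := by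
  by_cases h1 : V ≤ W
  · rw [sup_eq_right.2 h1, inf_eq_left.2 h1, add_comm]
  by_cases h2 : W ≤ V
  · rw [sup_eq_left.2 h2, inf_eq_right.2 h2]
  have a1 : Module.finrank ℚ ↥(V ⊓ W) < Module.finrank ℚ V :=
    Submodule.finrank_lt_finrank_of_lt (lt_of_le_of_ne inf_le_left fun h => h1 (inf_eq_left.1 h))
  have a2 : Module.finrank ℚ ↥(V ⊓ W) < Module.finrank ℚ W :=
    Submodule.finrank_lt_finrank_of_lt (lt_of_le_of_ne inf_le_right fun h => h2 (inf_eq_right.1 h))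
  have a3 := Submodule.finrank_sup_add_finrank_inf_eq V W
  have h := fV_sub u V W q
  simp only [gV]
  have b1 : (Module.finrank ℚ ↥(V ⊓ W) : ℝ) + 1 ≤ Module.finrank ℚ V := by exact_mod_cast a1
  have b2 : (Module.finrank ℚ ↥(V ⊓ W) : ℝ) + 1 ≤ Module.finrank ℚ W := by exact_mod_cast a2
  have b3 : (Module.finrank ℚ ↥(V ⊔ W) : ℝ) + Module.finrank ℚ ↥(V ⊓ W) =
    Module.finrank ℚ V + Module.finrank ℚ W := by exact_mod_cast a3
  generalize (Module.finrank ℚ ↥(V ⊓ W) : ℝ) = a at *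
  generalize (Module.finrank ℚ ↥(V ⊔ W) : ℝ) = d at *
  generalize (Module.finrank ℚ V : ℝ) = b at *
  generalize (Module.finrank ℚ W : ℝ) = c at *
  have hd : d = b + c - a := by linarith
  subst hd
  have hl : 0 ≤ Real.log 2 := Real.log_nonneg (by norm_num)
  have hbc : 1 ≤ (b - a) * (c - a) := by nlinarith
  have := mul_le_mul_of_nonneg_left hbc hl
  nlinarith

theorem Rsp_top : Rsp (⊤ : Submodule ℚ (Fin n → ℚ)) = ⊤ := by
  apply Submodule.eq_top_of_finrank_eq
  rw [← (bas_isB (⊤ : Submodule ℚ (Fin n → ℚ))).spanR, finrank_span_eq_card (li_emb.2 (bas_isB _).1)]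
  simp

theorem hnData (u : EuclideanSpace ℝ (Fin n)) (hu : u ≠ 0) :
    HNData n (fun V : Submodule ℚ (Fin n → ℚ) => Module.finrank ℚ V) (gV u) (-Real.log ‖u‖)
      (alV (⊤ : Submodule ℚ (Fin n → ℚ)) + Real.log ‖u‖) where
  rk_strict v w h := Submodule.finrank_lt_finrank_of_lt h
  rk_le v := by simpa using Submodule.finrank_le v
  rk_add v w := Submodule.finrank_sup_add_finrank_inf_eq v w
  mono v w hvw q q' hq := by
    have h1 := rhoV_mono u hvw
    have h0 : 0 ≤ rhoV u v := norm_nonneg _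
    simp only [gV, fV]
    generalize rhoV u v = r at *
    generalize rhoV u w = s at *
    have hx : Real.exp q ≤ Real.exp q' := Real.exp_le_exp.2 hq
    have hx0 := Real.exp_pos q
    generalize Real.exp q = x at *
    generalize Real.exp q' = y at *
    have m1 : ∀ t : ℝ, 0 < max 1 t := fun t => lt_max_of_lt_left one_pos
    have key : max 1 (x * s) * max 1 (y * r) ≤ max 1 (y * s) * max 1 (x * r) := by
      have e1 : x * s ≤ y * s := by nlinarith
      have e2 : x * r ≤ y * r := by nlinarith
      have e3 : x * r ≤ x * s := by nlinarith
      have e4 : y * r ≤ y * s := by nlinarith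
      rcases le_total (x * s) 1 with h | h
      · rw [max_eq_left h, max_eq_left (e3.trans h), one_mul, mul_one]
        exact max_le_max le_rfl e4
      · rw [max_eq_right h, max_eq_right (h.trans e1)]
        rcases le_total (y * r) 1 with h' | h'
        · rw [max_eq_left h', max_eq_left (e2.trans h')]; linarith
        · rw [max_eq_right h']
          have : x * r ≤ max 1 (x * r) := le_max_right _ _
          have h3 : 0 ≤ y * s := by nlinarith
          calc x * s * (y * r) = y * s * (x * r) := by ring
            _ ≤ _ := by gcongr
    have := Real.log_le_log (mul_pos (m1 _) (m1 _)) key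
    rw [Real.log_mul (m1 _).ne' (m1 _).ne', Real.log_mul (m1 _).ne' (m1 _).ne'] at this
    linarith
  min q j hj := by
    obtain ⟨V0, hV0⟩ := exists_rank n j hj
    set S := {V : Submodule ℚ (Fin n → ℚ) | Module.finrank ℚ V = j ∧
      cov LinearMap.id V ≤ Real.exp (2 * fV u V0 q)} with hS
    have hal : ∀ V : Submodule ℚ (Fin n → ℚ), alV V ≤ fV u V q := fun V => by
      have : 0 ≤ Real.log (max 1 (Real.exp q * rhoV u V)) := Real.log_nonneg (le_max_left _ _)
      simp only [fV]; linarith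
    have hmem : ∀ V : Submodule ℚ (Fin n → ℚ), Module.finrank ℚ V = j → fV u V q ≤ fV u V0 q → V ∈ S := by
      intro V h1 h2
      refine ⟨h1, ?_⟩
      have hc := cov_pos (LinearMap.id) (fun _ _ h => h) V
      rw [← Real.log_le_iff_le_exp hc]
      have := hal V
      simp only [alV] at this
      linarith
    obtain ⟨V, hV, hmin⟩ := Set.exists_min_image S (fun V => fV u V q) (finite_cov n j _)
      ⟨V0, hmem V0 hV0 le_rfl⟩
    refine ⟨V, hV.1, fun W hW => ?_⟩
    have hVW : fV u V q ≤ fV u W q := by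
      by_cases h : fV u W q ≤ fV u V0 q
      · exact hmin W (hmem W hW h)
      · exact (hmin V0 (hmem V0 hV0 le_rfl)).trans (le_of_not_ge h)
    simp only [gV]
    rw [hW, hV.1]
    linarith
  sub v w q := gV_sub u v w q
  form v a m b ham hmb := by
    simp only [gV, fV]
    have h0 : 0 ≤ rhoV u v := norm_nonneg _
    generalize rhoV u v = r at *
    rcases le_total (Real.exp m * r) 1 with h | h
    · left
      have : Real.exp a * r ≤ Real.exp m * r := by gcongr
      rw [max_eq_left h, max_eq_left (this.trans h)]
    · right
      have h2 : Real.exp m * r ≤ Real.exp b * r := by gcongr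
      have hr : r ≠ 0 := by
        rintro rfl
        simp at h
        linarith
      rw [max_eq_right h, max_eq_right (h.trans h2), Real.log_mul (Real.exp_pos _).ne' hr,
        Real.log_mul (Real.exp_pos _).ne' hr, Real.log_exp, Real.log_exp]
      ring
  zero v q hv := by
    have hb : v = ⊥ := Submodule.finrank_eq_zero.1 hv
    have h1 : rhoV u v = 0 := by
      have h3 : Rsp v = ⊥ := by
        rw [Rsp, Submodule.span_eq_bot]
        rintro _ ⟨x, hx, rfl⟩
        have : castQ n x ∈ v := hx
        rw [hb, Submodule.mem_bot] at this
        rw [castQ_inj (this.trans (map_zero _).symm), map_zero]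
      have h4 : (Rsp v).starProjection u ∈ Rsp v := Submodule.starProjection_apply_mem _ _
      rw [rhoV, norm_eq_zero]
      exact (Submodule.mem_bot ℝ).1 (h3.le h4)
    have h2 : cov LinearMap.id v = 1 := by
      have : IsEmpty (Fin (Module.finrank ℚ v)) := by rw [hv]; infer_instance
      exact Matrix.det_isEmpty
    simp [gV, fV, alV, h1, h2, hv]
  top v q hv hq := by
    have hb : v = ⊤ := Submodule.eq_top_of_finrank_eq (by simpa using hv)
    have hn0 : 0 < ‖u‖ := norm_pos_iff.2 hu
    have h1 : rhoV u v = ‖u‖ := by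
      have : (Rsp v).starProjection u = u := by
        apply Submodule.starProjection_eq_self_iff.2
        rw [hb, Rsp_top]; trivial
      rw [rhoV, this]
    have h2 : 1 ≤ Real.exp q * ‖u‖ := by
      have := Real.exp_le_exp.2 hq
      rw [Real.exp_neg, Real.exp_log hn0, inv_le_iff_one_le_mul₀ hn0] at this
      exact this
    simp only [gV, fV, h1, hv]
    rw [max_eq_right h2, Real.log_mul (Real.exp_pos _).ne' hn0.ne', Real.log_exp, hb]
    ring

end HNPoint

/-! ## Part V.6: comparison with successive minima -/

section Compare
variable {n : ℕ}

theorem exists_emb (z : EuclideanSpace ℝ (Fin n)) (hz : ∀ k, ∃ m : ℤ, z k = (m : ℝ)) :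
    ∃ x, emb n x = z := by
  choose x hx using hz
  exact ⟨x, by ext k; rw [emb_apply, hx]⟩

theorem emb_int (x : Fin n → ℤ) : ∀ k, ∃ m : ℤ, emb n x k = (m : ℝ) := fun k => ⟨x k, rfl⟩

/-- upper bound for the minimal model value -/
theorem exists_low (u : EuclideanSpace ℝ (Fin n)) (q : ℝ) {j : ℕ} (hj : j ≤ n) :
    ∃ V : Submodule ℚ (Fin n → ℚ), Module.finrank ℚ V = j ∧
      fV u V q ≤ ∑ i ∈ Finset.range j, Real.log (lamMin n u q (i + 1)) + j * (1 / 2 * Real.log 8) := by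
  obtain ⟨z, hz, hb⟩ := exists_greedy u q j hj
  choose x hx using fun i => exists_emb (z i) (hb i).1
  have hxz : emb n ∘ x = z := funext hx
  have hli : LinearIndependent ℤ x := li_emb.1 (by rw [hxz]; exact hz)
  have hr : Module.finrank ℚ (Submodule.span ℚ (Set.range (castQ n ∘ x))) = j := by
    rw [finrank_span_eq_card (li_castQ.2 hli), Fintype.card_fin]
  refine ⟨_, hr, ?_⟩
  set V := Submodule.span ℚ (Set.range (castQ n ∘ x)) with hV
  have h1 : cov (phi u q) V ≤ gd (phi u q ∘ emb n ∘ x) :=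
    cov_le _ (phi_inj u q) hli (fun i => Submodule.subset_span ⟨i, rfl⟩) (by simp [hr])
  have hl : ∀ i : Fin j, 1 ≤ lamMin n u q (i + 1) := fun i => one_le_lamMin u q (by omega)
  have h2 : gd (phi u q ∘ emb n ∘ x) ≤ ∏ i : Fin j, (8 * lamMin n u q (i + 1) ^ 2) := by
    rw [hxz]
    refine (gd_hadamard _).trans (Finset.prod_le_prod (fun i _ => by positivity) fun i _ => ?_)
    have := phi_le_of_body (hb i)
    rw [Function.comp_apply]
    linarith
  have h3 := Real.log_le_log (cov_pos _ (phi_inj u q) V) (h1.trans h2)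
  rw [Real.log_prod (fun i _ => by have := hl i; positivity)] at h3
  have h4 : ∑ i : Fin j, Real.log (8 * lamMin n u q (i + 1) ^ 2) =
      j * Real.log 8 + 2 * ∑ i ∈ Finset.range j, Real.log (lamMin n u q (i + 1)) := by
    rw [← Fin.sum_univ_eq_sum_range (fun i => Real.log (lamMin n u q (i + 1))), Finset.mul_sum]
    have : ∀ i : Fin j, Real.log (8 * lamMin n u q (i + 1) ^ 2) =
        Real.log 8 + 2 * Real.log (lamMin n u q (i + 1)) := fun i => by
      have := hl i
      rw [Real.log_mul (by norm_num) (by positivity), Real.log_pow]; push_cast; ring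
    simp only [this, Finset.sum_add_distrib]
    simp
  have h5 := (fV_close u q V).1
  linarith

/-- lower bound for all model values -/
theorem exists_high (n j : ℕ) (hj : j ≤ n) : ∃ C : ℝ, ∀ (u : EuclideanSpace ℝ (Fin n)) (q : ℝ)
    (V : Submodule ℚ (Fin n → ℚ)), Module.finrank ℚ V = j →
      ∑ i ∈ Finset.range j, Real.log (lamMin n u q (i + 1)) ≤ fV u V q + C := by
  obtain ⟨C, hC, hred⟩ := exists_red n (WithLp 2 (EuclideanSpace ℝ (Fin n) × ℝ)) j
  refine ⟨1 / 2 * Real.log C + 1 / 2 * Real.log 2, fun u q V hV => ?_⟩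
  obtain ⟨x, hx1, hx2, hx3⟩ := hred V (phi u q) hV (phi_inj u q)
  set y : Fin j → ℝ := fun i => ‖phi u q (emb n (x i))‖ with hy
  have hy1 : ∀ i, 1 ≤ y i := fun i => (one_le_norm_emb (hx1.ne_zero i)).trans (norm_le_phi u q _)
  set σ := Tuple.sort y with hσ
  have hm : Monotone (y ∘ σ) := Tuple.monotone_sort y
  have h1 : ∀ i : Fin j, lamMin n u q (i + 1) ≤ y (σ i) := by
    intro i
    have hle : (i : ℕ) + 1 ≤ j := i.2
    refine lamMin_le (hy1 _) (fun k : Fin (i + 1) => emb n (x (σ (Fin.castLE hle k)))) ?_ ?_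
    · exact (li_emb.2 hx1).comp (fun k => σ (Fin.castLE hle k))
        (σ.injective.comp (Fin.castLE_injective hle))
    · intro k
      refine (body_phi u q _ (emb_int _)).mono ?_
      apply hm
      rw [Fin.le_def]
      simp only [Fin.val_castLE]
      omega
  have h2 : ∑ i ∈ Finset.range j, Real.log (lamMin n u q (i + 1)) ≤ ∑ i, Real.log (y i) := by
    rw [← Fin.sum_univ_eq_sum_range (fun i => Real.log (lamMin n u q (i + 1))),
      ← Equiv.sum_comp σ (fun i => Real.log (y i))]
    refine Finset.sum_le_sum fun i _ => Real.log_le_log ?_ (h1 i)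
    have := one_le_lamMin u q (i := i + 1) (by omega)
    linarith
  have hyp : ∀ i, 0 < y i := fun i => one_pos.trans_le (hy1 i)
  have h3 : 2 * ∑ i, Real.log (y i) ≤ Real.log C + Real.log (cov (phi u q) V) := by
    have hc := cov_pos _ (phi_inj u q) V
    have := Real.log_le_log (Finset.prod_pos fun i _ => pow_pos (hyp i) 2) hx3
    rw [Real.log_prod (fun i _ => (pow_pos (hyp i) 2).ne'), Real.log_mul hC.ne' hc.ne'] at this
    simp only [Real.log_pow] at this
    rw [Finset.mul_sum]
    exact_mod_cast this
  have h4 := (fV_close u q V).2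
  linarith

theorem inner_ne_zero {u : EuclideanSpace ℝ (Fin n)} (hu : LinearIndependent ℚ (fun i => u i))
    {x : Fin n → ℤ} (hx : x ≠ 0) : ⟪emb n x, u⟫ ≠ 0 := by
  intro h
  apply hx
  have h1 : ∑ i, (x i : ℚ) • u i = 0 := by
    rw [← h, PiLp.inner_apply]
    refine Finset.sum_congr rfl fun i _ => ?_
    rw [emb_apply, Rat.smul_def]
    simp [mul_comm]
  have := Fintype.linearIndependent_iff.1 hu _ h1
  funext i
  exact_mod_cast this i

theorem lamMin_one_tendsto (hn : 0 < n) {u : EuclideanSpace ℝ (Fin n)}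
    (hu : LinearIndependent ℚ (fun i => u i)) :
    Tendsto (fun q => Real.log (lamMin n u q 1)) atTop atTop := by
  rw [tendsto_atTop]
  intro B
  have hfin : {x : Fin n → ℤ | ‖emb n x‖ ≤ 2 * Real.exp B}.Finite := finite_emb _
  have hev : ∀ x ∈ {x : Fin n → ℤ | ‖emb n x‖ ≤ 2 * Real.exp B}, ∀ᶠ q : ℝ in atTop,
      x ≠ 0 → 2 * Real.exp B * Real.exp (-q) < |⟪emb n x, u⟫| := by
    intro x _
    by_cases hx : x = 0
    · exact Eventually.of_forall fun q h => absurd hx h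
    · have ht : Tendsto (fun q : ℝ => 2 * Real.exp B * Real.exp (-q)) atTop (nhds (2 * Real.exp B * 0)) :=
        (Real.tendsto_exp_atBot.comp tendsto_neg_atTop_atBot).const_mul _
      rw [mul_zero] at ht
      filter_upwards [ht.eventually_lt_const (abs_pos.2 (inner_ne_zero hu hx))] with q hq _ using hq
  filter_upwards [(Set.Finite.eventually_all hfin).2 hev] with q hq
  by_contra hlt
  push Not at hlt
  have h1 : 1 ≤ lamMin n u q 1 := one_le_lamMin u q hn
  have h2 : lamMin n u q 1 < Real.exp B := (Real.log_lt_iff_lt_exp (by linarith)).1 hlt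
  obtain ⟨v, hv, hb⟩ := exists_lamMin_family u q (i := 1) hn
  obtain ⟨x, hx⟩ := exists_emb (v 0) (hb 0).1
  have hb' := (hb 0).mono (show 2 * lamMin n u q 1 ≤ 2 * Real.exp B by linarith)
  rw [← hx] at hb'
  have hx0 : x ≠ 0 := by
    rintro rfl
    rw [map_zero] at hx
    exact hv.ne_zero 0 hx.symm
  have := hq x hb'.2.1 hx0
  linarith [hb'.2.2]

theorem point_weakG (hn : 0 < n) {u : EuclideanSpace ℝ (Fin n)}
    (hu : LinearIndependent ℚ (fun i => u i)) :
    ∃ q0 F, WeakG n q0 F ∧ ∃ C', ∀ q, q0 ≤ q → ∀ i : Fin n, |F q i - Lu n u q i| ≤ C' := by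
  have hu0 : u ≠ 0 := by
    rintro rfl
    exact hu.ne_zero ⟨0, hn⟩ rfl
  have h := hnData u hu0
  choose! C hC using exists_high n
  set K : ℝ := ∑ j ∈ Finset.range (n + 1), |C j| + n * (1 / 2 * Real.log 8) +
    Real.log 2 / 2 * (n * n) with hK
  have l2 : 0 ≤ Real.log 2 := Real.log_nonneg (by norm_num)
  have l8 : 0 ≤ Real.log 8 := Real.log_nonneg (by norm_num)
  have hCs : 0 ≤ ∑ j ∈ Finset.range (n + 1), |C j| := Finset.sum_nonneg fun _ _ => abs_nonneg _
  have hK0 : 0 ≤ K := by positivity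
  obtain ⟨q0, F, hF, C', hC'⟩ := h.weakG hn (L := fun q i => Real.log (lamMin n u q (i + 1)))
    (fun q i j hij hj => Lu_mono u q (a := ⟨i, by omega⟩) (b := ⟨j, hj⟩) hij)
    (lamMin_one_tendsto hn hu) hK0 (fun q _ j hj => by
      have hjR : (j : ℝ) ≤ n := by exact_mod_cast hj
      have hj0 : (0 : ℝ) ≤ j := by positivity
      have hcorr : 0 ≤ Real.log 2 / 2 * ((j : ℝ) * (n - j)) ∧
          Real.log 2 / 2 * ((j : ℝ) * (n - j)) ≤ Real.log 2 / 2 * (n * n) := by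
        constructor
        · have : 0 ≤ (n : ℝ) - j := by linarith
          positivity
        · gcongr
          linarith
      have hCj : |C j| ≤ ∑ j ∈ Finset.range (n + 1), |C j| :=
        Finset.single_le_sum (f := fun j => |C j|) (fun _ _ => abs_nonneg _)
          (Finset.mem_range.2 (by omega))
      rw [abs_le]
      constructor
      · have e1 := h.mv_rk q hj
        have e2 := hC j hj u q (h.mv q j) e1
        have e3 : h.p q j = fV u (h.mv q j) q + Real.log 2 / 2 * ((j : ℝ) * (n - j)) := by
          have e4 : h.p q j = gV u (h.mv q j) q := rfl
          rw [e4, gV, e1]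
        have := le_abs_self (C j)
        have : 0 ≤ (n : ℝ) * (1 / 2 * Real.log 8) := by positivity
        have : 0 ≤ Real.log 2 / 2 * ((n : ℝ) * n) := by positivity
        rw [e3]
        linarith
      · obtain ⟨V, hV, hle⟩ := exists_low u q hj
        have e2 := h.p_le q V
        simp only [hV, gV] at e2
        have : (j : ℝ) * (1 / 2 * Real.log 8) ≤ n * (1 / 2 * Real.log 8) := by gcongr
        linarith)
  exact ⟨q0, F, hF, C', fun q hq i => hC' q hq i i.2⟩

end Compare

theorem tendsto_div_of_bdd {f : ℝ → ℝ} {q0 C : ℝ} (h : ∀ q, q0 ≤ q → |f q| ≤ C) :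
    Tendsto (fun q => f q / q) atTop (nhds 0) := by
  have h1 : Tendsto (fun q : ℝ => C / q) atTop (nhds 0) := tendsto_const_nhds.div_atTop tendsto_id
  apply squeeze_zero_norm' _ h1
  filter_upwards [eventually_ge_atTop q0, eventually_gt_atTop 0] with q hq hq0
  rw [Real.norm_eq_abs, abs_div, abs_of_pos hq0]
  gcongr
  exact h q hq

theorem stmt_5 (n m : ℕ) (hn : 2 ≤ n) (hm : 1 ≤ m)
    (T : (Fin n → ℝ) →ₗ[ℝ] (Fin m → ℝ)) (δ : ℝ) (hδ : 0 < δ) :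
    spectrumOf n m T =
      {y | ∃ q₀ : ℝ, 0 ≤ q₀ ∧ ∃ P : ℝ → Fin n → ℝ, IsNSystem n (Ici q₀) P ∧
        IsProper n P ∧ IsRigid n δ q₀ P ∧ y = muVec (fun x => T x) P} ∧
    spectrumOf n m T =
      {y | ∃ q₀ : ℝ, 0 ≤ q₀ ∧ ∃ P : ℝ → Fin n → ℝ, IsNSystem n (Ici q₀) P ∧
        IsProper n P ∧ y = muVec (fun x => T x) P} ∧
    spectrumOf n m T =
      {y | ∃ q₀ : ℝ, 0 ≤ q₀ ∧ ∃ P : ℝ → Fin n → ℝ, IsGenNSystem n (Ici q₀) P ∧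
        IsProper n P ∧ y = muVec (fun x => T x) P} := by
  have hn0 : 0 < n := by omega
  have hAR : spectrumOf n m T ⊆
      {y | ∃ q₀ : ℝ, 0 ≤ q₀ ∧ ∃ P : ℝ → Fin n → ℝ, IsNSystem n (Ici q₀) P ∧
        IsProper n P ∧ IsRigid n δ q₀ P ∧ y = muVec (fun x => T x) P} := by
    rintro y ⟨u, hu, rfl⟩
    obtain ⟨q0, F, hF, C, hC⟩ := point_weakG hn0 hu
    obtain ⟨p, hp⟩ := Track.track hδ hF hn0
    refine ⟨p.τ δ 0, p.τ_nonneg δ hδ 0, p.P δ, p.isNSystem δ hδ, p.P_proper δ hδ, p.isRigid δ hδ, ?_⟩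
    apply muVec_congr
    intro i
    have h1 := tendsto_div_of_bdd (f := fun q => F q i - Lu n u q i) (fun q hq => hC q hq i)
    have h2 := ((hp i).add h1).neg
    rw [add_zero, neg_zero] at h2
    refine h2.congr fun q => ?_
    ring
  have hRN : {y | ∃ q₀ : ℝ, 0 ≤ q₀ ∧ ∃ P : ℝ → Fin n → ℝ, IsNSystem n (Ici q₀) P ∧
        IsProper n P ∧ IsRigid n δ q₀ P ∧ y = muVec (fun x => T x) P} ⊆
      {y | ∃ q₀ : ℝ, 0 ≤ q₀ ∧ ∃ P : ℝ → Fin n → ℝ, IsNSystem n (Ici q₀) P ∧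
        IsProper n P ∧ y = muVec (fun x => T x) P} := by
    rintro y ⟨q0, hq0, P, h1, h2, -, h3⟩
    exact ⟨q0, hq0, P, h1, h2, h3⟩
  have hNG : {y | ∃ q₀ : ℝ, 0 ≤ q₀ ∧ ∃ P : ℝ → Fin n → ℝ, IsNSystem n (Ici q₀) P ∧
        IsProper n P ∧ y = muVec (fun x => T x) P} ⊆
      {y | ∃ q₀ : ℝ, 0 ≤ q₀ ∧ ∃ P : ℝ → Fin n → ℝ, IsGenNSystem n (Ici q₀) P ∧
        IsProper n P ∧ y = muVec (fun x => T x) P} := by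
    rintro y ⟨q0, hq0, P, h1, h2, h3⟩
    exact ⟨q0, hq0, P, h1.isGen h2, h2, h3⟩
  have hGA : {y | ∃ q₀ : ℝ, 0 ≤ q₀ ∧ ∃ P : ℝ → Fin n → ℝ, IsGenNSystem n (Ici q₀) P ∧
        IsProper n P ∧ y = muVec (fun x => T x) P} ⊆ spectrumOf n m T := by
    rintro y ⟨q0, hq0, P, h1, h2, rfl⟩
    obtain ⟨p, hp⟩ := Track.track hδ (h1.weakG hn0 h2) hn0
    obtain ⟨u, hu, C, hC⟩ := p.exists_point δ hδ
    refine ⟨u, hu, ?_⟩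
    apply muVec_congr
    intro i
    have h3 := tendsto_div_of_bdd (f := fun q => Lu n u q i - p.P δ q i) (fun q hq => hC q hq i)
    have h4 := ((hp i).add h3).neg
    rw [add_zero, neg_zero] at h4
    refine h4.congr fun q => ?_
    simp only [i.2, dite_true]
    ring
  exact ⟨hAR.antisymm (hRN.trans (hNG.trans hGA)), (hAR.trans hRN).antisymm (hNG.trans hGA),
    (hAR.trans (hRN.trans hNG)).antisymm hGA⟩
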